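/- arXiv:2012.15509 — 6 statements merged into one kernel-verified Lean document; each statement's English description precedes it below -/
import Mathlib

section
/- Let n be a positive integer and let p be an odd prime with p ∤ n. Then ord_n(p) = φ(n)/4 with φ(n)/4 odd if and only if one of the following holds: (a) n = 8 and p ≡ 1 (mod 8); (b) n = q^r or n = 2q^r for some odd prime q with q ≡ 5 (mod 8) and r ≥ 1, and ord_{q^{ε(r)}}(p) = q^{ε(r)−1}(q−1)/4; (c) n = q₁^{r₁}q₂^{r₂} or n = 2q₁^{r₁}q₂^{r₂} for distinct odd primes q₁, q₂ with q₁ ≡ 3 (mod 4) and q₂ ≡ 3 (mod 4) and r₁, r₂ ≥ 1, and either [p is a primitive root of q₁^{ε(r₁)}, ord_{q₂^{ε(r₂)}}(p) = q₂^{ε(r₂)−1}(q₂−1)/2, and gcd(q₁^{ε(r₁)−1}(q₁−1), q₂^{ε(r₂)−1}(q₂−1)/2) = 2] or [ord_{q₁^{ε(r₁)}}(p) = q₁^{ε(r₁)−1}(q₁−1)/2, ord_{q₂^{ε(r₂)}}(p) = q₂^{ε(r₂)−1}(q₂−1)/2, and gcd(q₁^{ε(r₁)−1}(q₁−1)/2,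 q₂^{ε(r₂)−1}(q₂−1)/2) = 1]; (d) n = 4q^r for some prime q with q ≡ 3 (mod 4) and r ≥ 1, p ≡ 1 (mod 4), and ord_{q^r}(p) = q^{r−1}(q−1)/2. -/
/-- `eps r = 1` if `r = 1` and `eps r = 2` if `r ≥ 2`. -/
def eps (r : ℕ) : ℕ := if r = 1 then 1 else 2

lemma ord_dvd_tot (n p : ℕ) (h : Nat.Coprime p n) : orderOf (p : ZMod n) ∣ Nat.totient n := by
  apply orderOf_dvd_of_pow_eq_one
  have := ZMod.pow_totient (ZMod.unitOfCoprime p h)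
  have h2 := congrArg (Units.val) this
  rw [Units.val_pow_eq_pow_val, ZMod.coe_unitOfCoprime, Units.val_one] at h2
  exact h2

lemma ord_mul (a b p : ℕ) (h : Nat.Coprime a b) :
    orderOf (p : ZMod (a * b)) = Nat.lcm (orderOf (p : ZMod a)) (orderOf (p : ZMod b)) := by
  have h1 := MulEquiv.orderOf_eq (ZMod.chineseRemainder h).toMulEquiv (p : ZMod (a * b))
  rw [← h1]
  have h2 : (ZMod.chineseRemainder h).toMulEquiv (p : ZMod (a * b)) = ((p : ZMod a), (p : ZMod b)) := by
    have := map_natCast (ZMod.chineseRemainder h) p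
    exact this
  rw [h2, Prod.orderOf_mk]

lemma ord_one_iff (n p : ℕ) (hn : 1 < n) : orderOf (p : ZMod n) = 1 ↔ p % n = 1 := by
  rw [orderOf_eq_one_iff, show (1 : ZMod n) = ((1 : ℕ) : ZMod n) by simp,
    ZMod.natCast_eq_natCast_iff, Nat.ModEq, Nat.mod_eq_of_lt hn]

lemma gcd_step (t q b c r : ℕ) (hq : q.Prime) (hr : 2 ≤ r) (hc : Nat.Coprime c q) :
    Nat.gcd (q ^ (r - 1) * b) t = c ↔ Nat.gcd (q ^ 1 * b) t = c := by
  have key : ∀ s, 1 ≤ s → (Nat.gcd (q ^ s * b) t = c ↔ (¬ q ∣ t ∧ Nat.gcd b t = c)) := by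
    intro s hs
    constructor
    · intro h
      have hqt : ¬ q ∣ t := by
        intro hd
        have : q ∣ c := h ▸ Nat.dvd_gcd (Dvd.dvd.mul_right (dvd_pow_self q (by omega)) b) hd
        have := Nat.dvd_gcd this (dvd_refl q)
        rw [hc] at this
        exact hq.one_lt.ne' (Nat.dvd_one.mp this)
      refine ⟨hqt, ?_⟩
      rw [← h]
      exact (Nat.Coprime.gcd_mul_left_cancel b
        (Nat.Coprime.pow_left s ((Nat.Prime.coprime_iff_not_dvd hq).2 hqt))).symm
    · rintro ⟨hqt, h⟩
      rw [← h]
      exact (Nat.Coprime.gcd_mul_left_cancel b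
        (Nat.Coprime.pow_left s ((Nat.Prime.coprime_iff_not_dvd hq).2 hqt)))
  rw [key _ (by omega), key 1 le_rfl]

lemma cyc_ord {G : Type*} [Group G] [Finite G] (g : G) (hg : orderOf g = Nat.card G) (t c : ℕ) :
    c * orderOf (g ^ t) = Nat.card G ↔ Nat.gcd (Nat.card G) t = c := by
  rw [orderOf_pow, hg]
  have hpos : 0 < Nat.card G := Nat.card_pos
  have hd := Nat.gcd_dvd_left (Nat.card G) t
  have hdp : 0 < (Nat.card G).gcd t := Nat.gcd_pos_of_pos_left _ hpos
  have h1 := Nat.mul_div_cancel' hd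
  have h2 : 0 < Nat.card G / (Nat.card G).gcd t := Nat.div_pos (Nat.le_of_dvd hpos hd) hdp
  constructor
  · intro h
    exact (Nat.eq_of_mul_eq_mul_right h2 (h.trans h1.symm)).symm
  · rintro rfl
    exact h1

lemma lift_step (q r c p : ℕ) (hq : q.Prime) (hq2 : q ≠ 2) (hr : 2 ≤ r) (hc : Nat.Coprime c q)
    (hp : Nat.Coprime p q) :
    c * orderOf (p : ZMod (q ^ r)) = Nat.totient (q ^ r) ↔
    c * orderOf (p : ZMod (q ^ 2)) = Nat.totient (q ^ 2) := by
  have : NeZero q := ⟨hq.ne_zero⟩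
  have hcyc := ZMod.isCyclic_units_of_prime_pow q hq hq2 r
  obtain ⟨g, hg⟩ := hcyc.exists_generator
  have hd : q ^ 2 ∣ q ^ r := pow_dvd_pow q hr
  set f := ZMod.unitsMap hd with hf
  have hfs : Function.Surjective f := ZMod.unitsMap_surjective hd
  set u := ZMod.unitOfCoprime p (Nat.Coprime.pow_right r hp) with hu
  obtain ⟨t, ht⟩ := (mem_powers_iff_mem_zpowers.2 (hg u))
  have ht : g ^ t = u := ht
  have hg1 : orderOf g = Nat.card (ZMod (q ^ r))ˣ := orderOf_eq_card_of_forall_mem_zpowers hg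
  have hg2 : orderOf (f g) = Nat.card (ZMod (q ^ 2))ˣ := by
    apply orderOf_eq_card_of_forall_mem_zpowers
    intro x
    obtain ⟨y, rfl⟩ := hfs x
    obtain ⟨k, hk⟩ := hg y
    exact ⟨k, by simp only at hk ⊢; rw [← hk, map_zpow]⟩
  have e1 : orderOf (p : ZMod (q ^ r)) = orderOf (g ^ t) := by
    rw [ht, ← orderOf_units]; rfl
  have e2 : orderOf (p : ZMod (q ^ 2)) = orderOf ((f g) ^ t) := by
    rw [← map_pow, ht, ← orderOf_units]
    congr 1
    simp [hf, hu, ZMod.unitsMap_def]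
  have c1 : ∀ s, Nat.card (ZMod (q ^ s))ˣ = Nat.totient (q ^ s) := by
    intro s
    rw [Nat.card_eq_fintype_card, ZMod.card_units_eq_totient]
  rw [e1, e2, ← c1, ← c1, cyc_ord g hg1, cyc_ord (f g) hg2, c1, c1,
    Nat.totient_prime_pow hq (by omega), Nat.totient_prime_pow hq (by omega)]
  exact gcd_step t q (q - 1) c r hq hr hc

lemma lift_eps (q r c p : ℕ) (hq : q.Prime) (hq2 : q ≠ 2) (hr : 1 ≤ r) (hc : Nat.Coprime c q)
    (hp : Nat.Coprime p q) :
    c * orderOf (p : ZMod (q ^ r)) = Nat.totient (q ^ r) ↔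
    c * orderOf (p : ZMod (q ^ eps r)) = Nat.totient (q ^ eps r) := by
  by_cases h : r = 1
  · rw [h]; rfl
  · rw [show eps r = 2 from if_neg h]
    exact lift_step q r c p hq hq2 (by omega) hc hp

lemma cop_eps (q r k X : ℕ) (hr : 1 ≤ r) :
    Nat.Coprime (q ^ (r - 1) * k) X ↔ Nat.Coprime (q ^ (eps r - 1) * k) X := by
  unfold eps
  split_ifs with h
  · rw [h]
  · rw [Nat.coprime_mul_iff_left, Nat.coprime_mul_iff_left,
      Nat.coprime_pow_left_iff (by omega), Nat.coprime_pow_left_iff (by omega)]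

lemma eps_pos (r : ℕ) : 0 < eps r := by
  unfold eps; split_ifs <;> omega

lemma tot_eps (q r : ℕ) (hq : q.Prime) : q ^ (eps r - 1) * (q - 1) = Nat.totient (q ^ eps r) :=
  (Nat.totient_prime_pow hq (eps_pos r)).symm

/-- totient of q^r with q = 3 mod 4 is twice an odd number -/
lemma tot3 (q r : ℕ) (hq : q.Prime) (hr : 1 ≤ r) (h : q % 4 = 3) :
    Nat.totient (q ^ r) = 2 * (q ^ (r - 1) * ((q - 1) / 2)) ∧ Odd (q ^ (r - 1) * ((q - 1) / 2)) := by
  constructor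
  · rw [Nat.totient_prime_pow hq (by omega), show q - 1 = 2 * ((q - 1) / 2) by omega]
    simp; ring
  · exact Odd.mul (Odd.pow (Nat.odd_iff.2 (by omega))) (Nat.odd_iff.2 (by omega))

lemma tot3' (q r k : ℕ) (hq : q.Prime) (hq2 : q ≠ 2) (hr : 1 ≤ r)
    (h : Nat.totient (q ^ r) = 2 * k) (hk : Odd k) : q % 4 = 3 := by
  rw [Nat.totient_prime_pow hq (by omega)] at h
  have ho := hq.odd_of_ne_two hq2
  by_contra hne
  have : 4 ∣ q - 1 := by
    have := Nat.odd_iff.1 ho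
    omega
  have : 4 ∣ 2 * k := h ▸ Dvd.dvd.mul_left this _
  have := Nat.odd_iff.1 hk
  omega

lemma tot5 (q r : ℕ) (hq : q.Prime) (hr : 1 ≤ r) (h : q % 8 = 5) :
    Nat.totient (q ^ r) = 4 * (q ^ (r - 1) * ((q - 1) / 4)) ∧ Odd (q ^ (r - 1) * ((q - 1) / 4)) := by
  constructor
  · rw [Nat.totient_prime_pow hq (by omega), show q - 1 = 4 * ((q - 1) / 4) by omega]
    simp; ring
  · exact Odd.mul (Odd.pow (Nat.odd_iff.2 (by omega))) (Nat.odd_iff.2 (by omega))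

lemma tot5' (q r k : ℕ) (hq : q.Prime) (hq2 : q ≠ 2) (hr : 1 ≤ r)
    (h : Nat.totient (q ^ r) = 4 * k) (hk : Odd k) : q % 8 = 5 := by
  rw [Nat.totient_prime_pow hq (by omega)] at h
  have ho := hq.odd_of_ne_two hq2
  have hop : Odd (q ^ (r - 1)) := ho.pow
  have h4 : 4 ∣ q - 1 := by
    have : Nat.Coprime 4 (q ^ (r - 1)) := by
      rw [show 4 = 2 ^ 2 by norm_num]
      exact Nat.Coprime.pow_left 2 (Nat.coprime_two_left.2 hop)
    exact this.dvd_of_dvd_mul_left (h ▸ Dvd.intro k rfl)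
  by_contra hne
  have : 8 ∣ q - 1 := by
    have := Nat.odd_iff.1 ho
    omega
  have : 8 ∣ 4 * k := h ▸ Dvd.dvd.mul_left this _
  have := Nat.odd_iff.1 hk
  omega

/-- two-prime core -/
lemma core_c (q₁ q₂ r₁ r₂ p : ℕ) (h1 : q₁.Prime) (h2 : q₂.Prime) (hne : q₁ ≠ q₂)
    (m1 : q₁ % 4 = 3) (m2 : q₂ % 4 = 3) (hr1 : 1 ≤ r₁) (hr2 : 1 ≤ r₂)
    (c1 : Nat.Coprime p q₁) (c2 : Nat.Coprime p q₂) :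
    (4 * orderOf (p : ZMod (q₁ ^ r₁ * q₂ ^ r₂)) = Nat.totient (q₁ ^ r₁ * q₂ ^ r₂) ∧
      Odd (orderOf (p : ZMod (q₁ ^ r₁ * q₂ ^ r₂)))) ↔
    (orderOf ((p : ZMod (q₁ ^ eps r₁))) = q₁ ^ (eps r₁ - 1) * (q₁ - 1) / 2 ∧
            orderOf ((p : ZMod (q₂ ^ eps r₂))) = q₂ ^ (eps r₂ - 1) * (q₂ - 1) / 2 ∧
            Nat.gcd (q₁ ^ (eps r₁ - 1) * (q₁ - 1) / 2)
              (q₂ ^ (eps r₂ - 1) * (q₂ - 1) / 2) = 1) := by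
  have hcop : Nat.Coprime (q₁ ^ r₁) (q₂ ^ r₂) :=
    Nat.Coprime.pow _ _ ((Nat.coprime_primes h1 h2).2 hne)
  have L1 := lift_eps q₁ r₁ 2 p h1 (by omega) hr1 (Nat.coprime_two_left.2 (h1.odd_of_ne_two (by omega))) c1
  have L2 := lift_eps q₂ r₂ 2 p h2 (by omega) hr2 (Nat.coprime_two_left.2 (h2.odd_of_ne_two (by omega))) c2
  obtain ⟨t1, o1⟩ := tot3 q₁ r₁ h1 hr1 m1
  obtain ⟨t2, o2⟩ := tot3 q₂ r₂ h2 hr2 m2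
  obtain ⟨e1, -⟩ := tot3 q₁ (eps r₁) h1 (eps_pos _) m1
  obtain ⟨e2, -⟩ := tot3 q₂ (eps r₂) h2 (eps_pos _) m2
  have d1 := ord_dvd_tot (q₁ ^ r₁) p (c1.pow_right _)
  have d2 := ord_dvd_tot (q₂ ^ r₂) p (c2.pow_right _)
  have G1 := cop_eps q₁ r₁ ((q₁ - 1) / 2) (q₂ ^ (r₂ - 1) * ((q₂ - 1) / 2)) hr1
  have G2 := cop_eps q₂ r₂ ((q₂ - 1) / 2) (q₁ ^ (eps r₁ - 1) * ((q₁ - 1) / 2)) hr2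
  rw [Nat.coprime_comm, Nat.coprime_comm (n := q₂ ^ (eps r₂ - 1) * ((q₂ - 1) / 2))] at G2
  have G := G1.trans G2
  rw [tot_eps _ _ h1, tot_eps _ _ h2, e1, e2, Nat.mul_div_cancel_left _ (by norm_num),
    Nat.mul_div_cancel_left _ (by norm_num)]
  rw [e1, t1] at L1
  rw [e2, t2] at L2
  rw [t1] at d1
  rw [t2] at d2
  rw [Nat.mul_right_inj (by norm_num), Nat.mul_right_inj (by norm_num)] at L1 L2
  rw [Nat.Coprime, Nat.Coprime] at G
  rw [← L1, ← L2, ← G, ord_mul _ _ _ hcop, Nat.totient_mul hcop, t1, t2]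
  generalize q₁ ^ (r₁ - 1) * ((q₁ - 1) / 2) = A at *
  generalize q₂ ^ (r₂ - 1) * ((q₂ - 1) / 2) = B at *
  generalize orderOf (p : ZMod (q₁ ^ r₁)) = x at *
  generalize orderOf (p : ZMod (q₂ ^ r₂)) = y at *
  constructor
  · rintro ⟨h, ho⟩
    have hl : Nat.lcm x y = A * B := by nlinarith
    have ox : Odd x := ho.of_dvd_nat (Nat.dvd_lcm_left x y)
    have oy : Odd y := ho.of_dvd_nat (Nat.dvd_lcm_right x y)
    have dx : x ∣ A := (Nat.coprime_two_right.2 ox).dvd_of_dvd_mul_left d1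
    have dy : y ∣ B := (Nat.coprime_two_right.2 oy).dvd_of_dvd_mul_left d2
    have pA := o1.pos
    have pB := o2.pos
    have lx := Nat.le_of_dvd pA dx
    have ly := Nat.le_of_dvd pB dy
    have hg := Nat.gcd_mul_lcm x y
    have hgp : 0 < Nat.gcd x y := Nat.gcd_pos_of_pos_left _ ox.pos
    rw [hl] at hg
    have hAB : 0 < A * B := Nat.mul_pos pA pB
    have h3 : A * B ≤ x * y := by nlinarith
    have hx : x = A := by
      by_contra hh
      have : x < A := by omega
      have : x * y < A * B := Nat.mul_lt_mul_of_lt_of_le this ly pB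
      omega
    have hy : y = B := by
      by_contra hh
      have : y < B := by omega
      have : x * y < A * B := Nat.mul_lt_mul_of_le_of_lt lx this pA
      omega
    subst hx hy
    refine ⟨rfl, rfl, ?_⟩
    nlinarith
  · rintro ⟨rfl, rfl, hg⟩
    rw [Nat.Coprime.lcm_eq_mul hg]
    exact ⟨by ring, o1.mul o2⟩

lemma core_b (q r p : ℕ) (h1 : q.Prime) (m1 : q % 8 = 5) (hr1 : 1 ≤ r) (c1 : Nat.Coprime p q) :
    (4 * orderOf (p : ZMod (q ^ r)) = Nat.totient (q ^ r) ∧ Odd (orderOf (p : ZMod (q ^ r)))) ↔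
    orderOf ((p : ZMod (q ^ eps r))) = q ^ (eps r - 1) * (q - 1) / 4 := by
  have hc : Nat.Coprime 4 q := by
    rw [show 4 = 2 ^ 2 by norm_num]
    exact Nat.Coprime.pow_left 2 (Nat.coprime_two_left.2 (h1.odd_of_ne_two (by omega)))
  have L1 := lift_eps q r 4 p h1 (by omega) hr1 hc c1
  obtain ⟨t1, o1⟩ := tot5 q r h1 hr1 m1
  obtain ⟨e1, -⟩ := tot5 q (eps r) h1 (eps_pos _) m1
  rw [tot_eps _ _ h1, e1, Nat.mul_div_cancel_left _ (by norm_num)]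
  rw [e1, t1] at L1
  rw [Nat.mul_right_inj (by norm_num), Nat.mul_right_inj (by norm_num)] at L1
  rw [← L1, t1, Nat.mul_right_inj (by norm_num)]
  constructor
  · exact fun h => h.1
  · intro h
    exact ⟨h, h ▸ o1⟩

lemma core_d (q r p : ℕ) (h1 : q.Prime) (m1 : q % 4 = 3) (hr1 : 1 ≤ r)
    (ho : Odd p) :
    (4 * orderOf (p : ZMod (4 * q ^ r)) = Nat.totient (4 * q ^ r) ∧
      Odd (orderOf (p : ZMod (4 * q ^ r)))) ↔
    p % 4 = 1 ∧ orderOf ((p : ZMod (q ^ r))) = q ^ (r - 1) * (q - 1) / 2 := by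
  have c4 : ∀ k, Odd k → Nat.Coprime 4 k := by
    intro k hk
    rw [show 4 = 2 ^ 2 by norm_num]
    exact Nat.Coprime.pow_left 2 (Nat.coprime_two_left.2 hk)
  have hcop := c4 _ ((h1.odd_of_ne_two (by omega)).pow (n := r))
  have t4 : Nat.totient 4 = 2 := by decide
  have d4 := ord_dvd_tot 4 p (c4 p ho).symm
  rw [t4] at d4
  obtain ⟨t1, o1⟩ := tot3 q r h1 hr1 m1
  rw [← Nat.totient_prime_pow h1 (by omega), Nat.totient_mul hcop, ord_mul _ _ _ hcop, t4, t1,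
    Nat.mul_div_cancel_left _ (by norm_num), ← ord_one_iff 4 p (by norm_num)]
  constructor
  · rintro ⟨h, hodd⟩
    have ox := hodd.of_dvd_nat (Nat.dvd_lcm_left _ _)
    have h41 : orderOf (p : ZMod 4) = 1 := by
      rcases (Nat.dvd_prime Nat.prime_two).1 d4 with h | h
      · exact h
      · rw [h] at ox; exact absurd ox (by decide)
    rw [h41, Nat.lcm_one_left] at h
    exact ⟨h41, by omega⟩
  · rintro ⟨h, h'⟩
    rw [h, Nat.lcm_one_left, h']
    exact ⟨by ring, o1⟩

lemma two_mul_ord (m p : ℕ) (hm : Odd m) (ho : Odd p) :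
    orderOf (p : ZMod (2 * m)) = orderOf (p : ZMod m) ∧ Nat.totient (2 * m) = Nat.totient m := by
  have hcop := Nat.coprime_two_left.2 hm
  rw [ord_mul _ _ _ hcop, (ord_one_iff 2 p (by norm_num)).2 (Nat.odd_iff.1 ho), Nat.lcm_one_left,
    Nat.totient_mul hcop]
  simp

lemma odd_split (m : ℕ) (hm : Odd m) (h1 : m ≠ 1) :
    ∃ q r m', q.Prime ∧ q ≠ 2 ∧ 1 ≤ r ∧ m = q ^ r * m' ∧ Nat.Coprime q m' ∧ Odd m' := by
  have hq := Nat.minFac_prime h1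
  obtain ⟨r, m', hnd, he⟩ := Nat.exists_eq_pow_mul_and_not_dvd (n := m) (by rintro rfl; simp at hm)
    (m.minFac) hq.ne_one
  refine ⟨m.minFac, r, m', hq, ?_, ?_, he, (Nat.Prime.coprime_iff_not_dvd hq).2 hnd, ?_⟩
  · intro h2
    have := hm.of_dvd_nat (Nat.minFac_dvd m)
    rw [h2] at this
    exact absurd this (by decide)
  · by_contra h0
    have : r = 0 := by omega
    subst this
    apply hnd
    have h := Nat.minFac_dvd m
    have e : m = m' := by simpa using he
    rwa [← e]
  · exact hm.of_dvd_nat (Dvd.intro_left _ he.symm)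

lemma odd_core (m p : ℕ) (hm : Odd m) (hpm : Nat.Coprime p m)
    (h : 4 * orderOf (p : ZMod m) = Nat.totient m) (ho : Odd (orderOf (p : ZMod m))) :
    (∃ q r, q.Prime ∧ q % 8 = 5 ∧ 1 ≤ r ∧ m = q ^ r) ∨
    (∃ q₁ q₂ r₁ r₂ : ℕ, q₁.Prime ∧ q₂.Prime ∧ q₁ ≠ q₂ ∧ q₁ % 4 = 3 ∧ q₂ % 4 = 3 ∧
        1 ≤ r₁ ∧ 1 ≤ r₂ ∧ m = q₁ ^ r₁ * q₂ ^ r₂) := by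
  have hoo := Nat.odd_iff.1 ho
  have ev : ∀ k, Odd k → k ≠ 1 → ∃ j, Nat.totient k = 2 * j := by
    intro k hk hk1
    have : 2 < k := by have := Nat.odd_iff.1 hk; omega
    exact (even_iff_two_dvd.1 (Nat.totient_even this))
  have hm1 : m ≠ 1 := by
    rintro rfl
    simp at h
  obtain ⟨q, r, m', hq, hq2, hr, he, hc, hm'⟩ := odd_split m hm hm1
  have hqo := hq.odd_of_ne_two hq2
  have pne : ∀ (q r : ℕ), q.Prime → 1 ≤ r → q ^ r ≠ 1 := by
    intro q r hq hr
    exact (Nat.one_lt_pow (by omega) hq.one_lt).ne'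
  by_cases h1 : m' = 1
  · left
    subst h1
    rw [mul_one] at he
    refine ⟨q, r, hq, tot5' q r _ hq hq2 hr (by rw [← he]; exact h.symm) ho, hr, he⟩
  · right
    obtain ⟨q', r', m'', hq', hq2', hr', he', hc', hm''⟩ := odd_split m' hm' h1
    have hqo' := hq'.odd_of_ne_two hq2'
    have ht : Nat.totient m = Nat.totient (q ^ r) * (Nat.totient (q' ^ r') * Nat.totient m'') := by
      rw [he, Nat.totient_mul (hc.pow_left r), he', Nat.totient_mul (hc'.pow_left r')]
    obtain ⟨j1, hj1⟩ := ev (q ^ r) hqo.pow (pne q r hq hr)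
    obtain ⟨j2, hj2⟩ := ev (q' ^ r') hqo'.pow (pne q' r' hq' hr')
    have h2 : m'' = 1 := by
      by_contra hh
      obtain ⟨j3, hj3⟩ := ev m'' hm'' hh
      rw [ht, hj1, hj2, hj3, show 2 * j1 * (2 * j2 * (2 * j3)) = 8 * (j1 * j2 * j3) by ring] at h
      omega
    subst h2
    rw [ht, hj1, hj2, Nat.totient_one, show 2 * j1 * (2 * j2 * 1) = 4 * (j1 * j2) by ring] at h
    have hjj : orderOf (p : ZMod m) = j1 * j2 := by omega
    rw [hjj] at ho
    have ho1 := Nat.odd_mul.1 ho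
    rw [mul_one] at he'
    refine ⟨q, q', r, r', hq, hq', ?_, tot3' q r j1 hq hq2 hr hj1 ho1.1,
      tot3' q' r' j2 hq' hq2' hr' hj2 ho1.2, hr, hr', by rw [he, he']⟩
    rintro rfl
    have : q ∣ m' := he' ▸ dvd_pow_self q (by omega)
    exact (Nat.Prime.coprime_iff_not_dvd hq).1 hc this

theorem orderOf_eq_quarter_totient_odd_iff (n : ℕ) (hn : 0 < n) (p : ℕ) (hp : p.Prime)
    (hp2 : p ≠ 2) (hpn : ¬ p ∣ n) :
    (4 * orderOf ((p : ZMod n)) = Nat.totient n ∧ Odd (orderOf ((p : ZMod n)))) ↔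
      -- (a)
      ((n = 8 ∧ p % 8 = 1) ∨
      -- (b)
      (∃ q r : ℕ, q.Prime ∧ q % 8 = 5 ∧ 1 ≤ r ∧ (n = q ^ r ∨ n = 2 * q ^ r) ∧
        orderOf ((p : ZMod (q ^ eps r))) = q ^ (eps r - 1) * (q - 1) / 4) ∨
      -- (c)
      (∃ q₁ q₂ r₁ r₂ : ℕ, q₁.Prime ∧ q₂.Prime ∧ q₁ ≠ q₂ ∧ q₁ % 4 = 3 ∧ q₂ % 4 = 3 ∧
        1 ≤ r₁ ∧ 1 ≤ r₂ ∧ (n = q₁ ^ r₁ * q₂ ^ r₂ ∨ n = 2 * (q₁ ^ r₁ * q₂ ^ r₂)) ∧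
        ((orderOf ((p : ZMod (q₁ ^ eps r₁))) = Nat.totient (q₁ ^ eps r₁) ∧
            orderOf ((p : ZMod (q₂ ^ eps r₂))) = q₂ ^ (eps r₂ - 1) * (q₂ - 1) / 2 ∧
            Nat.gcd (q₁ ^ (eps r₁ - 1) * (q₁ - 1)) (q₂ ^ (eps r₂ - 1) * (q₂ - 1) / 2) = 2) ∨
          (orderOf ((p : ZMod (q₁ ^ eps r₁))) = q₁ ^ (eps r₁ - 1) * (q₁ - 1) / 2 ∧
            orderOf ((p : ZMod (q₂ ^ eps r₂))) = q₂ ^ (eps r₂ - 1) * (q₂ - 1) / 2 ∧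
            Nat.gcd (q₁ ^ (eps r₁ - 1) * (q₁ - 1) / 2)
              (q₂ ^ (eps r₂ - 1) * (q₂ - 1) / 2) = 1))) ∨
      -- (d)
      (∃ q r : ℕ, q.Prime ∧ q % 4 = 3 ∧ 1 ≤ r ∧ n = 4 * q ^ r ∧ p % 4 = 1 ∧
        orderOf ((p : ZMod (q ^ r))) = q ^ (r - 1) * (q - 1) / 2)) := by
  have hpo := hp.odd_of_ne_two hp2
  have hpc : Nat.Coprime p n := (Nat.Prime.coprime_iff_not_dvd hp).2 hpn
  have h48 : Nat.totient 8 = 4 := by decide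
  have cq : ∀ q r, 1 ≤ r → q ^ r ∣ n → Nat.Coprime p q := by
    intro q r hr hd
    exact hpc.coprime_dvd_right ((dvd_pow_self q (by omega)).trans hd)
  constructor
  · rintro ⟨h, ho⟩
    obtain ⟨a, m, hm, hnm⟩ := Nat.exists_eq_two_pow_mul_odd hn.ne'
    have hoo := Nat.odd_iff.1 ho
    rcases Nat.lt_or_ge a 2 with ha | ha
    · have hh : n = m ∨ n = 2 * m := by
        interval_cases a
        · left; simpa using hnm
        · right; simpa using hnm
      have h' : 4 * orderOf (p : ZMod m) = Nat.totient m ∧ Odd (orderOf (p : ZMod m)) := by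
        rcases hh with hh | hh
        · rw [← hh]; exact ⟨h, ho⟩
        · have := two_mul_ord m p hm hpo
          rw [← hh] at this
          rw [← this.1, ← this.2]; exact ⟨h, ho⟩
      have hmn : m ∣ n := by rcases hh with hh | hh <;> rw [hh]; exact Dvd.intro_left _ rfl
      rcases odd_core m p hm (hpc.coprime_dvd_right hmn) h'.1 h'.2 with
        ⟨q, r, hq, hq5, hr, rfl⟩ | ⟨q₁, q₂, r₁, r₂, hq1, hq2, hne, m1, m2, hr1, hr2, rfl⟩
      · exact Or.inr (Or.inl ⟨q, r, hq, hq5, hr, hh, (core_b q r p hq hq5 hr (cq q r hr hmn)).1 h'⟩)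
      · refine Or.inr (Or.inr (Or.inl ⟨q₁, q₂, r₁, r₂, hq1, hq2, hne, m1, m2, hr1, hr2, hh, Or.inr ?_⟩))
        exact (core_c q₁ q₂ r₁ r₂ p hq1 hq2 hne m1 m2 hr1 hr2
          (cq q₁ r₁ hr1 ((Dvd.intro _ rfl).trans hmn)) (cq q₂ r₂ hr2 ((Dvd.intro_left _ rfl).trans hmn))).1 h'
    · obtain ⟨b, rfl⟩ := Nat.exists_eq_add_of_le ha
      have hcop : Nat.Coprime (2 ^ (2 + b)) m := (Nat.coprime_two_left.2 hm).pow_left _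
      have ht : Nat.totient n = 2 ^ (b + 1) * Nat.totient m := by
        rw [hnm, Nat.totient_mul hcop, Nat.totient_prime_pow Nat.prime_two (by omega)]
        simp only [show 2 + b - 1 = b + 1 by omega]
        simp
      by_cases hm1 : m = 1
      · subst hm1
        simp only [Nat.totient_one, mul_one] at ht hnm
        rw [ht] at h
        have hb : b = 1 := by
          rcases b with _ | _ | b
          · simp at h; omega
          · rfl
          · rw [show 2 ^ (b + 1 + 1 + 1) = 8 * 2 ^ b by ring] at h
            omega
        subst hb
        have hn8 : n = 8 := hnm
        subst hn8
        left
        refine ⟨rfl, (ord_one_iff 8 p (by norm_num)).1 (by omega)⟩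
      · have hm2 : 2 < m := by have := Nat.odd_iff.1 hm; rcases m with _ | _ | _ | m <;> simp_all
        obtain ⟨k, hk⟩ := even_iff_two_dvd.1 (Nat.totient_even hm2)
        rw [ht, hk] at h
        have hb : b = 0 := by
          rcases b with _ | b
          · rfl
          · rw [show 2 ^ (b + 1 + 1) * (2 * k) = 8 * (2 ^ b * k) by ring] at h
            omega
        subst hb
        have hok : Odd k := by
          rw [Nat.odd_iff]
          omega
        obtain ⟨q, r, m', hq, hq2, hr, he, hc, hm'⟩ := odd_split m hm hm1
        have hm'1 : m' = 1 := by
          by_contra hh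
          have h2' : 2 < m' := by have := Nat.odd_iff.1 hm'; omega
          obtain ⟨j, hj⟩ := even_iff_two_dvd.1 (Nat.totient_even h2')
          have hq3 : 2 < q ^ r := lt_of_lt_of_le (by have := hq.two_le; omega) (Nat.le_self_pow (by omega) q)
          obtain ⟨i, hi⟩ := even_iff_two_dvd.1 (Nat.totient_even hq3)
          rw [he, Nat.totient_mul (hc.pow_left r), hi, hj] at hk
          have := Nat.odd_iff.1 hok
          have : k = 2 * (i * j) := by nlinarith
          omega
        subst hm'1
        rw [mul_one] at he
        subst he
        have hq3 := tot3' q r k hq hq2 hr hk hok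
        have hn4 : n = 4 * q ^ r := by simpa using hnm
        right; right; right
        have h' : 4 * orderOf (p : ZMod n) = Nat.totient n ∧ Odd (orderOf (p : ZMod n)) :=
          ⟨by rw [ht, hk]; exact h, ho⟩
        rw [hn4] at h'
        have := (core_d q r p hq hq3 hr hpo).1 h'
        exact ⟨q, r, hq, hq3, hr, hn4, this.1, this.2⟩
  · have red : ∀ m, Odd m → (n = m ∨ n = 2 * m) →
        (4 * orderOf (p : ZMod m) = Nat.totient m ∧ Odd (orderOf (p : ZMod m))) →
        (4 * orderOf (p : ZMod n) = Nat.totient n ∧ Odd (orderOf (p : ZMod n))) := by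
      intro m hm hh h'
      rcases hh with hh | hh
      · rw [hh]; exact h'
      · have := two_mul_ord m p hm hpo
        rw [hh, this.1, this.2]; exact h'
    rintro (⟨rfl, h8⟩ | ⟨q, r, hq, hq5, hr, hh, h⟩ |
      ⟨q₁, q₂, r₁, r₂, hq1, hq2, hne, m1, m2, hr1, hr2, hh, h⟩ | ⟨q, r, hq, hq3, hr, rfl, h4, h⟩)
    · rw [(ord_one_iff 8 p (by norm_num)).2 h8, h48]
      exact ⟨rfl, odd_one⟩
    · have hmn : q ^ r ∣ n := by rcases hh with hh | hh <;> rw [hh]; exact Dvd.intro_left _ rfl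
      refine red (q ^ r) (Nat.odd_iff.2 (by omega : q % 2 = 1)).pow hh ?_
      exact (core_b q r p hq hq5 hr (cq q r hr hmn)).2 h
    · have hmn : q₁ ^ r₁ * q₂ ^ r₂ ∣ n := by
        rcases hh with hh | hh <;> rw [hh]; exact Dvd.intro_left _ rfl
      refine red _ ((Nat.odd_iff.2 (by omega : q₁ % 2 = 1)).pow.mul
        (Nat.odd_iff.2 (by omega : q₂ % 2 = 1)).pow) hh ?_
      rcases h with ⟨-, -, hg⟩ | h
      · exfalso
        obtain ⟨e2, o2⟩ := tot3 q₂ (eps r₂) hq2 (eps_pos _) m2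
        rw [tot_eps _ _ hq2, e2, Nat.mul_div_cancel_left _ (by norm_num)] at hg
        have := o2.of_dvd_nat (hg ▸ Nat.gcd_dvd_right _ _)
        exact absurd this (by decide)
      · exact (core_c q₁ q₂ r₁ r₂ p hq1 hq2 hne m1 m2 hr1 hr2
          (cq q₁ r₁ hr1 ((Dvd.intro _ rfl).trans hmn)) (cq q₂ r₂ hr2 ((Dvd.intro_left _ rfl).trans hmn))).2 h
    · exact (core_d q r p hq hq3 hr hpo).2 ⟨h4, h⟩
end

section
/- Let n be a positive integer and let p be an odd prime with p ∤ n. Then φ(n) = 4·ord_n(p) and ord_m(p) = φ(m) for every divisor m of n with m ≠ n, if and only if one of the following holds: (a) n = q is an odd prime with q ≡ 1 (mod 4) and ord_q(p) = (q−1)/4; (b) n = q₁q₂ for distinct odd primes q₁, q₂, p is a primitive root of both q₁ and q₂, and gcd(q₁−1, q₂−1) = 4. -/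
theorem aux_ord_mul (p a b : ℕ) (h : Nat.Coprime a b) :
    orderOf ((p : ZMod (a * b))) = Nat.lcm (orderOf (p : ZMod a)) (orderOf (p : ZMod b)) := by
  have h1 := orderOf_injective (ZMod.chineseRemainder h).toMonoidHom
    (ZMod.chineseRemainder h).injective (p : ZMod (a * b))
  rw [← h1, Prod.orderOf]
  simp

theorem aux_ord_dvd (p a b : ℕ) (h : a ∣ b) :
    orderOf ((p : ZMod a)) ∣ orderOf (p : ZMod b) := by
  have h1 := orderOf_map_dvd (ZMod.castHom h (ZMod a)).toMonoidHom (p : ZMod b)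
  simpa using h1

/-- If `φ(ab) = 4 ord` and `p` is primitive modulo both coprime factors, the gcd is 4. -/
theorem aux_gcd (p a b k : ℕ) (h : Nat.Coprime a b) (ha : 0 < a) (hb : 0 < b)
    (h1 : orderOf (p : ZMod a) = Nat.totient a) (h2 : orderOf (p : ZMod b) = Nat.totient b) :
    Nat.totient (a * b) = k * orderOf (p : ZMod (a * b)) ↔
    Nat.gcd (Nat.totient a) (Nat.totient b) = k := by
  rw [aux_ord_mul p a b h, h1, h2, Nat.totient_mul h,
    ← Nat.gcd_mul_lcm (Nat.totient a) (Nat.totient b)]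
  have : 0 < Nat.lcm (Nat.totient a) (Nat.totient b) :=
    Nat.lcm_pos (Nat.totient_pos.2 ha) (Nat.totient_pos.2 hb)
  exact Nat.mul_left_inj this.ne'

theorem aux_split (n p : ℕ) (hn : 0 < n)
    (h1 : Nat.totient n = 4 * orderOf ((p : ZMod n)))
    (h2 : ∀ m : ℕ, m ∣ n → m ≠ n → orderOf ((p : ZMod m)) = Nat.totient m)
    (hnp : ¬ n.Prime) (q m : ℕ) (hq : q.Prime) (hm : n = q * m) :
    Nat.Coprime q m ∧ Nat.gcd (q - 1) (Nat.totient m) = 4 := by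
  have hm0 : 0 < m := by
    rcases Nat.eq_zero_or_pos m with h | h
    · subst h; omega
    · exact h
  have hmn : m ≠ n := by
    intro h
    have := hq.two_le
    nlinarith
  have hqn : q ≠ n := by
    intro h
    exact hnp (h ▸ hq)
  have hmd : m ∣ n := ⟨q, by rw [hm, mul_comm]⟩
  have hqd : q ∣ n := ⟨m, hm⟩
  have hcop : Nat.Coprime q m := by
    rw [Nat.Prime.coprime_iff_not_dvd hq]
    intro hd
    have ht : Nat.totient n = q * Nat.totient m := by
      rw [hm, Nat.totient_mul_of_prime_of_dvd hq hd]
    obtain ⟨t, ht2⟩ := aux_ord_dvd p m n hmd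
    rw [h2 m hmd hmn] at ht2
    have hpos : 0 < Nat.totient m := Nat.totient_pos.2 hm0
    have : q = 4 * t := by
      apply Nat.eq_of_mul_eq_mul_right hpos
      rw [← ht, h1, ht2]; ring
    have h4 : 2 ∣ q := ⟨2 * t, by omega⟩
    have := (Nat.prime_dvd_prime_iff_eq Nat.prime_two hq).1 h4
    omega
  refine ⟨hcop, ?_⟩
  rw [← Nat.totient_prime hq]
  refine (aux_gcd p q m 4 hcop hq.pos hm0 (h2 q hqd hqn) (h2 m hmd hmn)).1 ?_
  rw [← hm]; exact h1


/-- For an odd prime `p` and a positive integer `n` with `p ∤ n`, one has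
`φ(n) = 4·ord_n(p)` and `ord_m(p) = φ(m)` for every proper divisor `m` of `n` iff
(a) `n = q` is an odd prime with `q ≡ 1 (mod 4)` and `ord_q(p) = (q-1)/4`, or
(b) `n = q₁q₂` for distinct odd primes `q₁, q₂`, `p` is a primitive root of both,
and `gcd(q₁-1, q₂-1) = 4`. -/
theorem totient_eq_four_mul_orderOf_and_primitive_on_proper_divisors_iff
    (n : ℕ) (hn : 0 < n) (p : ℕ) (hp : p.Prime) (hp2 : p ≠ 2) (hpn : ¬ p ∣ n) :
    (Nat.totient n = 4 * orderOf ((p : ZMod n)) ∧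
        ∀ m : ℕ, m ∣ n → m ≠ n → orderOf ((p : ZMod m)) = Nat.totient m) ↔
      ((n.Prime ∧ n % 4 = 1 ∧ orderOf ((p : ZMod n)) = (n - 1) / 4) ∨
        (∃ q₁ q₂ : ℕ, q₁.Prime ∧ q₂.Prime ∧ q₁ ≠ 2 ∧ q₂ ≠ 2 ∧ q₁ ≠ q₂ ∧ n = q₁ * q₂ ∧
          orderOf ((p : ZMod q₁)) = Nat.totient q₁ ∧
          orderOf ((p : ZMod q₂)) = Nat.totient q₂ ∧
          Nat.gcd (q₁ - 1) (q₂ - 1) = 4)) := by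
  constructor
  · rintro ⟨h1, h2⟩
    by_cases hnp : n.Prime
    · left
      have h3 := h1
      rw [Nat.totient_prime hnp] at h3
      have := hnp.two_le
      refine ⟨hnp, by omega, by omega⟩
    · right
      have hn1 : n ≠ 1 := by
        intro h
        rw [h, Nat.totient_one] at h1
        omega
      obtain ⟨m, hm⟩ := Nat.minFac_dvd n
      have hq := Nat.minFac_prime hn1
      generalize n.minFac = q at hm hq
      have hsplit := aux_split n p hn h1 h2 hnp
      obtain ⟨hc, hg⟩ := hsplit q m hq hm
      have hm1 : m ≠ 1 := by
        rintro rfl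
        exact hnp (by rw [hm, mul_one]; exact hq)
      obtain ⟨r, hr, hrm⟩ := Nat.exists_prime_and_dvd hm1
      obtain ⟨s, hs⟩ := hrm
      have hqr : Nat.Coprime q r := Nat.Coprime.coprime_dvd_right ⟨s, hs⟩ hc
      obtain ⟨-, hg2⟩ := hsplit r (q * s) hr (by rw [hm, hs]; ring)
      have d1 : 4 ∣ q - 1 := hg ▸ Nat.gcd_dvd_left _ _
      have d2 : 4 ∣ r - 1 := hg2 ▸ Nat.gcd_dvd_left _ _
      have hqn : q ≠ n := fun h => hnp (h ▸ hq)
      have hrn : r ≠ n := fun h => hnp (h ▸ hr)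
      have hqd : q ∣ n := ⟨m, hm⟩
      have hrd : r ∣ n := ⟨q * s, by rw [hm, hs]; ring⟩
      have oq := h2 q hqd hqn
      have or' := h2 r hrd hrn
      have hn' : n = q * r := by
        by_contra hne
        have ho := h2 (q * r) ⟨s, by rw [hm, hs]; ring⟩ (Ne.symm hne)
        have := (aux_gcd p q r 1 hqr hq.pos hr.pos oq or').1 (by rw [ho, one_mul])
        rw [Nat.totient_prime hq, Nat.totient_prime hr] at this
        have := Nat.dvd_gcd d1 d2
        omega
      refine ⟨q, r, hq, hr, ?_, ?_, ?_, hn', oq, or', ?_⟩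
      · rintro rfl; omega
      · rintro rfl; omega
      · exact (Nat.coprime_primes hq hr).1 hqr
      · rw [← Nat.totient_prime hq, ← Nat.totient_prime hr]
        refine (aux_gcd p q r 4 hqr hq.pos hr.pos oq or').1 ?_
        rw [← hn']; exact h1
  · have hone : orderOf ((p : ZMod 1)) = Nat.totient 1 := by
      rw [Nat.totient_one, orderOf_eq_one_iff]
      exact Subsingleton.elim _ _
    rintro (⟨hnp, h4, ho⟩ | ⟨q, r, hq, hr, -, -, hne, hn', oq, or', hg⟩)
    · refine ⟨?_, ?_⟩
      · rw [ho, Nat.totient_prime hnp]; omega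
      · intro m hm hmn
        rcases (Nat.dvd_prime hnp).1 hm with rfl | h
        · exact hone
        · exact absurd h hmn
    · have hqr := (Nat.coprime_primes hq hr).2 hne
      subst hn'
      refine ⟨?_, ?_⟩
      · refine (aux_gcd p q r 4 hqr hq.pos hr.pos oq or').2 ?_
        rw [Nat.totient_prime hq, Nat.totient_prime hr, hg]
      · intro m hm hmn
        obtain ⟨a, b, ha, hb, rfl⟩ := (Nat.dvd_mul).1 hm
        rcases (Nat.dvd_prime hq).1 ha with rfl | rfl <;>
          rcases (Nat.dvd_prime hr).1 hb with rfl | rfl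
        · exact hone
        · rw [one_mul]; exact or'
        · rw [mul_one]; exact oq
        · exact absurd rfl hmn
end

section
/- Let p be an odd prime and let G be a finite abelian group with exponent n such that p ∤ n. Then the following are equivalent: (i) the group ring ℤ_(p)[G] is clean; (ii) the ring ℤ_(p)[x]/(Φ_n(x)) is clean; (iii) p is a primitive root of n, i.e. ord_n(p) = φ(n). -/
/-- A ring is *clean* if every element is the sum of a unit and an idempotent. -/
def IsCleanRing (R : Type*) [Ring R] : Prop :=
  ∀ r : R, ∃ u e : R, IsUnit u ∧ IsIdempotentElem e ∧ r = u + e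

/-- Elements generating the same cyclic subgroup are related by a power of a primitive root. -/
lemma aux_gen {G : Type*} [CommGroup G] [Finite G] {p n : ℕ} [NeZero n] (hco : p.Coprime n)
    (hn : Monoid.exponent G = n) (hord : orderOf (p : ZMod n) = n.totient) (x y : G)
    (hxy : Subgroup.zpowers x = Subgroup.zpowers y) : ∃ j : ℕ, y = x ^ (p ^ j) := by
  have hd : orderOf x ∣ n := hn ▸ Monoid.order_dvd_exponent x
  have hy : y ∈ Submonoid.powers x := by
    rw [mem_powers_iff_mem_zpowers, hxy]; exact Subgroup.mem_zpowers y
  obtain ⟨k, rfl⟩ := hy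
  have ho : orderOf (x ^ k) = orderOf x := by
    rw [← Nat.card_zpowers, ← Nat.card_zpowers, hxy]
  have hpos : 0 < orderOf x := orderOf_pos x
  have hk : k.Coprime (orderOf x) := by
    rw [orderOf_pow] at ho
    have h1 : (orderOf x).gcd k ∣ orderOf x := Nat.gcd_dvd_left _ _
    have h2 := Nat.div_mul_cancel h1
    rw [ho] at h2
    have h3 : (orderOf x).gcd k = 1 := by
      exact Nat.eq_of_mul_eq_mul_left hpos (by omega)
    rw [Nat.coprime_comm]; exact h3
  set u := ZMod.unitOfCoprime p hco with hu
  have hou : orderOf u = n.totient := by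
    rw [← hord, ← orderOf_units]; rfl
  have htop : Subgroup.zpowers u = ⊤ := by
    apply Subgroup.eq_top_of_card_eq
    rw [Nat.card_zpowers, hou, Nat.card_eq_fintype_card, ZMod.card_units_eq_totient]
  obtain ⟨w, hw⟩ := ZMod.unitsMap_surjective hd (ZMod.unitOfCoprime k hk)
  have hwm : w ∈ Submonoid.powers u := by
    rw [mem_powers_iff_mem_zpowers, htop]; trivial
  obtain ⟨j, rfl⟩ := hwm
  refine ⟨j, ?_⟩
  change x ^ k = _
  rw [pow_eq_pow_iff_modEq, ← ZMod.natCast_eq_natCast_iff]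
  have h := congrArg (Units.val) hw
  simp only [map_pow, Units.val_pow_eq_pow_val, ZMod.coe_unitOfCoprime] at h
  rw [← h, hu]
  simp [ZMod.unitsMap_def]

/-- In characteristic `p`, the `(p-1)`-st power of a combination of liftable idempotents lifts. -/
lemma aux_lift {A B ι : Type*} [CommRing A] [CommRing B] {p : ℕ} [Fact p.Prime]
    [Algebra (ZMod p) B] (π : A →+* B) (e : ι → A) (he : ∀ i, IsIdempotentElem (e i))
    (c : ι → ZMod p) (s : Finset ι) :
    ∀ d : ZMod p, ∃ f : A, IsIdempotentElem f ∧
      π f = (algebraMap _ B d + ∑ i ∈ s, c i • π (e i)) ^ (p - 1) := by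
  classical
  have hp1 : p - 1 ≠ 0 := by have := (Fact.out : p.Prime).two_le; omega
  induction s using Finset.induction_on with
  | empty =>
    intro d
    by_cases hd : d = 0
    · refine ⟨0, IsIdempotentElem.zero, ?_⟩
      simp [hd, hp1]
    · refine ⟨1, IsIdempotentElem.one, ?_⟩
      simp [← map_pow, ZMod.pow_card_sub_one_eq_one hd]
  | insert a s ha ih =>
    intro d
    obtain ⟨f1, hf1, h1⟩ := ih (d + c a)
    obtain ⟨f2, hf2, h2⟩ := ih d
    have hea := he a
    refine ⟨e a * f1 + (1 - e a) * f2, ?_, ?_⟩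
    · unfold IsIdempotentElem at *
      linear_combination (f1 * f1 + f2 * f2 - 2 * f1 * f2) * hea + e a * hf1 + (1 - e a) * hf2
    · rw [Finset.sum_insert ha]
      have hE : π (e a) * π (e a) = π (e a) := by rw [← map_mul, hea]
      simp only [map_add, map_mul, map_sub, map_one, h1, h2, Algebra.smul_def (c a)]
      generalize π (e a) = E at *
      generalize ∑ i ∈ s, c i • π (e i) = S
      generalize algebraMap (ZMod p) B d = D
      generalize algebraMap (ZMod p) B (c a) = C
      have key : ∀ m : ℕ, (D + (C * E + S)) ^ m = E * (D + C + S) ^ m + (1 - E) * (D + S) ^ m := by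
        intro m
        induction m with
        | zero => ring
        | succ m ihm =>
          rw [pow_succ, ihm, pow_succ, pow_succ]
          linear_combination (C * (D + C + S) ^ m - C * (D + S) ^ m) * hE
      rw [key]

open MonoidAlgebra in
lemma aux_repr {R G : Type*} [CommRing R] [CommGroup G] [Fintype G] (x : MonoidAlgebra R G) :
    x = ∑ g, single g (x.coeff g) := by
  classical
  ext h
  simp

open MonoidAlgebra in
lemma aux_frob {G : Type*} [CommGroup G] [Fintype G] {p : ℕ} [Fact p.Prime]
    (x : MonoidAlgebra (ZMod p) G) (k : ℕ) :
    x ^ (p ^ k) = ∑ g, single (g ^ (p ^ k)) (x.coeff g) := by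
  have : CharP (MonoidAlgebra (ZMod p) G) p := charP_of_injective_algebraMap
    (algebraMap (ZMod p) (MonoidAlgebra (ZMod p) G)).injective p
  conv_lhs => rw [aux_repr x]
  rw [sum_pow_char_pow]
  refine Finset.sum_congr rfl fun g _ => ?_
  rw [single_pow, ZMod.pow_card_pow]

open MonoidAlgebra in
/-- An idempotent has constant coefficients along powers of `p`. -/
lemma aux_coeff {G : Type*} [CommGroup G] [Fintype G] {p n : ℕ} [Fact p.Prime]
    (hco : p.Coprime n) (hn : Monoid.exponent G = n)
    (x : MonoidAlgebra (ZMod p) G) (hx : IsIdempotentElem x) (k : ℕ) (g : G) :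
    x.coeff (g ^ (p ^ k)) = x.coeff g := by
  classical
  have hpk : p ^ k ≠ 0 := pow_ne_zero _ (Fact.out : p.Prime).ne_zero
  have h1 : x ^ (p ^ k) = x := hx.pow_eq hpk
  have hinj : Function.Injective (fun h : G => h ^ (p ^ k)) := by
    intro a b hab
    have h2 : (a / b) ^ (p ^ k) = 1 := by simp only at hab; rw [div_pow, hab, div_self']
    have h3 : (a / b) ^ n = 1 := hn ▸ Monoid.pow_exponent_eq_one _
    have h4 : (a / b) ^ (Nat.gcd (p ^ k) n) = 1 := pow_gcd_eq_one.2 ⟨h2, h3⟩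
    rw [Nat.Coprime.pow_left k hco, pow_one] at h4
    exact div_eq_one.1 h4
  conv_lhs => rw [← h1, aux_frob]
  simp [Finsupp.single_apply, hinj.eq_iff]

open MonoidAlgebra in
/-- Sum of the elements of a subgroup. -/
noncomputable def auxN (R : Type*) {G : Type*} [CommRing R] [CommGroup G] [Fintype G]
    (H : Subgroup G) : MonoidAlgebra R G :=
  by classical exact ∑ g ∈ Finset.univ.filter (fun g => g ∈ H), single g 1

open MonoidAlgebra in
/-- Sum of the generators of a subgroup. -/
noncomputable def auxS (R : Type*) {G : Type*} [CommRing R] [CommGroup G] [Fintype G]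
    (H : Subgroup G) : MonoidAlgebra R G :=
  by classical exact ∑ g ∈ Finset.univ.filter (fun g => Subgroup.zpowers g = H), single g 1

open MonoidAlgebra in
lemma auxN_eq (R : Type*) {G : Type*} [CommRing R] [CommGroup G] [Fintype G] [Fintype (Subgroup G)]
    [DecidableRel ((· ≤ ·) : Subgroup G → Subgroup G → Prop)]
    (H : Subgroup G) : auxN R H = ∑ K ∈ Finset.univ.filter (fun K => K ≤ H), auxS R K := by
  classical
  unfold auxN auxS
  rw [← Finset.sum_fiberwise_of_maps_to (t := Finset.univ.filter (fun K => K ≤ H))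
    (g := fun g => Subgroup.zpowers g)]
  · refine Finset.sum_congr rfl fun K hK => ?_
    rw [Finset.filter_filter]
    refine Finset.sum_congr ?_ fun _ _ => rfl
    ext g
    simp only [Finset.mem_filter, Finset.mem_univ, true_and] at hK ⊢
    constructor
    · exact fun h => h.2
    · rintro rfl
      exact ⟨hK (Subgroup.mem_zpowers g), rfl⟩
  · intro g hg
    simpa using hg

lemma auxS_mem (R : Type*) {G : Type*} [CommRing R] [CommGroup G] [Fintype G] (H : Subgroup G) :
    auxS R H ∈ Submodule.span R (Set.range (auxN R (G := G))) := by
  classical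
  have : Fintype (Subgroup G) := Fintype.ofFinite _
  induction H using WellFoundedLT.induction with
  | ind H ih =>
    have h := auxN_eq R H
    rw [← Finset.add_sum_erase _ _ (a := H) (by simp)] at h
    rw [← sub_eq_iff_eq_add] at h
    rw [← h]
    refine Submodule.sub_mem _ (Submodule.subset_span ⟨H, rfl⟩) (Submodule.sum_mem _ ?_)
    intro K hK
    simp only [Finset.mem_erase, Finset.mem_filter, Finset.mem_univ, true_and] at hK
    exact ih K (lt_of_le_of_ne hK.2 hK.1)

open MonoidAlgebra in
lemma auxN_mul (R : Type*) {G : Type*} [CommRing R] [CommGroup G] [Fintype G] (H : Subgroup G) :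
    auxN R H * auxN R H = (Nat.card H : R) • auxN R H := by
  classical
  have h1 : ∀ g ∈ H, single g 1 * auxN R H = auxN R H := by
    intro g hg
    unfold auxN
    rw [Finset.mul_sum]
    refine Finset.sum_bij (fun h _ => g * h) ?_ ?_ ?_ ?_
    · intro a ha
      simp only [Finset.mem_filter, Finset.mem_univ, true_and] at ha ⊢
      exact H.mul_mem hg ha
    · intro a _ b _ hab
      exact mul_left_cancel hab
    · intro b hb
      simp only [Finset.mem_filter, Finset.mem_univ, true_and] at hb
      exact ⟨g⁻¹ * b, by simpa using H.mul_mem (H.inv_mem hg) hb, by simp⟩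
    · intro a _
      simp [single_mul_single]
  conv_lhs => enter [1]; unfold auxN
  rw [Finset.sum_mul, Finset.sum_congr rfl (g := fun _ => auxN R H)]
  · rw [Finset.sum_const, Nat.cast_smul_eq_nsmul]
    congr 1
    rw [Nat.card_eq_fintype_card, Fintype.card_subtype]
  · intro g hg
    exact h1 g (by simpa using hg)

/-- Idempotents of `𝔽_p[G]` are in the span of the subgroup sums. -/
lemma aux_idem_mem {G : Type*} [CommGroup G] [Fintype G] {p n : ℕ} [Fact p.Prime] [NeZero n]
    (hco : p.Coprime n) (hn : Monoid.exponent G = n) (hord : orderOf (p : ZMod n) = n.totient)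
    (x : MonoidAlgebra (ZMod p) G) (hx : IsIdempotentElem x) :
    x ∈ Submodule.span (ZMod p) (Set.range (auxN (ZMod p) (G := G))) := by
  classical
  have : Fintype (Subgroup G) := Fintype.ofFinite _
  rw [aux_repr x, ← Finset.sum_fiberwise (g := fun g : G => Subgroup.zpowers g)]
  refine Submodule.sum_mem _ fun K _ => ?_
  by_cases hK : ∃ g : G, Subgroup.zpowers g = K
  · obtain ⟨g, rfl⟩ := hK
    have : ∑ i ∈ Finset.univ.filter (fun i => Subgroup.zpowers i = Subgroup.zpowers g),
        MonoidAlgebra.single i (x.coeff i) = x.coeff g • auxS (ZMod p) (Subgroup.zpowers g) := by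
      unfold auxS
      rw [Finset.smul_sum]
      refine Finset.sum_congr ?_ fun i hi => ?_
      · congr
      · simp only [Finset.mem_filter, Finset.mem_univ, true_and] at hi
        obtain ⟨j, rfl⟩ := aux_gen hco hn hord g i hi.symm
        rw [aux_coeff hco hn x hx]
        simp
    rw [this]
    exact Submodule.smul_mem _ _ (auxS_mem _ _)
  · rw [Finset.sum_eq_zero]
    · exact Submodule.zero_mem _
    · intro i hi
      exact absurd ⟨i, by simpa using hi⟩ hK

lemma aux_natCast_unit {R : Type*} [CommRing R] [IsLocalRing R] {p : ℕ} [Fact p.Prime]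
    (ρ : R →+* ZMod p) (hρ : Function.Surjective ρ) (m : ℕ) (hm : ¬ p ∣ m) : IsUnit (m : R) := by
  have := IsLocalHom.of_surjective ρ hρ
  refine isUnit_of_map_unit ρ _ ?_
  rw [map_natCast, isUnit_iff_ne_zero, Ne, ZMod.natCast_eq_zero_iff]
  exact hm

open MonoidAlgebra in
/-- Every idempotent lifts. -/
lemma aux_idem_lift {R G : Type*} [CommRing R] [IsLocalRing R] [CommGroup G] [Fintype G] {p n : ℕ}
    [Fact p.Prime] [NeZero n] (ρ : R →+* ZMod p) (hρ : Function.Surjective ρ)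
    (hco : p.Coprime n) (hn : Monoid.exponent G = n) (hord : orderOf (p : ZMod n) = n.totient)
    (x : MonoidAlgebra (ZMod p) G) (hx : IsIdempotentElem x) :
    ∃ f : MonoidAlgebra R G, IsIdempotentElem f ∧ mapRingHom G ρ f = x := by
  classical
  have : Fintype (Subgroup G) := Fintype.ofFinite _
  have hcard : ∀ H : Subgroup G, ¬ p ∣ Nat.card H := by
    intro H hH
    obtain ⟨h, hh⟩ := exists_prime_orderOf_dvd_card' p hH
    have h1 : orderOf (h : G) ∣ n := hn ▸ Monoid.order_dvd_exponent _
    rw [Subgroup.orderOf_coe, hh] at h1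
    have h2 := Nat.Coprime.eq_one_of_dvd hco h1
    exact (Fact.out : p.Prime).one_lt.ne' h2
  have hu : ∀ H : Subgroup G, ∃ v : R, v * (Nat.card H : R) = 1 := fun H =>
    (aux_natCast_unit ρ hρ _ (hcard H)).exists_left_inv
  choose v hv using hu
  let e : Subgroup G → MonoidAlgebra R G := fun H => v H • auxN R H
  have he : ∀ H, IsIdempotentElem (e H) := by
    intro H
    change (v H • auxN R H) * (v H • auxN R H) = v H • auxN R H
    rw [smul_mul_smul_comm, auxN_mul, smul_smul, mul_assoc, hv, mul_one]
  have hmap : ∀ H, mapRingHom G ρ (auxN R H) = auxN (ZMod p) H := by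
    intro H
    simp [auxN]
  have hmap2 : ∀ H, mapRingHom G ρ (e H) = ρ (v H) • auxN (ZMod p) H := by
    intro H
    ext g
    simp [e, ← hmap]
  obtain ⟨c, hc⟩ := (Submodule.mem_span_range_iff_exists_fun _).1
    (aux_idem_mem hco hn hord x hx)
  obtain ⟨f, hf, hf2⟩ := aux_lift (mapRingHom G ρ) e he (fun H => c H * ρ (Nat.card H : R))
    Finset.univ 0
  refine ⟨f, hf, ?_⟩
  rw [hf2]
  have : ∑ H, (c H * ρ (Nat.card H : R)) • mapRingHom G ρ (e H) = x := by
    rw [← hc]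
    refine Finset.sum_congr rfl fun H _ => ?_
    rw [hmap2, smul_smul, mul_assoc, ← map_mul, mul_comm (Nat.card H : R), hv, map_one, mul_one]
  rw [this, map_zero, zero_add]
  apply hx.pow_eq
  have := (Fact.out : p.Prime).two_le
  omega

open MonoidAlgebra in
lemma aux_isUnit {R G : Type*} [CommRing R] [IsLocalRing R] [CommGroup G] [Fintype G] {p : ℕ}
    [Fact p.Prime] (ρ : R →+* ZMod p) (hρ : Function.Surjective ρ) (u : MonoidAlgebra R G)
    (hu : IsUnit (mapRingHom G ρ u)) : IsUnit u := by
  by_contra hnu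
  obtain ⟨M, hM, huM⟩ := exists_max_ideal_of_mem_nonunits hnu
  have hint : Algebra.IsIntegral R (MonoidAlgebra R G) := by
    have : Module.Finite R (MonoidAlgebra R G) := inferInstance
    infer_instance
  have hcomap : (M.comap (algebraMap R (MonoidAlgebra R G))).IsMaximal :=
    Ideal.isMaximal_comap_of_isIntegral_of_isMaximal M
  have hmax := IsLocalRing.eq_maximalIdeal hcomap
  have hker : (RingHom.ker ρ) = IsLocalRing.maximalIdeal R :=
    IsLocalRing.eq_maximalIdeal (RingHom.ker_isMaximal_of_surjective ρ hρ)
  obtain ⟨w, hw⟩ := hu.exists_right_inv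
  obtain ⟨v, rfl⟩ : ∃ v, mapRingHom G ρ v = w := by
    choose s hs using hρ
    refine ⟨∑ g, single g (s (w.coeff g)), ?_⟩
    conv_rhs => rw [aux_repr w]
    simp [hs]
  have hz : mapRingHom G ρ (u * v - 1) = 0 := by
    rw [map_sub, map_mul, hw, map_one, sub_self]
  have hmem : u * v - 1 ∈ M := by
    rw [aux_repr (u * v - 1)]
    refine Submodule.sum_mem _ fun g _ => ?_
    have h1 : ρ ((u * v - 1).coeff g) = 0 := by
      rw [← coeff_mapRingHom, hz]; rfl
    have h2 : (u * v - 1).coeff g ∈ M.comap (algebraMap R (MonoidAlgebra R G)) := by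
      rw [hmax, ← hker]; exact h1
    have h3 : single g ((u * v - 1).coeff g) =
        algebraMap R (MonoidAlgebra R G) ((u * v - 1).coeff g) * single g 1 := by
      generalize (u * v - 1).coeff g = t
      simp [coe_algebraMap, single_mul_single]
    rw [h3]
    exact M.mul_mem_right _ h2
  apply hM.ne_top
  rw [Ideal.eq_top_iff_one]
  have := M.sub_mem (M.mul_mem_right v huM) hmem
  simpa using this

open MonoidAlgebra in
lemma aux_iii_i {R G : Type*} [CommRing R] [IsLocalRing R] [CommGroup G] [Fintype G] {p n : ℕ}
    [Fact p.Prime] [NeZero n] (hp2 : p ≠ 2) (ρ : R →+* ZMod p) (hρ : Function.Surjective ρ)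
    (hco : p.Coprime n) (hn : Monoid.exponent G = n) (hord : orderOf (p : ZMod n) = n.totient) :
    IsCleanRing (MonoidAlgebra R G) := by
  intro r
  have hp3 : 3 ≤ p := by have := (Fact.out : p.Prime).two_le; omega
  obtain ⟨m, hm⟩ : ∃ m, p ^ n.totient = m + 3 := by
    refine Nat.exists_eq_add_of_le' ?_
    calc 3 ≤ p := hp3
      _ = p ^ 1 := (pow_one p).symm
      _ ≤ _ := Nat.pow_le_pow_right (by omega) (Nat.totient_pos.2 (NeZero.pos n))
  have hq : ∀ x : MonoidAlgebra (ZMod p) G, x ^ (m + 3) = x := by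
    intro x
    rw [← hm, aux_frob]
    conv_rhs => rw [aux_repr x]
    refine Finset.sum_congr rfl fun g _ => ?_
    congr 1
    conv_rhs => rw [← pow_one g]
    rw [pow_eq_pow_iff_modEq]
    exact (Nat.ModEq.pow_totient hco).of_dvd (hn ▸ Monoid.order_dvd_exponent g)
  set x := mapRingHom G ρ r with hx
  have h3 := hq x
  have hi : IsIdempotentElem (1 - x ^ (m + 2)) := by
    unfold IsIdempotentElem
    have : x ^ (m + 2) * x ^ (m + 2) = x ^ (m + 2) := by
      calc _ = x ^ (m + 3) * x ^ (m + 1) := by ring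
        _ = x * x ^ (m + 1) := by rw [h3]
        _ = _ := by ring
    linear_combination this
  obtain ⟨f, hf, hfx⟩ := aux_idem_lift ρ hρ hco hn hord _ hi
  refine ⟨r - f, f, aux_isUnit ρ hρ _ ?_, hf, by ring⟩
  rw [map_sub, hfx, ← hx]
  refine IsUnit.of_mul_eq_one (x ^ (m + 1) - (1 - x ^ (m + 2))) ?_
  have h4 : x * (1 - x ^ (m + 2)) = 0 := by linear_combination -h3
  have h5 : x ^ (m + 1) * (1 - x ^ (m + 2)) = 0 := by linear_combination x ^ m * h4
  unfold IsIdempotentElem at hi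
  linear_combination -h4 - h5 + hi

lemma aux_clean_surj {A B : Type*} [CommRing A] [CommRing B] (f : A →+* B)
    (hf : Function.Surjective f) (hA : IsCleanRing A) : IsCleanRing B := by
  intro r
  obtain ⟨a, rfl⟩ := hf r
  obtain ⟨u, e, hu, he, rfl⟩ := hA a
  exact ⟨f u, f e, hu.map f, he.map f, map_add f u e⟩

lemma aux_clean_local {A : Type*} [CommRing A] [IsDomain A] (hA : IsCleanRing A) :
    IsLocalRing A := by
  refine IsLocalRing.of_isUnit_or_isUnit_one_sub_self fun a => ?_
  obtain ⟨u, e, hu, he, rfl⟩ := hA a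
  rcases IsIdempotentElem.iff_eq_zero_or_one.1 he with rfl | rfl
  · left; simpa using hu
  · right
    have : 1 - (u + 1) = -u := by ring
    rw [this]; exact hu.neg

open Polynomial in
lemma aux_prime {R : Type*} [CommRing R] [IsDomain R] [UniqueFactorizationMonoid R]
    (σ : R →+* ℚ) {n : ℕ} (hn : 0 < n) : Prime (cyclotomic n R) := by
  rw [← UniqueFactorizationMonoid.irreducible_iff_prime]
  refine Monic.irreducible_of_irreducible_map σ _ (cyclotomic.monic n R) ?_
  rw [map_cyclotomic]
  exact cyclotomic.irreducible_rat hn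

open Polynomial in
lemma aux_i_ii {R G : Type*} [CommRing R] [CommGroup G] [Fintype G] {n : ℕ} [NeZero n]
    (hn : Monoid.exponent G = n) (hprime : Prime (cyclotomic n R)) (hun : IsUnit (n : R))
    (hA : IsCleanRing (MonoidAlgebra R G)) :
    IsCleanRing (R[X] ⧸ Ideal.span {cyclotomic n R}) := by
  have hdom : IsDomain (AdjoinRoot (cyclotomic n R)) :=
    AdjoinRoot.isDomain_of_prime hprime
  change IsCleanRing (AdjoinRoot (cyclotomic n R))
  set Q := AdjoinRoot (cyclotomic n R) with hQ
  have hnz : NeZero (n : Q) := by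
    constructor
    have := hun.map (algebraMap R Q)
    rw [map_natCast] at this
    exact this.ne_zero
  set ζ : Q := AdjoinRoot.root (cyclotomic n R) with hζd
  have hζ : IsPrimitiveRoot ζ n := by
    rw [← isRoot_cyclotomic_iff, ← map_cyclotomic n (AdjoinRoot.of (cyclotomic n R))]
    exact AdjoinRoot.isRoot_root _
  have hE : HasEnoughRootsOfUnity Q n := ⟨⟨ζ, hζ⟩, inferInstance⟩
  have hE' : HasEnoughRootsOfUnity Q (Monoid.exponent G) := hn ▸ hE
  obtain ⟨φ⟩ := CommGroup.monoidHom_mulEquiv_of_hasEnoughRootsOfUnity G Q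
  obtain ⟨g, hg⟩ := Monoid.exists_orderOf_eq_exponent (Monoid.ExponentExists.of_finite (G := G))
  set χ := φ.symm g with hχ
  have hoχ : orderOf χ = n := by
    rw [hχ, MulEquiv.orderOf_eq, hg, hn]
  have hle : χ.range ≤ rootsOfUnity n Q := by
    rintro _ ⟨a, rfl⟩
    have han : a ^ n = 1 := by rw [← hn, Monoid.pow_exponent_eq_one]
    rw [mem_rootsOfUnity, ← map_pow, han, map_one]
  have hcard : Nat.card (rootsOfUnity n Q) = n := HasEnoughRootsOfUnity.natCard_rootsOfUnity Q n
  have hfin : Finite (rootsOfUnity n Q) := HasEnoughRootsOfUnity.finite_rootsOfUnity Q n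
  have hdvd : n ∣ Nat.card χ.range := by
    refine dvd_trans (dvd_of_eq hoχ.symm) ?_
    apply orderOf_dvd_of_pow_eq_one
    ext a
    have h1 : (⟨χ a, a, rfl⟩ : χ.range) ^ Nat.card χ.range = 1 := pow_card_eq_one'
    have h2 := congrArg (fun z : χ.range => ((z : Qˣ) : Q)) h1
    simpa using h2
  have heq : χ.range = rootsOfUnity n Q := by
    apply Subgroup.eq_of_le_of_card_ge hle
    rw [hcard]
    have : Finite χ.range := inferInstance
    exact Nat.le_of_dvd Nat.card_pos hdvd
  obtain ⟨a, ha⟩ : ∃ a, ((χ a : Qˣ) : Q) = ζ := by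
    have : (hζ.isUnit (NeZero.ne n)).unit ∈ χ.range := by
      rw [heq, mem_rootsOfUnity]
      ext
      simp [hζ.pow_eq_one]
    obtain ⟨a, ha⟩ := this
    exact ⟨a, by rw [ha]; rfl⟩
  let F : MonoidAlgebra R G →ₐ[R] Q := MonoidAlgebra.lift R Q G ((Units.coeHom Q).comp χ)
  refine aux_clean_surj (F : MonoidAlgebra R G →+* Q) ?_ hA
  change Function.Surjective F
  rw [← AlgHom.range_eq_top, eq_top_iff, ← AdjoinRoot.adjoinRoot_eq_top]
  apply Algebra.adjoin_le
  rintro _ rfl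
  exact ⟨MonoidAlgebra.single a 1, by simp [F, ha, hζd]⟩

open Polynomial in
lemma aux_ii_iii {R : Type*} [CommRing R] {p n : ℕ} [Fact p.Prime] [NeZero n]
    (hprime : Prime (cyclotomic n R)) (ρ : R →+* ZMod p) (hρ : Function.Surjective ρ)
    (hco : p.Coprime n)
    (hA : IsCleanRing (R[X] ⧸ Ideal.span {cyclotomic n R})) :
    orderOf (p : ZMod n) = n.totient := by
  have hdom : IsDomain (AdjoinRoot (cyclotomic n R)) :=
    AdjoinRoot.isDomain_of_prime hprime
  have hloc : IsLocalRing (AdjoinRoot (cyclotomic n R)) := aux_clean_local hA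
  set Φ := cyclotomic n (ZMod p) with hΦ
  have hnz : NeZero ((n : ℕ) : ZMod p) := by
    constructor
    rw [Ne, ZMod.natCast_eq_zero_iff]
    exact ((Fact.out : p.Prime).coprime_iff_not_dvd).1 hco
  have hnu : ¬ IsUnit Φ := by
    apply not_isUnit_of_degree_pos
    exact degree_cyclotomic_pos n _ (NeZero.pos n)
  have hnt : Nontrivial (AdjoinRoot Φ) := Ideal.Quotient.nontrivial_iff.2 (by
    rwa [Ne, Ideal.span_singleton_eq_top])
  let F : AdjoinRoot (cyclotomic n R) →+* AdjoinRoot Φ :=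
    Ideal.quotientMap (Ideal.span {Φ}) (mapRingHom ρ) (by
      rw [Ideal.span_singleton_le_iff_mem, Ideal.mem_comap, coe_mapRingHom, map_cyclotomic]
      exact Ideal.mem_span_singleton_self _)
  have hF : Function.Surjective F := by
    intro y
    obtain ⟨q, rfl⟩ := AdjoinRoot.mk_surjective y
    obtain ⟨q, rfl⟩ := Polynomial.map_surjective ρ hρ q
    exact ⟨AdjoinRoot.mk _ q, rfl⟩
  have hloc2 : IsLocalRing (AdjoinRoot Φ) := IsLocalRing.of_surjective' F hF
  have hnunit : ∀ f : (ZMod p)[X], f ∣ Φ → IsUnit (AdjoinRoot.mk Φ f) → IsUnit f := by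
    intro f hf hu
    obtain ⟨y, hy⟩ := hu.exists_right_inv
    obtain ⟨h, rfl⟩ := AdjoinRoot.mk_surjective y
    rw [← map_mul, ← map_one (AdjoinRoot.mk Φ), AdjoinRoot.mk_eq_mk] at hy
    have h1 : f ∣ f * h - 1 := hf.trans hy
    have h2 : f ∣ 1 := by
      have := dvd_sub (Dvd.intro h rfl) h1
      simpa using this
    exact isUnit_of_dvd_one h2
  have hirr : Irreducible Φ := by
    refine ⟨hnu, fun f g hfg => ?_⟩
    have hsep : Φ.Separable := separable_cyclotomic n (ZMod p)
    rw [hfg] at hsep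
    obtain ⟨a, b, hab⟩ := hsep.isCoprime
    have h1 : IsUnit (AdjoinRoot.mk Φ (a * f) + AdjoinRoot.mk Φ (b * g)) := by
      rw [← map_add, hab, map_one]; exact isUnit_one
    rcases IsLocalRing.isUnit_or_isUnit_of_isUnit_add h1 with h | h
    · left
      rw [map_mul] at h
      exact hnunit f ⟨g, hfg⟩ (isUnit_of_mul_isUnit_right h)
    · right
      rw [map_mul] at h
      exact hnunit g ⟨f, by rw [hfg, mul_comm]⟩ (isUnit_of_mul_isUnit_right h)
  have hdeg := natDegree_of_dvd_cyclotomic_of_irreducible (K := ZMod p) (p := p) (f := 1) (n := n)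
    (by simp) hco (dvd_refl _) hirr
  rw [natDegree_cyclotomic] at hdeg
  rw [hdeg, ← orderOf_units]
  simp

/-- For an odd prime `p` and a finite abelian group `G` of exponent `n` with `p ∤ n`, the
following are equivalent: (i) `ℤ_(p)[G]` is clean; (ii) `ℤ_(p)[x]/(Φ_n(x))` is clean;
(iii) `p` is a primitive root of `n`. -/
theorem clean_localization_monoidAlgebra_iff
    (p : ℕ) (hp : p.Prime) (hp2 : p ≠ 2)
    [hP : (Ideal.span {(p : ℤ)}).IsPrime]
    (G : Type*) [CommGroup G] [Fintype G]
    (n : ℕ) (hn : Monoid.exponent G = n) (hpn : ¬ p ∣ n) :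
    (IsCleanRing (MonoidAlgebra (Localization.AtPrime (Ideal.span {(p : ℤ)})) G) ↔
      IsCleanRing (Polynomial (Localization.AtPrime (Ideal.span {(p : ℤ)})) ⧸
        Ideal.span
          {Polynomial.cyclotomic n (Localization.AtPrime (Ideal.span {(p : ℤ)}))})) ∧
    (IsCleanRing (MonoidAlgebra (Localization.AtPrime (Ideal.span {(p : ℤ)})) G) ↔
      orderOf ((p : ZMod n)) = Nat.totient n) := by
  have hpf : Fact p.Prime := ⟨hp⟩
  have hnz : NeZero n := ⟨by rintro rfl; exact hpn (dvd_zero p)⟩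
  have hco : p.Coprime n := hp.coprime_iff_not_dvd.2 hpn
  set I : Ideal ℤ := Ideal.span {(p : ℤ)} with hI
  have hI0 : I ≠ ⊥ := by
    rw [hI, Ne, Ideal.span_singleton_eq_bot]
    exact_mod_cast hp.ne_zero
  have hdvr := IsLocalization.AtPrime.isDiscreteValuationRing_of_dedekind_domain ℤ hI0
    (Localization.AtPrime I)
  have hmem : ∀ y : I.primeCompl, ¬ (p : ℤ) ∣ (y : ℤ) := by
    intro y hy
    exact y.2 (Ideal.mem_span_singleton.2 hy)
  let ρ : Localization.AtPrime I →+* ZMod p :=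
    IsLocalization.lift (M := I.primeCompl) (g := Int.castRingHom (ZMod p)) (by
      intro y
      rw [isUnit_iff_ne_zero, eq_intCast, Ne, ZMod.intCast_zmod_eq_zero_iff_dvd]
      exact hmem y)
  have hρ : Function.Surjective ρ := by
    intro z
    obtain ⟨k, rfl⟩ := ZMod.intCast_surjective z
    exact ⟨(k : Localization.AtPrime I), by simp⟩
  let σ : Localization.AtPrime I →+* ℚ :=
    IsLocalization.lift (M := I.primeCompl) (g := Int.castRingHom ℚ) (by
      intro y
      rw [isUnit_iff_ne_zero, eq_intCast, Ne, Int.cast_eq_zero]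
      intro h
      exact hmem y (h ▸ dvd_zero _))
  have hprime := aux_prime σ (NeZero.pos n)
  have hun := aux_natCast_unit ρ hρ n hpn
  have h12 := aux_i_ii hn hprime hun
  have h23 := aux_ii_iii hprime ρ hρ hco
  have h31 := aux_iii_i (G := G) hp2 ρ hρ hco hn
  exact ⟨⟨h12, fun h => h31 (h23 h)⟩, ⟨fun h => h23 (h12 h), h31⟩⟩
end

section
/- Let p be an odd prime and let G be a finite abelian group with exponent n such that p ∤ n. Then the following are equivalent: (i) the group ring ℤ_(p)[G] is feebly clean but not clean; (ii) the ring ℤ_(p)[x]/(Φ_n(x)) is feebly clean but not clean; (iii) φ(n) = 2·ord_n(p). -/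
/-- A ring is *feebly clean* if every element can be written as `u + e₁ - e₂` with `u`
a unit and `e₁`, `e₂` orthogonal idempotents. -/
def IsFeeblyCleanRing (R : Type*) [Ring R] : Prop :=
  ∀ r : R, ∃ u e₁ e₂ : R, IsUnit u ∧ IsIdempotentElem e₁ ∧ IsIdempotentElem e₂ ∧
    e₁ * e₂ = 0 ∧ r = u + e₁ - e₂

set_option linter.unusedSectionVars false

section Quot

theorem IsCleanRing.of_surjective {A B : Type*} [Ring A] [Ring B] (f : A →+* B)
    (hf : Function.Surjective f) (h : IsCleanRing A) : IsCleanRing B := by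
  intro r
  obtain ⟨a, rfl⟩ := hf r
  obtain ⟨u, e, hu, he, rfl⟩ := h a
  exact ⟨f u, f e, hu.map f, he.map f, by simp⟩

theorem IsFeeblyCleanRing.of_surjective {A B : Type*} [Ring A] [Ring B] (f : A →+* B)
    (hf : Function.Surjective f) (h : IsFeeblyCleanRing A) : IsFeeblyCleanRing B := by
  intro r
  obtain ⟨a, rfl⟩ := hf r
  obtain ⟨u, e, e', hu, he, he', h0, rfl⟩ := h a
  exact ⟨f u, f e, f e', hu.map f, he.map f, he'.map f, by rw [← map_mul, h0, map_zero], by simp⟩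

theorem isCleanRing_iff_of_isDomain {A : Type*} [CommRing A] [IsDomain A] :
    IsCleanRing A ↔ ∀ a : A, IsUnit a ∨ IsUnit (a - 1) := by
  constructor
  · intro h a
    obtain ⟨u, e, hu, he, rfl⟩ := h a
    rcases IsIdempotentElem.iff_eq_zero_or_one.1 he with rfl | rfl
    · left; simpa using hu
    · right; simpa using hu
  · intro h a
    rcases h a with h | h
    · exact ⟨a, 0, h, IsIdempotentElem.zero, by simp⟩
    · exact ⟨a - 1, 1, h, IsIdempotentElem.one, by simp⟩

theorem isFeeblyCleanRing_iff_of_isDomain {A : Type*} [CommRing A] [IsDomain A] :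
    IsFeeblyCleanRing A ↔ ∀ a : A, IsUnit a ∨ IsUnit (a - 1) ∨ IsUnit (a + 1) := by
  constructor
  · intro h a
    obtain ⟨u, e, e', hu, he, he', h0, rfl⟩ := h a
    rcases IsIdempotentElem.iff_eq_zero_or_one.1 he with rfl | rfl
    · rcases IsIdempotentElem.iff_eq_zero_or_one.1 he' with rfl | rfl
      · left; simpa using hu
      · right; right; simpa using hu
    · rcases IsIdempotentElem.iff_eq_zero_or_one.1 he' with rfl | rfl
      · right; left; simpa using hu
      · simp at h0
  · intro h a
    rcases h a with h | h | h
    · exact ⟨a, 0, 0, h, IsIdempotentElem.zero, IsIdempotentElem.zero, by simp, by simp⟩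
    · exact ⟨a - 1, 1, 0, h, IsIdempotentElem.one, IsIdempotentElem.zero, by simp, by simp⟩
    · exact ⟨a + 1, 0, 1, h, IsIdempotentElem.zero, IsIdempotentElem.one, by simp, by simp⟩

end Quot

section Fourier

variable {R L G : Type*} [CommRing R] [Field L] [Algebra R L] [CommGroup G]

/-- Evaluation of the group ring at a character. -/
noncomputable def charEval (R : Type*) {L G : Type*} [CommRing R] [Field L] [Algebra R L]
    [CommGroup G] (χ : G →* Lˣ) : MonoidAlgebra R G →ₐ[R] L :=
  MonoidAlgebra.lift R L G ((Units.coeHom L).comp χ)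

theorem charEval_single (χ : G →* Lˣ) (g : G) (r : R) :
    charEval R χ (MonoidAlgebra.single g r) = algebraMap R L r * (χ g : L) := by
  simp [charEval, Algebra.smul_def]

theorem charEval_eq_sum [Fintype G] (χ : G →* Lˣ) (b : MonoidAlgebra R G) :
    charEval R χ b = ∑ g, algebraMap R L (b.coeff g) * (χ g : L) := by
  rw [charEval, MonoidAlgebra.lift_apply, Finsupp.sum_fintype]
  · simp [Algebra.smul_def]
  · simp

theorem sum_char_ratio [Fintype G] (χ ψ : G →* Lˣ) [Decidable (ψ = χ)] :
    ∑ g, (ψ g⁻¹ : L) * (χ g : L) = if ψ = χ then (Fintype.card G : L) else 0 := by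
  split_ifs with h
  · subst h
    simp
  · have := sum_hom_units_eq_zero ((Units.coeHom L).comp (ψ⁻¹ * χ)) (by
      intro h1
      apply h
      ext g
      have := DFunLike.congr_fun h1 g
      simp at this
      field_simp at this
      exact this.symm)
    simpa using this

theorem sum_char_eq_zero [Finite G] [HasEnoughRootsOfUnity L (Monoid.exponent G)]
    [Fintype (G →* Lˣ)] {g : G} (hg : g ≠ 1) : ∑ χ : G →* Lˣ, (χ g : L) = 0 := by
  obtain ⟨φ, hφ⟩ := CommGroup.exists_apply_ne_one_of_hasEnoughRootsOfUnity G L hg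
  have h := sum_hom_units_eq_zero ((Units.coeHom L).comp (MonoidHom.eval g : (G →* Lˣ) →* Lˣ)) (by
      intro h1
      apply hφ
      have := DFunLike.congr_fun h1 φ
      simpa using this)
  simpa using h

theorem charEval_injective [CharZero L] [Fintype G]
    [HasEnoughRootsOfUnity L (Monoid.exponent G)] (hRL : Function.Injective (algebraMap R L))
    {b c : MonoidAlgebra R G} (h : ∀ χ : G →* Lˣ, charEval R χ b = charEval R χ c) : b = c := by
  classical
  have := Fintype.ofFinite (G →* Lˣ)
  have key : ∀ d : MonoidAlgebra R G, ∀ k : G,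
      ∑ χ : G →* Lˣ, (χ k⁻¹ : L) * charEval R χ d =
        Fintype.card (G →* Lˣ) * algebraMap R L (d.coeff k) := by
    intro d k
    simp_rw [charEval_eq_sum, Finset.mul_sum]
    rw [Finset.sum_comm, Finset.sum_eq_single k]
    · calc _ = ∑ χ : G →* Lˣ, algebraMap R L (d.coeff k) := by
            refine Finset.sum_congr rfl fun χ _ => ?_
            have : (χ k : L) ≠ 0 := (χ k).ne_zero
            rw [map_inv, Units.val_inv_eq_inv_val]
            field_simp
        _ = _ := by simp
    · intro g _ hg
      have h1 : k⁻¹ * g ≠ 1 := fun h => hg (by rw [inv_mul_eq_one] at h; exact h.symm)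
      have h0 := sum_char_eq_zero (L := L) h1
      calc _ = algebraMap R L (d.coeff g) * ∑ χ : G →* Lˣ, (χ (k⁻¹ * g) : L) := by
            rw [Finset.mul_sum]
            refine Finset.sum_congr rfl fun χ _ => ?_
            rw [map_mul, Units.val_mul]; ring
        _ = 0 := by rw [h0, mul_zero]
    · simp
  ext k
  apply hRL
  have h1 := key b k
  simp_rw [h] at h1
  rw [key c k] at h1
  have hc : (Fintype.card (G →* Lˣ) : L) ≠ 0 := by
    simp
  exact (mul_left_cancel₀ hc h1).symm

variable [Algebra ℚ L] [Algebra R ℚ] [IsScalarTower R ℚ L] [IsFractionRing R ℚ]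
  [IsIntegrallyClosed R] [IsGalois ℚ L]

theorem mem_range_of_fixed (x : L) (hx : IsIntegral R x) (h : ∀ σ : L ≃ₐ[ℚ] L, σ x = x) :
    ∃ r : R, algebraMap R L r = x := by
  obtain ⟨q, rfl⟩ := (InfiniteGalois.mem_range_algebraMap_iff_fixed (k := ℚ) x).2 h
  have hq : IsIntegral R q := (isIntegral_algebraMap_iff (algebraMap ℚ L).injective).1 hx
  obtain ⟨r, rfl⟩ := IsIntegrallyClosed.isIntegral_iff.1 hq
  exact ⟨r, (IsScalarTower.algebraMap_apply R ℚ L r)⟩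

/-- The Galois conjugate of a character. -/
noncomputable def conjChar (σ : L ≃ₐ[ℚ] L) (χ : G →* Lˣ) : G →* Lˣ :=
  (Units.map (σ : L →* L)).comp χ

theorem conjChar_apply (σ : L ≃ₐ[ℚ] L) (χ : G →* Lˣ) (g : G) :
    ((conjChar σ χ g : Lˣ) : L) = σ (χ g) := rfl

theorem conjChar_bijective (σ : L ≃ₐ[ℚ] L) :
    Function.Bijective (conjChar σ : (G →* Lˣ) → (G →* Lˣ)) := by
  refine Function.bijective_iff_has_inverse.2 ⟨conjChar σ.symm, fun χ => ?_, fun χ => ?_⟩ <;>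
  · ext g
    simp [conjChar_apply]

theorem charEval_conj (σ : L ≃ₐ[ℚ] L) (χ : G →* Lˣ) (b : MonoidAlgebra R G) :
    charEval R (conjChar σ χ) b = σ (charEval R χ b) := by
  induction b using MonoidAlgebra.induction_linear with
  | zero => simp
  | add x y hx hy => simp [hx, hy]
  | single m r =>
    rw [charEval_single, charEval_single, map_mul, conjChar_apply,
      IsScalarTower.algebraMap_apply R ℚ L, AlgEquiv.commutes]

theorem isIntegral_char [Finite G] (χ : G →* Lˣ) (g : G) : IsIntegral R (χ g : L) := by
  refine IsIntegral.of_pow (n := Nat.card G) Nat.card_pos ?_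
  rw [← Units.val_pow_eq_pow_val, ← map_pow, pow_card_eq_one', map_one, Units.val_one]
  exact isIntegral_one

theorem exists_charEval_eq [Fintype G] (hG : IsUnit (Fintype.card G : R))
    (f : (G →* Lˣ) → L) (hf : ∀ σ : L ≃ₐ[ℚ] L, ∀ χ, f (conjChar σ χ) = σ (f χ))
    (hint : ∀ χ, IsIntegral R (f χ)) :
    ∃ b : MonoidAlgebra R G, ∀ χ : G →* Lˣ, charEval R χ b = f χ := by
  classical
  have := Fintype.ofFinite (G →* Lˣ)
  have h1 : ∀ g : G, ∃ r : R, algebraMap R L r = ∑ ψ : G →* Lˣ, f ψ * (ψ g⁻¹ : L) := by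
    intro g
    apply mem_range_of_fixed
    · exact IsIntegral.sum _ fun ψ _ => (hint ψ).mul (isIntegral_char ψ g⁻¹)
    · intro σ
      rw [map_sum]
      refine Fintype.sum_bijective (conjChar σ) (conjChar_bijective σ) _ _ fun ψ => ?_
      rw [map_mul, hf, conjChar_apply]
  choose c hc using h1
  obtain ⟨v, hv⟩ := hG.exists_left_inv
  have hv' : algebraMap R L v * (Fintype.card G : L) = 1 := by
    have := congrArg (algebraMap R L) hv
    simpa using this
  refine ⟨∑ g, MonoidAlgebra.single g (v * c g), fun χ => ?_⟩
  simp_rw [map_sum, charEval_single, map_mul, hc]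
  calc _ = algebraMap R L v * ∑ ψ : G →* Lˣ, f ψ * ∑ g, (ψ g⁻¹ : L) * (χ g : L) := by
        simp_rw [Finset.mul_sum, Finset.sum_mul]
        rw [Finset.sum_comm]
        refine Finset.sum_congr rfl fun _ _ => Finset.sum_congr rfl fun _ _ => by ring
    _ = f χ := by
        simp_rw [sum_char_ratio]
        simp only [mul_ite, mul_zero, Finset.sum_ite_eq', Finset.mem_univ, if_true]
        rw [mul_left_comm, hv', mul_one]

/-- `y` is nonzero with integral inverse. -/
def InvInt (R : Type*) {L : Type*} [CommRing R] [Field L] [Algebra R L] (y : L) : Prop :=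
  y ≠ 0 ∧ IsIntegral R y⁻¹

theorem InvInt.conj_iff (σ : L ≃ₐ[ℚ] L) (y : L) : InvInt R (σ y) ↔ InvInt R y := by
  unfold InvInt
  rw [← map_inv₀]
  refine and_congr (by simp) ?_
  exact isIntegral_algHom_iff ((σ.restrictScalars R : L ≃ₐ[R] L) : L →ₐ[R] L) σ.injective

theorem isUnit_of_charEval [CharZero L] [Fintype G]
    [HasEnoughRootsOfUnity L (Monoid.exponent G)] (hRL : Function.Injective (algebraMap R L))
    (hG : IsUnit (Fintype.card G : R))
    (u : MonoidAlgebra R G) (h : ∀ χ : G →* Lˣ, InvInt R (charEval R χ u)) : IsUnit u := by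
  obtain ⟨v, hv⟩ := exists_charEval_eq (L := L) hG (fun χ => (charEval R χ u)⁻¹)
    (fun σ χ => by rw [charEval_conj, map_inv₀]) (fun χ => (h χ).2)
  refine IsUnit.of_mul_eq_one v (charEval_injective (L := L) hRL fun χ => ?_)
  rw [map_mul, hv, map_one, mul_inv_cancel₀ (h χ).1]

theorem isClean_monoidAlgebra [CharZero L] [Fintype G]
    [HasEnoughRootsOfUnity L (Monoid.exponent G)] (hRL : Function.Injective (algebraMap R L))
    (hG : IsUnit (Fintype.card G : R))
    (h : ∀ (b : MonoidAlgebra R G) (χ : G →* Lˣ),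
      InvInt R (charEval R χ b) ∨ InvInt R (charEval R χ b - 1)) :
    IsCleanRing (MonoidAlgebra R G) := by
  classical
  intro b
  obtain ⟨e, he⟩ := exists_charEval_eq (L := L) hG
    (fun χ => if InvInt R (charEval R χ b) then 0 else 1)
    (fun σ χ => by simp only [charEval_conj, InvInt.conj_iff]; split_ifs <;> simp)
    (fun χ => by split_ifs; exacts [isIntegral_zero, isIntegral_one])
  refine ⟨b - e, e, isUnit_of_charEval (L := L) hRL hG _ fun χ => ?_,
    charEval_injective (L := L) hRL fun χ => ?_, by simp⟩
  · rw [map_sub, he]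
    split_ifs with h1
    · simpa using h1
    · exact (h b χ).resolve_left h1
  · rw [map_mul, he]
    split_ifs <;> simp

theorem isFeeblyClean_monoidAlgebra [CharZero L] [Fintype G]
    [HasEnoughRootsOfUnity L (Monoid.exponent G)] (hRL : Function.Injective (algebraMap R L))
    (hG : IsUnit (Fintype.card G : R))
    (h : ∀ (b : MonoidAlgebra R G) (χ : G →* Lˣ),
      InvInt R (charEval R χ b) ∨ InvInt R (charEval R χ b - 1) ∨
        InvInt R (charEval R χ b + 1)) :
    IsFeeblyCleanRing (MonoidAlgebra R G) := by
  classical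
  intro b
  have hc : ∀ (σ : L ≃ₐ[ℚ] L) (y : L), InvInt R (σ y - 1) ↔ InvInt R (y - 1) := by
    intro σ y
    rw [← InvInt.conj_iff σ (y - 1), map_sub, map_one]
  obtain ⟨e, he⟩ := exists_charEval_eq (L := L) hG
    (fun χ => if InvInt R (charEval R χ b) then 0 else
      if InvInt R (charEval R χ b - 1) then 1 else 0)
    (fun σ χ => by simp only [charEval_conj, InvInt.conj_iff, hc]; split_ifs <;> simp)
    (fun χ => by split_ifs; exacts [isIntegral_zero, isIntegral_one, isIntegral_zero])
  obtain ⟨e', he'⟩ := exists_charEval_eq (L := L) hG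
    (fun χ => if InvInt R (charEval R χ b) then 0 else
      if InvInt R (charEval R χ b - 1) then 0 else 1)
    (fun σ χ => by simp only [charEval_conj, InvInt.conj_iff, hc]; split_ifs <;> simp)
    (fun χ => by split_ifs; exacts [isIntegral_zero, isIntegral_zero, isIntegral_one])
  refine ⟨b - e + e', e, e', isUnit_of_charEval (L := L) hRL hG _ fun χ => ?_,
    charEval_injective (L := L) hRL fun χ => ?_, charEval_injective (L := L) hRL fun χ => ?_,
    charEval_injective (L := L) hRL fun χ => ?_, by ring⟩
  · rw [map_add, map_sub, he, he']
    split_ifs with h1 h2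
    · simpa using h1
    · simpa using h2
    · simpa using ((h b χ).resolve_left h1).resolve_left h2
  · rw [map_mul, he]
    split_ifs <;> simp
  · rw [map_mul, he']
    split_ifs <;> simp
  · rw [map_mul, he, he', map_zero]
    split_ifs <;> simp

end Fourier

section Cyclo

open Polynomial

variable {R L G : Type*} [CommRing R] [Field L] [Algebra R L] [CommGroup G]

theorem exists_char_primitive [Finite G] [HasEnoughRootsOfUnity L (Monoid.exponent G)] :
    ∃ (χ : G →* Lˣ) (g : G), IsPrimitiveRoot (χ g : L) (Monoid.exponent G) := by
  obtain ⟨e⟩ := CommGroup.monoidHom_mulEquiv_of_hasEnoughRootsOfUnity G L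
  obtain ⟨g₀, hg₀⟩ := Monoid.exists_orderOf_eq_exponent (Monoid.ExponentExists.of_finite (G := G))
  have hχ : orderOf (e.symm g₀) = Monoid.exponent G := by
    rw [MulEquiv.orderOf_eq, hg₀]
  set χ := e.symm g₀
  have : Finite χ.range := Set.finite_range χ
  obtain ⟨⟨z, g, rfl⟩, hz⟩ := (inferInstance : IsCyclic χ.range).exists_generator
  refine ⟨χ, g, ?_⟩
  have hord : orderOf (χ g) = Monoid.exponent G := by
    apply Nat.dvd_antisymm
    · apply orderOf_dvd_of_pow_eq_one
      rw [← map_pow, Monoid.pow_exponent_eq_one, map_one]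
    · rw [← hχ]
      apply orderOf_dvd_of_pow_eq_one
      ext h
      obtain ⟨k, hk⟩ := hz ⟨χ h, h, rfl⟩
      have hk' : χ g ^ k = χ h := congrArg Subtype.val hk
      rw [MonoidHom.pow_apply, ← hk', ← zpow_natCast, ← zpow_mul, mul_comm, zpow_mul,
        zpow_natCast, pow_orderOf_eq_one, one_zpow, MonoidHom.one_apply]
  rw [← hord]
  exact IsPrimitiveRoot.coe_units_iff.2 (IsPrimitiveRoot.orderOf _)

/-- The embedding of `R[x]/(Φ_n)`. -/
noncomputable def cycEmb (R : Type*) {L : Type*} [CommRing R] [Field L] [Algebra R L] (n : ℕ)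
    (ζ : L) (hζ : IsPrimitiveRoot ζ n) (hn : 0 < n) :
    (R[X] ⧸ Ideal.span {cyclotomic n R}) →ₐ[R] L :=
  Ideal.Quotient.liftₐ _ (aeval ζ) (by
    intro a ha
    obtain ⟨c, rfl⟩ := Ideal.mem_span_singleton.1 ha
    have : aeval ζ (cyclotomic n R) = 0 := by
      rw [aeval_def, ← eval_map, map_cyclotomic]
      exact hζ.isRoot_cyclotomic hn
    rw [map_mul, this, zero_mul])

theorem cycEmb_mk (n : ℕ) (ζ : L) (hζ : IsPrimitiveRoot ζ n) (hn : 0 < n) (f : R[X]) :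
    cycEmb R n ζ hζ hn (Ideal.Quotient.mk _ f) = aeval ζ f := rfl

theorem cycEmb_injective [CharZero L] [Algebra ℚ L] [Algebra R ℚ] [IsScalarTower R ℚ L]
    (hR : Function.Injective (algebraMap R ℚ))
    (n : ℕ) (ζ : L) (hζ : IsPrimitiveRoot ζ n) (hn : 0 < n) :
    Function.Injective (cycEmb R n ζ hζ hn) := by
  rw [injective_iff_map_eq_zero]
  intro a ha
  obtain ⟨f, rfl⟩ := Ideal.Quotient.mk_surjective a
  rw [cycEmb_mk] at ha
  have hmin : cyclotomic n ℚ = minpoly ℚ ζ := by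
    convert cyclotomic_eq_minpoly_rat hζ hn
    exact Subsingleton.elim _ _
  rw [Ideal.Quotient.eq_zero_iff_mem, Ideal.mem_span_singleton,
    ← Polynomial.map_dvd_map (algebraMap R ℚ) hR (cyclotomic.monic n R), map_cyclotomic,
    hmin]
  have h2 := minpoly.dvd ℚ ζ (p := f.map (algebraMap R ℚ)) (by rwa [aeval_map_algebraMap])
  exact h2

theorem charEval_mem_range [Fintype G] (n : ℕ) (ζ : L) (hζ : IsPrimitiveRoot ζ n) (hn : 0 < n)
    (hG : Monoid.exponent G = n) (χ : G →* Lˣ) (b : MonoidAlgebra R G) :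
    charEval R χ b ∈ (cycEmb R n ζ hζ hn).range := by
  induction b using MonoidAlgebra.induction_linear with
  | zero => simp
  | add x y hx hy => rw [map_add]; exact add_mem hx hy
  | single g r =>
    rw [charEval_single]
    refine mul_mem (Subalgebra.algebraMap_mem _ r) ?_
    have h1 : (χ g : L) ^ n = 1 := by
      rw [← Units.val_pow_eq_pow_val, ← map_pow, ← hG, Monoid.pow_exponent_eq_one, map_one,
        Units.val_one]
    have : NeZero n := ⟨hn.ne'⟩
    obtain ⟨i, _, hi⟩ := hζ.eq_pow_of_pow_eq_one h1
    refine ⟨Ideal.Quotient.mk _ (X ^ i), ?_⟩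
    change cycEmb R n ζ hζ hn _ = _
    rw [cycEmb_mk, map_pow, aeval_X, hi]

theorem cycEmb_mem_range [Fintype G] (n : ℕ) (χ : G →* Lˣ) (g : G)
    (hζ : IsPrimitiveRoot (χ g : L) n) (hn : 0 < n) (a) :
    cycEmb R n (χ g : L) hζ hn a ∈ (charEval R χ).range := by
  obtain ⟨f, rfl⟩ := Ideal.Quotient.mk_surjective a
  rw [cycEmb_mk]
  refine ⟨aeval (MonoidAlgebra.single g 1) f, ?_⟩
  change charEval R χ _ = _
  rw [← aeval_algHom_apply, charEval_single, map_one, one_mul]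

variable [Algebra ℚ L] [Algebra R ℚ] [IsScalarTower R ℚ L] [IsFractionRing R ℚ]
  [IsIntegrallyClosed R] [IsGalois ℚ L]

theorem invInt_of_isUnit (n : ℕ) (ζ : L) (hζ : IsPrimitiveRoot ζ n) (hn : 0 < n)
    {a : R[X] ⧸ Ideal.span {cyclotomic n R}} (ha : IsUnit a) :
    InvInt R (cycEmb R n ζ hζ hn a) := by
  have hu := ha.map (cycEmb R n ζ hζ hn)
  refine ⟨hu.ne_zero, ?_⟩
  obtain ⟨c, hc⟩ := ha.exists_right_inv
  have h1 : (cycEmb R n ζ hζ hn a)⁻¹ = cycEmb R n ζ hζ hn c := by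
    exact inv_eq_of_mul_eq_one_right (by rw [← map_mul, hc, map_one])
  rw [h1]
  have : Module.Finite R (R[X] ⧸ Ideal.span {cyclotomic n R}) :=
    (cyclotomic.monic n R).finite_quotient
  exact (Algebra.IsIntegral.isIntegral c).map (cycEmb R n ζ hζ hn)

/-- The group ring is (feebly) clean iff the cyclotomic ring is. -/
theorem groupRing_iff_cyc [CharZero L] [Fintype G]
    [HasEnoughRootsOfUnity L (Monoid.exponent G)]
    (hR : Function.Injective (algebraMap R ℚ)) (hRL : Function.Injective (algebraMap R L))
    (hG : IsUnit (Fintype.card G : R)) (n : ℕ) (hn : Monoid.exponent G = n) :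
    IsDomain (R[X] ⧸ Ideal.span {cyclotomic n R}) ∧
    (IsCleanRing (MonoidAlgebra R G) ↔ IsCleanRing (R[X] ⧸ Ideal.span {cyclotomic n R})) ∧
    (IsFeeblyCleanRing (MonoidAlgebra R G) ↔
      IsFeeblyCleanRing (R[X] ⧸ Ideal.span {cyclotomic n R})) := by
  have hn0 : 0 < n := hn ▸ Nat.pos_of_ne_zero Monoid.exponent_ne_zero_of_finite
  obtain ⟨χ₀, g₀, hζ⟩ := exists_char_primitive (L := L) (G := G)
  rw [hn] at hζ
  set j := cycEmb R n (χ₀ g₀ : L) hζ hn0 with hj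
  have hinj : Function.Injective j := cycEmb_injective hR n _ hζ hn0
  have hdom : IsDomain (R[X] ⧸ Ideal.span {cyclotomic n R}) := hinj.isDomain j
  let s : MonoidAlgebra R G →ₐ[R] (R[X] ⧸ Ideal.span {cyclotomic n R}) :=
    ((AlgEquiv.ofInjective j hinj).symm : _ →ₐ[R] _).comp
      ((charEval R χ₀).codRestrict j.range (charEval_mem_range n _ hζ hn0 hn χ₀))
  have hs : Function.Surjective (s.toRingHom) := by
    intro a
    obtain ⟨b, hb⟩ := cycEmb_mem_range n χ₀ g₀ hζ hn0 a
    refine ⟨b, ?_⟩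
    change (AlgEquiv.ofInjective j hinj).symm _ = a
    rw [AlgEquiv.symm_apply_eq]
    ext
    exact hb
  refine ⟨hdom, ⟨fun h => h.of_surjective _ hs, fun h => ?_⟩,
    ⟨fun h => h.of_surjective _ hs, fun h => ?_⟩⟩
  · rw [isCleanRing_iff_of_isDomain] at h
    refine isClean_monoidAlgebra (L := L) hRL hG fun b χ => ?_
    obtain ⟨a, ha⟩ := charEval_mem_range n _ hζ hn0 hn χ b
    change j a = _ at ha
    rw [← ha]
    rcases h a with h | h
    · left; exact invInt_of_isUnit n _ hζ hn0 h
    · right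
      have := invInt_of_isUnit n _ hζ hn0 h
      rwa [map_sub, map_one] at this
  · rw [isFeeblyCleanRing_iff_of_isDomain] at h
    refine isFeeblyClean_monoidAlgebra (L := L) hRL hG fun b χ => ?_
    obtain ⟨a, ha⟩ := charEval_mem_range n _ hζ hn0 hn χ b
    change j a = _ at ha
    rw [← ha]
    rcases h a with h | h | h
    · left; exact invInt_of_isUnit n _ hζ hn0 h
    · right; left
      have := invInt_of_isUnit n _ hζ hn0 h
      rwa [map_sub, map_one] at this
    · right; right
      have := invInt_of_isUnit n _ hζ hn0 h
      rwa [map_add, map_one] at this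

end Cyclo

section ModP

open Polynomial

theorem isUnit_mk_iff {R k : Type*} [CommRing R] [IsLocalRing R] [Field k] (π : R →+* k)
    (hπ : Function.Surjective π) (Φ : R[X]) (hΦ : Φ.Monic) (f : R[X]) :
    IsUnit (Ideal.Quotient.mk (Ideal.span {Φ}) f) ↔ IsCoprime (f.map π) (Φ.map π) := by
  constructor
  · intro h
    obtain ⟨c, hc⟩ := h.exists_left_inv
    obtain ⟨a, rfl⟩ := Ideal.Quotient.mk_surjective c
    rw [← map_mul, ← map_one (Ideal.Quotient.mk _), Ideal.Quotient.eq,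
      Ideal.mem_span_singleton] at hc
    obtain ⟨d, hd⟩ := hc
    refine ⟨a.map π, - d.map π, ?_⟩
    have : a * f + (-d) * Φ = 1 := by linear_combination hd
    have := congrArg (Polynomial.map π) this
    simpa using this
  · rintro ⟨a, c, h⟩
    obtain ⟨a, rfl⟩ := Polynomial.map_surjective π hπ a
    obtain ⟨c, rfl⟩ := Polynomial.map_surjective π hπ c
    have hfin : Module.Finite R (R[X] ⧸ Ideal.span {Φ}) := hΦ.finite_quotient
    by_contra hu
    obtain ⟨M, hM, hfM⟩ := exists_max_ideal_of_mem_nonunits hu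
    have hmax : (M.comap (algebraMap R (R[X] ⧸ Ideal.span {Φ}))).IsMaximal :=
      Ideal.isMaximal_comap_of_isIntegral_of_isMaximal M
    have hker : RingHom.ker π = M.comap (algebraMap R (R[X] ⧸ Ideal.span {Φ})) := by
      rw [IsLocalRing.eq_maximalIdeal hmax,
        IsLocalRing.eq_maximalIdeal (RingHom.ker_isMaximal_of_surjective π hπ)]
    have h1 : a * f + c * Φ - 1 ∈ RingHom.ker (mapRingHom π) := by
      rw [RingHom.mem_ker]
      simp only [map_sub, map_add, map_mul, map_one, coe_mapRingHom]
      rw [h, sub_self]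
    rw [ker_mapRingHom] at h1
    have h2 : (RingHom.ker π).map C ≤ M.comap (Ideal.Quotient.mk (Ideal.span {Φ})) := by
      rw [Ideal.map_le_iff_le_comap, hker]
      intro x hx
      exact hx
    have h3 := h2 h1
    rw [Ideal.mem_comap, map_sub, map_add, map_mul, map_mul,
      Ideal.Quotient.eq_zero_iff_mem.2 (Ideal.mem_span_singleton_self Φ), mul_zero, add_zero,
      map_one] at h3
    apply hM.ne_top
    rw [Ideal.eq_top_iff_one]
    have := M.sub_mem (M.mul_mem_left (Ideal.Quotient.mk _ a) hfM) h3
    simpa using this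

theorem not_isCoprime_exists {k : Type*} [Field k] {f Φ : k[X]} (hΦ : Φ ≠ 0)
    (h : ¬ IsCoprime f Φ) : ∃ P, Irreducible P ∧ P ∣ f ∧ P ∣ Φ := by
  by_contra! hP
  apply h
  apply isCoprime_of_irreducible_dvd
  · rintro ⟨_, h0⟩; exact hΦ h0
  · exact hP

theorem not_isCoprime_of_dvd {k : Type*} [Field k] {f Φ P : k[X]} (hP : Irreducible P)
    (h1 : P ∣ f) (h2 : P ∣ Φ) : ¬ IsCoprime f Φ := fun h =>
  hP.not_isUnit (h.isUnit_of_dvd' h1 h2)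

/-- Counting: two coprime factors. -/
theorem two_factors_iff {k : Type*} [Field k] {Φ : k[X]} (hΦ : Squarefree Φ) {d : ℕ}
    (hd : ∀ P, Irreducible P → P ∣ Φ → P.natDegree = d) (hpos : 0 < Φ.natDegree) :
    (∃ f : k[X], ¬ IsCoprime f Φ ∧ ¬ IsCoprime (f - 1) Φ) ↔ 2 * d ≤ Φ.natDegree := by
  have hΦ0 : Φ ≠ 0 := hΦ.ne_zero
  constructor
  · rintro ⟨f, h1, h2⟩
    obtain ⟨P, hP, hPf, hPΦ⟩ := not_isCoprime_exists hΦ0 h1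
    obtain ⟨Q, hQ, hQf, hQΦ⟩ := not_isCoprime_exists hΦ0 h2
    have hPQ : IsCoprime P Q := by
      have : IsCoprime f (f - 1) := ⟨1, -1, by ring⟩
      exact this.mono hPf hQf
    have := natDegree_le_of_dvd (hPQ.mul_dvd hPΦ hQΦ) hΦ0
    rw [natDegree_mul hP.ne_zero hQ.ne_zero, hd P hP hPΦ, hd Q hQ hQΦ] at this
    omega
  · intro h
    obtain ⟨P, hP, A, rfl⟩ := exists_irreducible_of_natDegree_pos hpos
    have hA0 : A ≠ 0 := right_ne_zero_of_mul hΦ0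
    have hdP := hd P hP (dvd_mul_right _ _)
    have hdpos : 0 < P.natDegree := hP.natDegree_pos
    rw [natDegree_mul hP.ne_zero hA0] at h
    obtain ⟨Q, hQ, B, rfl⟩ := exists_irreducible_of_natDegree_pos (f := A) (by omega)
    have hPQ : IsCoprime P Q := (IsRelPrime.isCoprime (squarefree_mul_iff.1 hΦ).1).of_mul_right_left
    obtain ⟨a, b, hab⟩ := hPQ
    refine ⟨a * P, not_isCoprime_of_dvd hP (dvd_mul_left _ _) (dvd_mul_right _ _),
      not_isCoprime_of_dvd hQ ⟨-b, by linear_combination hab⟩ ⟨P * B, by ring⟩⟩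

/-- Counting: three coprime factors. -/
theorem three_factors_iff {k : Type*} [Field k] (h20 : (2 : k) ≠ 0) {Φ : k[X]}
    (hΦ : Squarefree Φ) {d : ℕ}
    (hd : ∀ P, Irreducible P → P ∣ Φ → P.natDegree = d) (hpos : 0 < Φ.natDegree) :
    (∃ f : k[X], ¬ IsCoprime f Φ ∧ ¬ IsCoprime (f - 1) Φ ∧ ¬ IsCoprime (f + 1) Φ) ↔
      3 * d ≤ Φ.natDegree := by
  have hΦ0 : Φ ≠ 0 := hΦ.ne_zero
  constructor
  · rintro ⟨f, h1, h2, h3⟩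
    obtain ⟨P, hP, hPf, hPΦ⟩ := not_isCoprime_exists hΦ0 h1
    obtain ⟨Q, hQ, hQf, hQΦ⟩ := not_isCoprime_exists hΦ0 h2
    obtain ⟨S, hS, hSf, hSΦ⟩ := not_isCoprime_exists hΦ0 h3
    have hPQ : IsCoprime P Q := by
      have : IsCoprime f (f - 1) := ⟨1, -1, by ring⟩
      exact this.mono hPf hQf
    have hPS : IsCoprime P S := by
      have : IsCoprime f (f + 1) := ⟨-1, 1, by ring⟩
      exact this.mono hPf hSf
    have hQS : IsCoprime Q S := by
      have : IsCoprime (f - 1) (f + 1) := ⟨-C (2⁻¹), C (2⁻¹), by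
        have : C (2⁻¹ : k) * 2 = 1 := by
          rw [← C_ofNat, ← C_mul, inv_mul_cancel₀ h20, C_1]
        linear_combination this⟩
      exact this.mono hQf hSf
    have := natDegree_le_of_dvd
      ((hPS.mul_left hQS).mul_dvd (hPQ.mul_dvd hPΦ hQΦ) hSΦ) hΦ0
    rw [natDegree_mul (mul_ne_zero hP.ne_zero hQ.ne_zero) hS.ne_zero,
      natDegree_mul hP.ne_zero hQ.ne_zero, hd P hP hPΦ, hd Q hQ hQΦ, hd S hS hSΦ] at this
    omega
  · intro h
    obtain ⟨P, hP, A, rfl⟩ := exists_irreducible_of_natDegree_pos hpos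
    have hA0 : A ≠ 0 := right_ne_zero_of_mul hΦ0
    have hdP := hd P hP (dvd_mul_right _ _)
    have hdpos : 0 < P.natDegree := hP.natDegree_pos
    rw [natDegree_mul hP.ne_zero hA0] at h
    obtain ⟨Q, hQ, B, rfl⟩ := exists_irreducible_of_natDegree_pos (f := A) (by omega)
    have hB0 : B ≠ 0 := right_ne_zero_of_mul hA0
    have hdQ := hd Q hQ ⟨P * B, by ring⟩
    rw [natDegree_mul hQ.ne_zero hB0] at h
    obtain ⟨S, hS, D, rfl⟩ := exists_irreducible_of_natDegree_pos (f := B) (by omega)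
    have hPQS : IsCoprime P (Q * (S * D)) := IsRelPrime.isCoprime (squarefree_mul_iff.1 hΦ).1
    have hQSD : IsCoprime Q (S * D) :=
      IsRelPrime.isCoprime (squarefree_mul_iff.1 hΦ.of_mul_right).1
    have hPQ : IsCoprime P Q := hPQS.of_mul_right_left
    have hPS : IsCoprime P S := hPQS.of_mul_right_right.of_mul_right_left
    have hQS : IsCoprime Q S := hQSD.of_mul_right_left
    obtain ⟨a, b, hab⟩ := hPQS.of_mul_right_right.of_mul_right_left.mul_left hQS
    obtain ⟨c, e, hce⟩ := hPQ.mul_left hQS.symm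
    -- `a * (P * Q)` is `0, 0, 1` and `c * (P * S)` is `0, 1, 0` modulo `P, Q, S`.
    refine ⟨c * (P * S) - a * (P * Q),
      not_isCoprime_of_dvd hP ⟨c * S - a * Q, by ring⟩ (dvd_mul_right _ _),
      not_isCoprime_of_dvd hQ ⟨-e - a * P, by linear_combination hce⟩ ⟨P * (S * D), by ring⟩,
      not_isCoprime_of_dvd hS ⟨c * P + b, by linear_combination -hab⟩ ⟨P * (Q * D), by ring⟩⟩

theorem cyc_clean_iff {R : Type*} [CommRing R] [IsLocalRing R] (p : ℕ) [hp : Fact p.Prime]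
    (hp2 : p ≠ 2) (π : R →+* ZMod p) (n : ℕ) (hn : 0 < n) (hpn : ¬ p ∣ n)
    [IsDomain (R[X] ⧸ Ideal.span {cyclotomic n R})] :
    (IsFeeblyCleanRing (R[X] ⧸ Ideal.span {cyclotomic n R}) ∧
      ¬ IsCleanRing (R[X] ⧸ Ideal.span {cyclotomic n R})) ↔
    Nat.totient n = 2 * orderOf (p : ZMod n) := by
  have hπ : Function.Surjective π := ZMod.ringHom_surjective π
  have hcop : p.Coprime n := (Nat.Prime.coprime_iff_not_dvd hp.out).2 hpn
  have h20 : (2 : ZMod p) ≠ 0 := by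
    intro h
    have h' : ((2 : ℕ) : ZMod p) = 0 := by exact_mod_cast h
    rw [ZMod.natCast_eq_zero_iff] at h'
    exact hp2 ((Nat.prime_dvd_prime_iff_eq hp.out Nat.prime_two).1 h')
  have : NeZero (n : ZMod p) := ⟨by rwa [Ne, ZMod.natCast_eq_zero_iff]⟩
  have hsq : Squarefree (cyclotomic n (ZMod p)) := (separable_cyclotomic n (ZMod p)).squarefree
  have hdeg : (cyclotomic n (ZMod p)).natDegree = n.totient := natDegree_cyclotomic n _
  have hpos : 0 < (cyclotomic n (ZMod p)).natDegree := by
    rw [hdeg]; exact Nat.totient_pos.2 hn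
  set d := orderOf (p : ZMod n) with hdef
  have hord : orderOf (ZMod.unitOfCoprime _ (hcop.pow_left 1)) = d := by
    rw [← orderOf_units, ZMod.coe_unitOfCoprime, pow_one]
  have hd : ∀ P, Irreducible P → P ∣ cyclotomic n (ZMod p) → P.natDegree = d := by
    intro P hP hPd
    rw [natDegree_of_dvd_cyclotomic_of_irreducible (f := 1) (by simp) hcop hPd hP, hord]
  have hdvd : d ∣ n.totient := by
    have : NeZero n := ⟨hn.ne'⟩
    rw [← hord, ← ZMod.card_units_eq_totient]
    exact orderOf_dvd_card
  have hdpos : 0 < d := Nat.pos_of_dvd_of_pos hdvd (Nat.totient_pos.2 hn)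
  have hunit : ∀ f : R[X], IsUnit (Ideal.Quotient.mk (Ideal.span {cyclotomic n R}) f) ↔
      IsCoprime (f.map π) (cyclotomic n (ZMod p)) := fun f => by
    rw [isUnit_mk_iff π hπ _ (cyclotomic.monic n R), map_cyclotomic]
  have hC : ¬ IsCleanRing (R[X] ⧸ Ideal.span {cyclotomic n R}) ↔ 2 * d ≤ n.totient := by
    rw [isCleanRing_iff_of_isDomain, ← hdeg, ← two_factors_iff hsq hd hpos]
    push Not
    rw [Ideal.Quotient.mk_surjective.exists, (Polynomial.map_surjective π hπ).exists]
    refine exists_congr fun f => ?_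
    rw [← map_one (Ideal.Quotient.mk _), ← map_sub, hunit, hunit, Polynomial.map_sub,
      Polynomial.map_one]
  have hF : ¬ IsFeeblyCleanRing (R[X] ⧸ Ideal.span {cyclotomic n R}) ↔ 3 * d ≤ n.totient := by
    rw [isFeeblyCleanRing_iff_of_isDomain, ← hdeg, ← three_factors_iff h20 hsq hd hpos]
    push Not
    rw [Ideal.Quotient.mk_surjective.exists, (Polynomial.map_surjective π hπ).exists]
    refine exists_congr fun f => ?_
    rw [← map_one (Ideal.Quotient.mk _), ← map_sub, ← map_add, hunit, hunit, hunit,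
      Polynomial.map_sub, Polynomial.map_add, Polynomial.map_one]
  rw [hC, ← not_not (a := IsFeeblyCleanRing _), hF]
  obtain ⟨m, hm⟩ := hdvd
  rw [hm]
  constructor
  · rintro ⟨h1, h2⟩
    have h3 : m < 3 := by
      by_contra! h
      exact h1 (by nlinarith)
    have h4 : 2 ≤ m := by
      by_contra! h
      nlinarith
    have : m = 2 := by omega
    rw [this, mul_comm]
  · intro h
    omega

end ModP

theorem isGalois_algClosure (K : Type*) [Field K] [CharZero K] :
    IsGalois K (AlgebraicClosure K) :=
  { to_isSeparable := IsSepClosure.isSeparable, to_normal := IsGalois.to_normal }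

/-- For an odd prime `p` and a finite abelian group `G` of exponent `n` with `p ∤ n`, the
following are equivalent: (i) `ℤ_(p)[G]` is feebly clean but not clean; (ii)
`ℤ_(p)[x]/(Φ_n(x))` is feebly clean but not clean; (iii) `φ(n) = 2·ord_n(p)`. -/
theorem feeblyClean_not_clean_localization_monoidAlgebra_iff
    (p : ℕ) (hp : p.Prime) (hp2 : p ≠ 2)
    [hP : (Ideal.span {(p : ℤ)}).IsPrime]
    (G : Type*) [CommGroup G] [Fintype G]
    (n : ℕ) (hn : Monoid.exponent G = n) (hpn : ¬ p ∣ n) :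
    ((IsFeeblyCleanRing (MonoidAlgebra (Localization.AtPrime (Ideal.span {(p : ℤ)})) G) ∧
        ¬ IsCleanRing (MonoidAlgebra (Localization.AtPrime (Ideal.span {(p : ℤ)})) G)) ↔
      (IsFeeblyCleanRing (Polynomial (Localization.AtPrime (Ideal.span {(p : ℤ)})) ⧸
          Ideal.span
            {Polynomial.cyclotomic n (Localization.AtPrime (Ideal.span {(p : ℤ)}))}) ∧
        ¬ IsCleanRing (Polynomial (Localization.AtPrime (Ideal.span {(p : ℤ)})) ⧸
          Ideal.span
            {Polynomial.cyclotomic n (Localization.AtPrime (Ideal.span {(p : ℤ)}))}))) ∧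
    ((IsFeeblyCleanRing (MonoidAlgebra (Localization.AtPrime (Ideal.span {(p : ℤ)})) G) ∧
        ¬ IsCleanRing (MonoidAlgebra (Localization.AtPrime (Ideal.span {(p : ℤ)})) G)) ↔
      Nat.totient n = 2 * orderOf ((p : ZMod n))) := by
  have hpfact : Fact p.Prime := ⟨hp⟩
  subst hn
  set n := Monoid.exponent G with hn
  have hn0 : 0 < n := Nat.pos_of_ne_zero Monoid.exponent_ne_zero_of_finite
  set P : Ideal ℤ := Ideal.span {(p : ℤ)} with hPdef
  have hmem : ∀ y : P.primeCompl, ¬ (p : ℤ) ∣ y := fun y hy =>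
    y.2 (Ideal.mem_span_singleton.2 hy)
  let π : Localization.AtPrime P →+* ZMod p :=
    IsLocalization.lift (M := P.primeCompl) (g := Int.castRingHom (ZMod p)) (fun y => by
      rw [isUnit_iff_ne_zero, eq_intCast, Ne, ZMod.intCast_zmod_eq_zero_iff_dvd]
      exact hmem y)
  let ι : Localization.AtPrime P →+* ℚ :=
    IsLocalization.lift (M := P.primeCompl) (g := Int.castRingHom ℚ) (fun y => by
      rw [isUnit_iff_ne_zero, eq_intCast, Ne, Int.cast_eq_zero]
      intro h
      exact hmem y (h ▸ dvd_zero _))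
  let _ : Algebra (Localization.AtPrime P) ℚ := ι.toAlgebra
  have htower := IsScalarTower.of_algebraMap_eq (R := ℤ) (S := Localization.AtPrime P) (A := ℚ)
    fun x => by
      change _ = ι _
      rw [IsLocalization.lift_eq]
      rfl
  have : IsFractionRing (Localization.AtPrime P) ℚ :=
    IsFractionRing.isFractionRing_of_isDomain_of_isLocalization P.primeCompl _ _
  have : IsGalois ℚ (AlgebraicClosure ℚ) := isGalois_algClosure ℚ
  have hR : Function.Injective (algebraMap (Localization.AtPrime P) ℚ) :=
    IsFractionRing.injective _ _
  have hRL : Function.Injective (algebraMap (Localization.AtPrime P) (AlgebraicClosure ℚ)) :=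
    (algebraMap ℚ (AlgebraicClosure ℚ)).injective.comp hR
  have hG : IsUnit (Fintype.card G : Localization.AtPrime P) := by
    have h1 : ¬ p ∣ Fintype.card G := fun h => by
      obtain ⟨g, hg⟩ := exists_prime_orderOf_dvd_card p h
      exact hpn (hg ▸ Monoid.order_dvd_exponent g)
    have h2 : (Fintype.card G : ℤ) ∈ P.primeCompl := fun h =>
      h1 (Int.natCast_dvd_natCast.1 (Ideal.mem_span_singleton.1 h))
    have := IsLocalization.map_units (Localization.AtPrime P) (⟨_, h2⟩ : P.primeCompl)
    simpa using this
  have : NeZero (Monoid.exponent G) := ⟨hn0.ne'⟩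
  obtain ⟨hdom, hC, hF⟩ := groupRing_iff_cyc (L := AlgebraicClosure ℚ) (G := G) hR hRL hG n rfl
  have key := cyc_clean_iff p hp2 π n hn0 hpn
  rw [hC, hF]
  exact ⟨Iff.rfl, key⟩
end

section
/- Let p and q be distinct primes with p > 2. Then ℤ_(p)[C_q] is clean if and only if ord_q(p) = q − 1. Moreover, the following are equivalent: (i) ℤ_(p)[C_q] is weakly clean but not clean; (ii) ℤ_(p)[C_q] is feebly clean but not clean; (iii) ord_q(p) = (q−1)/2. -/
/-- A ring is *weakly clean* if every element is a sum or a difference of a unit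
and an idempotent. -/
def IsWeaklyCleanRing (R : Type*) [Ring R] : Prop :=
  ∀ r : R, ∃ u e : R, IsUnit u ∧ IsIdempotentElem e ∧ (r = u + e ∨ r = u - e)

open Polynomial UniqueFactorizationMonoid in
/-- Pigeonhole: fewer primes than constants gives a constant avoiding all primes. -/
lemma exists_const_avoid {F : Type} [Field F] (T : Finset F[X]) (hT : ∀ π ∈ T, Prime π)
    (E : Finset F) (hTE : T.card < E.card) (f : F[X]) :
    ∃ c ∈ E, ∀ π ∈ T, ¬ π ∣ f - C c := by
  classical
  by_contra! H
  choose! g hg hgd using H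
  obtain ⟨a, ha, b, hb, hab, h⟩ := Finset.exists_ne_map_eq_of_card_lt_of_maps_to hTE (f := g)
    (fun c hc => hg c hc)
  have h1 := hgd a ha
  have h2 := hgd b hb
  rw [← h] at h2
  have h3 : g a ∣ C (a - b) := by
    have := dvd_sub h2 h1
    simpa using this
  exact (hT _ (hg a ha)).not_isUnit
    (isUnit_of_dvd_unit h3 ((isUnit_C).2 (sub_ne_zero.2 hab).isUnit))

open Polynomial in
/-- Chinese remainder: enough pairwise coprime polynomials realize all residues. -/
lemma exists_poly_hit {F : Type} [Field F] (T : Finset F[X])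
    (hT : ∀ π ∈ T, ∀ π' ∈ T, π ≠ π' → IsCoprime π π')
    (E : Finset F) (hTE : E.card ≤ T.card) :
    ∃ f : F[X], ∀ c ∈ E, ∃ π ∈ T, π ∣ f - C c := by
  classical
  obtain ⟨g⟩ : Nonempty (E ↪ T) := by
    rw [Function.Embedding.nonempty_iff_card_le]; simpa using hTE
  have hc : Pairwise (fun i j : E => IsCoprime (Ideal.span {((g i : T) : F[X])})
      (Ideal.span {((g j : T) : F[X])})) := by
    intro i j hij
    rw [Ideal.isCoprime_span_singleton_iff]
    exact hT _ (g i).2 _ (g j).2 (fun h => hij (g.injective (Subtype.ext h)))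
  obtain ⟨f, hf⟩ := Ideal.exists_forall_sub_mem_ideal hc (fun i => C (i : F))
  exact ⟨f, fun c hcE => ⟨g ⟨c, hcE⟩, (g ⟨c, hcE⟩).2,
    Ideal.mem_span_singleton.1 (hf ⟨c, hcE⟩)⟩⟩

lemma ker_eq_maximalIdeal {R F : Type} [CommRing R] [IsLocalRing R] [Field F] (ρ : R →+* F)
    (hρ : Function.Surjective ρ) : RingHom.ker ρ = IsLocalRing.maximalIdeal R :=
  IsLocalRing.eq_maximalIdeal (RingHom.ker_isMaximal_of_surjective ρ hρ)

/-- Units of an integral algebra over a local ring are detected on residue fields. -/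
lemma isUnit_of_residue {R F A : Type} [CommRing R] [IsLocalRing R] [Field F] (ρ : R →+* F)
    (hρ : Function.Surjective ρ) [CommRing A] [Algebra R A] [Algebra.IsIntegral R A] (x : A)
    (h : ∀ (K : Type) [Field K] [Algebra F K] (ψ : A →+* K),
      (∀ a : R, ψ (algebraMap R A a) = algebraMap F K (ρ a)) → ψ x ≠ 0) : IsUnit x := by
  by_contra hx
  obtain ⟨M, hM, hxM⟩ := exists_max_ideal_of_mem_nonunits hx
  have hc := Ideal.isMaximal_comap_of_isIntegral_of_isMaximal (R := R) M
  have hk : RingHom.ker ρ = M.comap (algebraMap R A) := by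
    rw [ker_eq_maximalIdeal ρ hρ, IsLocalRing.eq_maximalIdeal hc]
  let : Field (A ⧸ M) := Ideal.Quotient.field M
  let g : R →+* A ⧸ M := (Ideal.Quotient.mk M).comp (algebraMap R A)
  have hg : RingHom.ker ρ ≤ RingHom.ker g := by
    intro a ha
    rw [hk] at ha
    rw [RingHom.mem_ker]
    exact Ideal.Quotient.eq_zero_iff_mem.2 ha
  let l : F →+* A ⧸ M := ρ.liftOfSurjective hρ ⟨g, hg⟩
  let : Algebra F (A ⧸ M) := l.toAlgebra
  refine h (A ⧸ M) (Ideal.Quotient.mk M) (fun a => ?_) (Ideal.Quotient.eq_zero_iff_mem.2 hxM)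
  change g a = l (ρ a)
  exact (RingHom.liftOfSurjective_comp_apply ρ hρ ⟨g, hg⟩ a).symm

/-- the generator of the group algebra -/
noncomputable def tgen (R : Type) [CommRing R] (q : ℕ) : MonoidAlgebra R (Multiplicative (ZMod q)) :=
  MonoidAlgebra.of R (Multiplicative (ZMod q)) (Multiplicative.ofAdd 1)

lemma of_eq_tgen_pow (R : Type) [CommRing R] (q : ℕ) [NeZero q] (g : Multiplicative (ZMod q)) :
    MonoidAlgebra.of R (Multiplicative (ZMod q)) g = tgen R q ^ (Multiplicative.toAdd g).val := by
  rw [tgen, ← map_pow]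
  congr 1
  rw [← ofAdd_nsmul]
  simp

lemma tgen_pow (R : Type) [CommRing R] (q : ℕ) : tgen R q ^ q = 1 := by
  rw [tgen, ← map_pow, ← ofAdd_nsmul]
  simp [MonoidAlgebra.one_def]

open Polynomial in
lemma exists_aeval_tgen (R : Type) [CommRing R] (q : ℕ) [NeZero q]
    (r : MonoidAlgebra R (Multiplicative (ZMod q))) : ∃ f : R[X], aeval (tgen R q) f = r := by
  induction r using MonoidAlgebra.induction_on with
  | of g => exact ⟨X ^ (Multiplicative.toAdd g).val, by rw [of_eq_tgen_pow]; simp⟩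
  | add a b ha hb =>
    obtain ⟨f, rfl⟩ := ha
    obtain ⟨g, rfl⟩ := hb
    exact ⟨f + g, by simp⟩
  | smul c a ha =>
    obtain ⟨f, rfl⟩ := ha
    exact ⟨c • f, by simp⟩

open Polynomial UniqueFactorizationMonoid in
lemma exists_idem_isUnit_sub {R F : Type} [CommRing R] [IsLocalRing R] [Field F] [DecidableEq F] (ρ : R →+* F)
    (hρ : Function.Surjective ρ) (q : ℕ) [hq : Fact q.Prime] (hqF : (q : F) ≠ 0)
    (f : R[X]) (s c : R) (hs : s = 1 ∨ s = -1) (hc : c = 0 ∨ c = 1)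
    (h : ∀ π ∈ normalizedFactors (cyclotomic q F), ¬ π ∣ f.map ρ - C (ρ (s * c))) :
    ∃ e : MonoidAlgebra R (Multiplicative (ZMod q)), IsIdempotentElem e ∧
      IsUnit (aeval (tgen R q) f - algebraMap R _ s * e) := by
  classical
  have : NeZero q := ⟨hq.out.ne_zero⟩
  set A := MonoidAlgebra R (Multiplicative (ZMod q)) with hA
  have hqu : IsUnit (q : R) := by
    by_contra hn
    have : (q : R) ∈ IsLocalRing.maximalIdeal R := hn
    rw [← ker_eq_maximalIdeal ρ hρ, RingHom.mem_ker, map_natCast] at this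
    exact hqF this
  obtain ⟨w, hw⟩ := hqu.exists_right_inv
  set t : A := tgen R q with ht
  have htq : t ^ q = 1 := tgen_pow R q
  set N : A := ∑ i ∈ Finset.range q, t ^ i with hN
  have hN1 : N * (t - 1) = 0 := by rw [hN, geom_sum_mul, htq, sub_self]
  have hNt : ∀ i : ℕ, t ^ i * N = N := by
    intro i
    induction i with
    | zero => simp
    | succ i ih =>
      rw [pow_succ, mul_assoc, show t * N = N by linear_combination hN1, ih]
  have hNN : N * N = (q : A) * N := by
    conv_lhs => lhs; rw [hN]
    rw [Finset.sum_mul, Finset.sum_congr rfl (fun i _ => hNt i)]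
    simp
  have hwA : (q : A) * algebraMap R A w = 1 := by
    rw [← map_natCast (algebraMap R A) q, ← map_mul, hw, map_one]
  set e0 : A := algebraMap R A w * N with he0
  have he0i : e0 * e0 = e0 := by
    rw [he0]
    linear_combination (algebraMap R A w)^2 * hNN + (algebraMap R A w * N) * hwA
  have hs2 : ρ s ≠ 0 := by
    rcases hs with rfl | rfl <;> simp
  obtain ⟨c0, hc0, hc0'⟩ : ∃ c0 : R, (c0 = 0 ∨ c0 = 1) ∧ ρ (f.eval 1) ≠ ρ (s * c0) := by
    by_cases h0 : ρ (f.eval 1) = 0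
    · exact ⟨1, Or.inr rfl, by rw [h0, mul_one]; exact hs2.symm⟩
    · exact ⟨0, Or.inl rfl, by simpa using h0⟩
  refine ⟨algebraMap R A c0 * e0 + algebraMap R A c * (1 - e0), ?_, ?_⟩
  · have h1 : algebraMap R A c0 * algebraMap R A c0 = algebraMap R A c0 := by
      rcases hc0 with rfl | rfl <;> simp
    have h2 : algebraMap R A c * algebraMap R A c = algebraMap R A c := by
      rcases hc with rfl | rfl <;> simp
    generalize algebraMap R A c0 = x at *
    generalize algebraMap R A c = y at *
    clear_value e0
    unfold IsIdempotentElem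
    linear_combination e0 * h1 + (1 - e0) * h2 + (x * x + y * y - 2 * x * y) * he0i
  · have : Algebra.IsIntegral R A := by
      have : Module.Finite R A := inferInstance
      infer_instance
    refine isUnit_of_residue ρ hρ _ (fun K _ _ ψ hψ => ?_)
    have hfe : ψ (aeval t f) = aeval (ψ t) (f.map ρ) := by
      rw [aeval_def, hom_eval₂, aeval_def, eval₂_map]
      congr 1
      ext a
      exact hψ a
    have hNe : ψ N = ∑ i ∈ Finset.range q, (ψ t) ^ i := by
      rw [hN]; simp
    by_cases h1 : ψ t = 1
    · have : ψ e0 = 1 := by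
        rw [he0, map_mul, hNe, h1]
        have := congrArg ψ hwA
        simp only [map_mul, map_one, map_natCast] at this
        simp only [one_pow, Finset.sum_const, Finset.card_range, nsmul_eq_mul, mul_one]
        rw [mul_comm]; exact this
      intro h0
      rw [map_sub, hfe, map_mul, map_add, map_mul ψ (algebraMap R A c0) e0,
        map_mul ψ (algebraMap R A c) (1 - e0), map_sub, this, h1, hψ s, hψ c0] at h0
      apply hc0'
      apply (algebraMap F K).injective
      have h3 : aeval (1 : K) (f.map ρ) = algebraMap F K (ρ (f.eval 1)) := by
        rw [← map_one (algebraMap F K), aeval_algebraMap_apply, coe_aeval_eq_eval,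
          ← map_one ρ, eval_map_apply]
      rw [h3] at h0
      rw [map_mul ρ, map_mul]
      simp only [map_one] at h0
      linear_combination h0
    · have hN0 : ψ N = 0 := by
        have := congrArg ψ hN1
        rw [map_mul, map_zero, map_sub, map_one] at this
        exact (mul_eq_zero.1 this).resolve_right (sub_ne_zero.2 h1)
      have he00 : ψ e0 = 0 := by rw [he0, map_mul, hN0, mul_zero]
      have hroot : aeval (ψ t) (cyclotomic q F) = 0 := by
        rw [cyclotomic_prime]
        rw [hNe] at hN0
        simpa using hN0
      intro h0
      rw [map_sub, hfe, map_mul, map_add, map_mul ψ (algebraMap R A c0) e0,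
        map_mul ψ (algebraMap R A c) (1 - e0), map_sub, he00, hψ s, hψ c] at h0
      have hint : IsIntegral F (ψ t) := ⟨cyclotomic q F, cyclotomic.monic q F, hroot⟩
      obtain ⟨π, hπ, hass⟩ := exists_mem_normalizedFactors_of_dvd (cyclotomic_ne_zero q F)
        (minpoly.irreducible hint) (minpoly.dvd F _ hroot)
      refine h π hπ (hass.symm.dvd.trans (minpoly.dvd F _ ?_))
      rw [map_sub, aeval_C, map_mul ρ, map_mul]
      simp only [map_one] at h0
      linear_combination h0

open Polynomial UniqueFactorizationMonoid in
lemma clean_of_card {R F : Type} [CommRing R] [IsLocalRing R] [Field F] [DecidableEq F]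
    (ρ : R →+* F) (hρ : Function.Surjective ρ) (q : ℕ) [hq : Fact q.Prime] (hqF : (q : F) ≠ 0)
    (hcard : (normalizedFactors (cyclotomic q F)).toFinset.card < 2) :
    IsCleanRing (MonoidAlgebra R (Multiplicative (ZMod q))) := by
  intro r
  have : NeZero q := ⟨hq.out.ne_zero⟩
  obtain ⟨f, rfl⟩ := exists_aeval_tgen R q r
  obtain ⟨c, hc, h⟩ := exists_const_avoid (normalizedFactors (cyclotomic q F)).toFinset
    (fun π hπ => prime_of_normalized_factor π (Multiset.mem_toFinset.1 hπ)) {0, 1}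
    (by rwa [Finset.card_pair zero_ne_one]) (f.map ρ)
  simp only [Multiset.mem_toFinset] at h
  have : ∃ c' : R, (c' = 0 ∨ c' = 1) ∧ c = ρ (1 * c') := by
    simp only [Finset.mem_insert, Finset.mem_singleton] at hc
    rcases hc with rfl | rfl
    · exact ⟨0, by simp⟩
    · exact ⟨1, by simp⟩
  obtain ⟨c', hc', rfl⟩ := this
  obtain ⟨e, he, hu⟩ := exists_idem_isUnit_sub ρ hρ q hqF f 1 c' (Or.inl rfl) hc' h
  exact ⟨_, e, hu, he, by rw [map_one, one_mul, sub_add_cancel]⟩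

open Polynomial UniqueFactorizationMonoid in
lemma weaklyClean_of_card {R F : Type} [CommRing R] [IsLocalRing R] [Field F] [DecidableEq F]
    (ρ : R →+* F) (hρ : Function.Surjective ρ) (q : ℕ) [hq : Fact q.Prime] (hqF : (q : F) ≠ 0)
    (hE : ({0, 1, -1} : Finset F).card = 3)
    (hcard : (normalizedFactors (cyclotomic q F)).toFinset.card < 3) :
    IsWeaklyCleanRing (MonoidAlgebra R (Multiplicative (ZMod q))) := by
  intro r
  have : NeZero q := ⟨hq.out.ne_zero⟩
  obtain ⟨f, rfl⟩ := exists_aeval_tgen R q r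
  obtain ⟨c, hc, h⟩ := exists_const_avoid (normalizedFactors (cyclotomic q F)).toFinset
    (fun π hπ => prime_of_normalized_factor π (Multiset.mem_toFinset.1 hπ)) {0, 1, -1}
    (by rwa [hE]) (f.map ρ)
  simp only [Multiset.mem_toFinset] at h
  have : ∃ s c' : R, (s = 1 ∨ s = -1) ∧ (c' = 0 ∨ c' = 1) ∧ c = ρ (s * c') := by
    simp only [Finset.mem_insert, Finset.mem_singleton] at hc
    rcases hc with rfl | rfl | rfl
    · exact ⟨1, 0, by simp⟩
    · exact ⟨1, 1, by simp⟩
    · exact ⟨-1, 1, by simp⟩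
  obtain ⟨s, c', hs, hc', rfl⟩ := this
  obtain ⟨e, he, hu⟩ := exists_idem_isUnit_sub ρ hρ q hqF f s c' hs hc' h
  refine ⟨_, e, hu, he, ?_⟩
  rcases hs with rfl | rfl
  · left; rw [map_one, one_mul, sub_add_cancel]
  · right; rw [map_neg, map_one]; ring

open Polynomial in
lemma exists_surj_adjoinRoot (R : Type) [CommRing R] (q : ℕ) [hq : Fact q.Prime] :
    ∃ η : MonoidAlgebra R (Multiplicative (ZMod q)) →+* AdjoinRoot (cyclotomic q R),
      Function.Surjective η := by
  have : NeZero q := ⟨hq.out.ne_zero⟩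
  set D := AdjoinRoot (cyclotomic q R)
  set z : D := AdjoinRoot.root (cyclotomic q R) with hz
  have hzq : z ^ q = 1 := by
    have h1 : ∑ i ∈ Finset.range q, z ^ i = 0 := by
      have h2 : (cyclotomic q R).eval₂ (AdjoinRoot.of (cyclotomic q R)) z = 0 :=
        AdjoinRoot.eval₂_root (cyclotomic q R)
      have h3 : (∑ i ∈ Finset.range q, (X : R[X]) ^ i).eval₂
          (AdjoinRoot.of (cyclotomic q R)) z = 0 := by
        rw [← cyclotomic_prime R q]; exact h2
      simpa [eval₂_finsetSum] using h3
    have := geom_sum_mul z q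
    rw [h1, zero_mul] at this
    exact (sub_eq_zero.1 this.symm)
  let u : Dˣ := Units.ofPowEqOne z q hzq hq.out.ne_zero
  have hu : u ^ q = 1 := by
    ext
    simp [u]
  let m : Multiplicative (ZMod q) →* Dˣ :=
    AddMonoidHom.toMultiplicativeLeft (ZMod.lift q ⟨zmultiplesHom (Additive Dˣ) (Additive.ofMul u), by
      simp only [zmultiplesHom_apply, natCast_zsmul]
      rw [← ofMul_pow, hu, ofMul_one]⟩)
  have hm : m (Multiplicative.ofAdd 1) = u := by
    have := ZMod.lift_coe q (⟨zmultiplesHom (Additive Dˣ) (Additive.ofMul u), by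
      simp only [zmultiplesHom_apply, natCast_zsmul]
      rw [← ofMul_pow, hu, ofMul_one]⟩ : {f : ℤ →+ Additive Dˣ // f q = 0}) 1
    simp only [Int.cast_one] at this
    change Additive.toMul _ = u
    erw [this]
    simp only [zmultiplesHom_apply, one_zsmul]
    rfl
  let η : MonoidAlgebra R (Multiplicative (ZMod q)) →ₐ[R] D :=
    MonoidAlgebra.lift R D _ ((Units.coeHom D).comp m)
  have hη : η (tgen R q) = z := by
    simp only [η, tgen, MonoidAlgebra.lift_of, MonoidHom.comp_apply, hm]
    rfl
  refine ⟨η, fun d => ?_⟩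
  obtain ⟨f, rfl⟩ := AdjoinRoot.mk_surjective d
  refine ⟨aeval (tgen R q) f, ?_⟩
  change η _ = _
  rw [← aeval_algHom_apply, hη, hz, AdjoinRoot.aeval_eq]

open Polynomial UniqueFactorizationMonoid in
lemma exists_nonunits {R F : Type} [CommRing R] [Field F] [DecidableEq F]
    (ρ : R →+* F) (hρ : Function.Surjective ρ) (q : ℕ) 
    (E : Finset F) (hcard : E.card ≤ (normalizedFactors (cyclotomic q F)).toFinset.card) :
    ∃ d : AdjoinRoot (cyclotomic q R), ∀ c : R, ρ c ∈ E → ¬ IsUnit (d - algebraMap R _ c) := by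
  obtain ⟨f', hf'⟩ := exists_poly_hit (normalizedFactors (cyclotomic q F)).toFinset (by
    intro π hπ π' hπ' hne
    rw [Multiset.mem_toFinset] at hπ hπ'
    refine ((irreducible_of_normalized_factor π hπ).coprime_iff_not_dvd).2 (fun hd => hne ?_)
    exact mem_normalizedFactors_eq_of_associated hπ hπ'
      ((irreducible_of_normalized_factor π hπ).associated_of_dvd
        (irreducible_of_normalized_factor π' hπ') hd)) E hcard
  obtain ⟨f, rfl⟩ := map_surjective ρ hρ f'
  refine ⟨AdjoinRoot.mk _ f, fun c hc hunit => ?_⟩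
  obtain ⟨π, hπ, hd⟩ := hf' _ hc
  rw [Multiset.mem_toFinset] at hπ
  have hlift : (cyclotomic q R).eval₂ ((AdjoinRoot.of π).comp ρ) (AdjoinRoot.root π) = 0 := by
    rw [← eval₂_map, map_cyclotomic]
    obtain ⟨g, hg⟩ := dvd_of_mem_normalizedFactors hπ
    rw [hg, eval₂_mul, AdjoinRoot.eval₂_root, zero_mul]
  let l := AdjoinRoot.lift ((AdjoinRoot.of π).comp ρ) (AdjoinRoot.root π) hlift
  have h0 : l (AdjoinRoot.mk _ f - algebraMap R _ c) = 0 := by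
    have : AdjoinRoot.mk (cyclotomic q R) f - algebraMap R _ c
      = AdjoinRoot.mk (cyclotomic q R) (f - C c) := by
      rw [map_sub]; rfl
    rw [this]
    simp only [l]
    rw [AdjoinRoot.lift_mk, ← eval₂_map, Polynomial.map_sub, map_C]
    obtain ⟨g, hg⟩ := hd
    rw [hg, eval₂_mul, AdjoinRoot.eval₂_root, zero_mul]
  have hu := hunit.map l
  rw [h0] at hu
  have := (AdjoinRoot.mk_eq_zero (f := π) (g := 1)).1 (by
    rw [map_one]; exact (isUnit_zero_iff.1 hu).symm)
  exact (prime_of_normalized_factor π hπ).not_isUnit (isUnit_of_dvd_one this)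

open Polynomial UniqueFactorizationMonoid in
lemma not_clean_of_card {R F : Type} [CommRing R] [IsDomain R] [Field F] [DecidableEq F]
    (ρ : R →+* F) (hρ : Function.Surjective ρ) (q : ℕ) [hq : Fact q.Prime]
    (hprime : Prime (cyclotomic q R))
    (hcard : 2 ≤ (normalizedFactors (cyclotomic q F)).toFinset.card) :
    ¬ IsCleanRing (MonoidAlgebra R (Multiplicative (ZMod q))) := by
  intro H
  have : IsDomain (AdjoinRoot (cyclotomic q R)) := AdjoinRoot.isDomain_of_prime hprime
  obtain ⟨η, hη⟩ := exists_surj_adjoinRoot R q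
  obtain ⟨d, hd⟩ := exists_nonunits ρ hρ q {0, 1} (by rwa [Finset.card_pair zero_ne_one])
  obtain ⟨a, rfl⟩ := hη d
  obtain ⟨u, e, hu, he, rfl⟩ := H a
  have hu' := hu.map η
  rcases (IsIdempotentElem.iff_eq_zero_or_one).1 (he.map η) with h | h
  · exact hd 0 (by simp) (by simpa [h] using hu')
  · exact hd 1 (by simp) (by simpa [h] using hu')

open Polynomial UniqueFactorizationMonoid in
lemma not_feeblyClean_of_card {R F : Type} [CommRing R] [IsDomain R] [Field F] [DecidableEq F]
    (ρ : R →+* F) (hρ : Function.Surjective ρ) (q : ℕ) [hq : Fact q.Prime]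
    (hprime : Prime (cyclotomic q R))
    (hE : ({0, 1, -1} : Finset F).card = 3)
    (hcard : 3 ≤ (normalizedFactors (cyclotomic q F)).toFinset.card) :
    ¬ IsFeeblyCleanRing (MonoidAlgebra R (Multiplicative (ZMod q))) := by
  intro H
  have : IsDomain (AdjoinRoot (cyclotomic q R)) := AdjoinRoot.isDomain_of_prime hprime
  obtain ⟨η, hη⟩ := exists_surj_adjoinRoot R q
  obtain ⟨d, hd⟩ := exists_nonunits ρ hρ q {0, 1, -1} (by rwa [hE])
  obtain ⟨a, rfl⟩ := hη d
  obtain ⟨u, e₁, e₂, hu, he₁, he₂, h12, rfl⟩ := H a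
  have hu' := hu.map η
  rcases (IsIdempotentElem.iff_eq_zero_or_one).1 (he₁.map η) with h | h <;>
  rcases (IsIdempotentElem.iff_eq_zero_or_one).1 (he₂.map η) with h' | h'
  · exact hd 0 (by simp) (by simpa [h, h'] using hu')
  · exact hd (-1) (by simp) (by simpa [h, h'] using hu')
  · exact hd 1 (by simp) (by simpa [h, h'] using hu')
  · exact hd 0 (by simp) (by simpa [h, h'] using hu')

lemma IsWeaklyCleanRing.feebly {R : Type} [Ring R] (h : IsWeaklyCleanRing R) :
    IsFeeblyCleanRing R := by
  intro r
  obtain ⟨u, e, hu, he, h | h⟩ := h r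
  · exact ⟨u, e, 0, hu, he, IsIdempotentElem.zero, by simp, by simp [h]⟩
  · exact ⟨u, 0, e, hu, IsIdempotentElem.zero, he, by simp, by simp [h]⟩

lemma exists_localization_hom (p : ℕ) [hp : Fact p.Prime] [hP : (Ideal.span {(p : ℤ)}).IsPrime] :
    ∃ ρ : Localization.AtPrime (Ideal.span {(p : ℤ)}) →+* ZMod p, Function.Surjective ρ := by
  have h : ∀ y : (Ideal.span {(p : ℤ)}).primeCompl, IsUnit (Int.castRingHom (ZMod p) y) := by
    intro y
    refine IsUnit.mk0 _ (fun h0 => y.2 ?_)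
    rw [eq_intCast, ZMod.intCast_zmod_eq_zero_iff_dvd] at h0
    exact Ideal.mem_span_singleton.2 h0
  refine ⟨IsLocalization.lift h, fun x => ?_⟩
  obtain ⟨n, rfl⟩ := ZMod.intCast_surjective x
  exact ⟨algebraMap ℤ _ n, by simp⟩

open Polynomial in
lemma prime_cyclotomic_localization (p q : ℕ) [hp : Fact p.Prime] [hq : Fact q.Prime]
    [hP : (Ideal.span {(p : ℤ)}).IsPrime] :
    Prime (cyclotomic q (Localization.AtPrime (Ideal.span {(p : ℤ)}))) := by
  have hM : (Ideal.span {(p : ℤ)}).primeCompl ≤ nonZeroDivisors ℤ :=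
    Ideal.primeCompl_le_nonZeroDivisors _
  have h : ∀ y : (Ideal.span {(p : ℤ)}).primeCompl, IsUnit (Int.castRingHom ℚ y) := by
    intro y
    refine IsUnit.mk0 _ (fun h0 => nonZeroDivisors.ne_zero (hM y.2) ?_)
    simpa using h0
  let : Algebra (Localization.AtPrime (Ideal.span {(p : ℤ)})) ℚ :=
    (IsLocalization.lift h).toAlgebra
  have tower :=
    IsScalarTower.of_algebraMap_eq (R := ℤ) (S := Localization.AtPrime (Ideal.span {(p : ℤ)}))
      (A := ℚ) (fun x => by
      exact (IsLocalization.lift_eq h x).symm)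
  have : IsFractionRing (Localization.AtPrime (Ideal.span {(p : ℤ)})) ℚ :=
    IsFractionRing.isFractionRing_of_isDomain_of_isLocalization
      (Ideal.span {(p : ℤ)}).primeCompl _ _
  refine Irreducible.prime ?_
  rw [(cyclotomic.monic q _).irreducible_iff_irreducible_map_fraction_map (K := ℚ), map_cyclotomic]
  exact cyclotomic.irreducible_rat hq.out.pos

/-- For distinct primes `p, q` with `p > 2`: `ℤ_(p)[C_q]` is clean iff `ord_q(p) = q - 1`;
moreover `ℤ_(p)[C_q]` is weakly clean but not clean iff it is feebly clean but not clean
iff `ord_q(p) = (q-1)/2`. -/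
theorem clean_weaklyClean_feeblyClean_localization_cyclic_iff
    (p q : ℕ) (hp : p.Prime) (hq : q.Prime) (hpq : p ≠ q) (hp2 : 2 < p)
    [hP : (Ideal.span {(p : ℤ)}).IsPrime] :
    (IsCleanRing (MonoidAlgebra (Localization.AtPrime (Ideal.span {(p : ℤ)}))
        (Multiplicative (ZMod q))) ↔ orderOf ((p : ZMod q)) = q - 1) ∧
    ((IsWeaklyCleanRing (MonoidAlgebra (Localization.AtPrime (Ideal.span {(p : ℤ)}))
          (Multiplicative (ZMod q))) ∧
        ¬ IsCleanRing (MonoidAlgebra (Localization.AtPrime (Ideal.span {(p : ℤ)}))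
          (Multiplicative (ZMod q)))) ↔
      (IsFeeblyCleanRing (MonoidAlgebra (Localization.AtPrime (Ideal.span {(p : ℤ)}))
          (Multiplicative (ZMod q))) ∧
        ¬ IsCleanRing (MonoidAlgebra (Localization.AtPrime (Ideal.span {(p : ℤ)}))
          (Multiplicative (ZMod q))))) ∧
    ((IsWeaklyCleanRing (MonoidAlgebra (Localization.AtPrime (Ideal.span {(p : ℤ)}))
          (Multiplicative (ZMod q))) ∧
        ¬ IsCleanRing (MonoidAlgebra (Localization.AtPrime (Ideal.span {(p : ℤ)}))
          (Multiplicative (ZMod q)))) ↔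
      orderOf ((p : ZMod q)) = (q - 1) / 2) := by
  classical
  have hpF : Fact p.Prime := ⟨hp⟩
  have hqF : Fact q.Prime := ⟨hq⟩
  have hcop : p.Coprime q := (Nat.coprime_primes hp hq).2 hpq
  obtain ⟨ρ, hρ⟩ := exists_localization_hom p
  have hprime := prime_cyclotomic_localization p q
  have hq0 : (q : ZMod p) ≠ 0 := by
    rw [Ne, ZMod.natCast_eq_zero_iff]
    exact fun h => hpq ((Nat.prime_dvd_prime_iff_eq hp hq).1 h)
  have hE : ({0, 1, -1} : Finset (ZMod p)).card = 3 := by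
    have : Fact (2 < p) := ⟨hp2⟩
    have h1 : (1 : ZMod p) ≠ -1 := (ZMod.neg_one_ne_one).symm
    rw [Finset.card_eq_three]
    exact ⟨0, 1, -1, zero_ne_one, by simp, h1, rfl⟩
  have hcard := Polynomial.normalizedFactors_cyclotomic_card (K := ZMod p) (p := p) (f := 1)
    (n := q) (by simp) hcop
  have hord : orderOf (ZMod.unitOfCoprime _ (hcop.pow_left 1)) = orderOf (p : ZMod q) := by
    rw [← orderOf_units, ZMod.coe_unitOfCoprime, pow_one]
  have hdvd : orderOf (p : ZMod q) ∣ q - 1 := by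
    rw [← hord, ← ZMod.card_units q]
    exact orderOf_dvd_card
  rw [hord, Nat.totient_prime hq] at hcard
  have hc1 := clean_of_card ρ hρ q hq0
  have hc2 := weaklyClean_of_card ρ hρ q hq0 hE
  have hc3 := not_clean_of_card ρ hρ q hprime
  have hc4 := not_feeblyClean_of_card ρ hρ q hprime hE
  have hwf := IsWeaklyCleanRing.feebly
    (R := MonoidAlgebra (Localization.AtPrime (Ideal.span {(p : ℤ)})) (Multiplicative (ZMod q)))
  rw [hcard] at hc1 hc2 hc3 hc4
  clear hcard hord
  obtain ⟨g, hg⟩ := hdvd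
  have hq1 : 0 < q - 1 := by have := hq.two_le; omega
  generalize orderOf (p : ZMod q) = n at *
  have hn : 0 < n := Nat.pos_of_ne_zero (by rintro rfl; omega)
  have hg0 : 0 < g := Nat.pos_of_ne_zero (by rintro rfl; omega)
  rw [hg, Nat.mul_div_cancel_left _ hn] at hc1 hc2 hc3 hc4
  rw [hg]
  have e1 : n = n * g ↔ g = 1 := by
    constructor
    · intro h; exact Nat.eq_of_mul_eq_mul_left hn (by omega)
    · rintro rfl; simp
  have e2 : n = n * g / 2 ↔ g = 2 := by
    constructor
    · intro h
      have : g < 3 := by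
        by_contra! h3
        have := Nat.mul_le_mul_left n h3
        rcases hq.eq_two_or_odd with h2 | h2 <;> omega
      interval_cases g <;> omega
    · rintro rfl; simp
  rw [e1, e2]
  have k1 : g < 2 ↔ g = 1 := by omega
  rcases lt_trichotomy g 2 with h | h | h
  · have := hc1 h
    simp only [this]
    simp
    omega
  · subst h
    have a := hc2 (by norm_num)
    have b := hc3 le_rfl
    have c := hwf a
    simp only [a, b, c]
    simp
  · have a := hc4 h
    have b := hc3 h.le
    have c := mt hwf a
    simp only [a, b, c]
    simp
    omega
end

section
/- Let p be an odd prime and q an odd prime distinct from p with ord_{q²}(p) = q(q−1)/2, and let G be a finite abelian group with exp(G) = q^r for some r ≥ 1. Then: (i) ℤ_(p)[G] is feebly clean but not clean; and (ii) ℤ_(p)[G] is weakly clean if and only if G is cyclic and r = 1. -/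
namespace FeeblyAux

open MonoidAlgebra

set_option linter.unusedSectionVars false

section Idem

variable {A : Type*} [CommRing A] (k : Type*) [Field k] {G : Type*} [CommGroup G] [Fintype G]

/-- The character of `G` attached to a ring homomorphism out of the group ring. -/
noncomputable def chr {k : Type*} [Field k] (φ : MonoidAlgebra A G →+* k) : G →* k :=
  (φ : MonoidAlgebra A G →* k).comp (MonoidAlgebra.of A G)

theorem chr_apply {k : Type*} [Field k] (φ : MonoidAlgebra A G →+* k) (g : G) :
    chr φ g = φ (MonoidAlgebra.of A G g) := rfl

open Classical in
theorem exists_hat (K : Subgroup G) (hc : ∃ c : A, c * (Nat.card K : A) = 1) :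
    ∃ h : MonoidAlgebra A G, IsIdempotentElem h ∧
      ∀ φ : MonoidAlgebra A G →+* k, φ h = if K ≤ (chr φ).ker then 1 else 0 := by
  obtain ⟨c, hc⟩ := hc
  set S : MonoidAlgebra A G := ∑ g : K, MonoidAlgebra.of A G (g : G) with hS
  set C : MonoidAlgebra A G := algebraMap A _ c with hC
  have hcard : C * (Nat.card K : MonoidAlgebra A G) = 1 := by
    rw [hC, ← map_natCast (algebraMap A (MonoidAlgebra A G)), ← map_mul, hc, map_one]
  have hmul : ∀ g : K, MonoidAlgebra.of A G (g : G) * S = S := by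
    intro g
    rw [hS, Finset.mul_sum]
    simp_rw [← map_mul]
    exact Fintype.sum_equiv (Equiv.mulLeft g) _ _ (fun x => by simp)
  have hSS : S * S = (Nat.card K : MonoidAlgebra A G) * S := by
    conv_lhs => rw [hS, Finset.sum_mul]
    rw [← hS, Finset.sum_congr rfl (fun g _ => hmul g), Finset.sum_const, nsmul_eq_mul,
      Finset.card_univ, Nat.card_eq_fintype_card]
  refine ⟨C * S, ?_, ?_⟩
  · show C * S * (C * S) = C * S
    calc C * S * (C * S) = C * C * (S * S) := by ring
      _ = (C * (Nat.card K : MonoidAlgebra A G)) * (C * S) := by rw [hSS]; ring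
      _ = C * S := by rw [hcard, one_mul]
  · intro φ
    have h1 : φ S = ∑ g : K, ((chr φ).comp K.subtype) g := by
      rw [hS, map_sum]; rfl
    rw [map_mul, h1, sum_hom_units]
    have hiff : (chr φ).comp K.subtype = 1 ↔ K ≤ (chr φ).ker := by
      constructor
      · intro h g hg
        exact DFunLike.congr_fun h ⟨g, hg⟩
      · intro h
        ext g
        exact h g.2
    by_cases h : K ≤ (chr φ).ker
    · rw [if_pos h, if_pos (hiff.2 h)]
      have := congrArg φ hcard
      rw [map_mul, map_natCast, map_one, Nat.card_eq_fintype_card] at this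
      exact this
    · rw [if_neg h, if_neg (fun h' => h (hiff.1 h'))]
      simp

open Classical in
theorem exists_idem (hc : ∀ K : Subgroup G, ∃ c : A, c * (Nat.card K : A) = 1) :
    ∃ E : Set (Subgroup G) → MonoidAlgebra A G,
      (∀ S, IsIdempotentElem (E S)) ∧ (∀ S T, Disjoint S T → E S * E T = 0) ∧
      ∀ S (φ : MonoidAlgebra A G →+* k), φ (E S) = if (chr φ).ker ∈ S then 1 else 0 := by
  choose h hi hφ using fun K => exists_hat (A := A) k K (hc K)
  have : Fintype (Subgroup G) := Fintype.ofFinite _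
  set f : Subgroup G → Subgroup G → MonoidAlgebra A G :=
    fun H K => if K ≤ H then h K else 1 - h K with hf
  set e : Subgroup G → MonoidAlgebra A G := fun H => ∏ K, f H K with he
  have hfi : ∀ H K, f H K * f H K = f H K := by
    intro H K
    simp only [hf]
    split_ifs
    · exact hi K
    · exact (hi K).one_sub
  have hei : ∀ H, e H * e H = e H := by
    intro H
    simp only [he, ← Finset.prod_mul_distrib, hfi]
  have hmain : ∀ H H' K, K ≤ H → ¬ K ≤ H' → e H * e H' = 0 := by
    intro H H' K h1 h2
    simp only [he, ← Finset.prod_mul_distrib]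
    apply Finset.prod_eq_zero (Finset.mem_univ K)
    simp only [hf, if_pos h1, if_neg h2]
    exact (hi K).mul_one_sub_self
  have hort : ∀ H H', H ≠ H' → e H * e H' = 0 := by
    intro H H' hne
    by_cases h1 : H ≤ H'
    · have h2 : ¬ H' ≤ H := fun h2 => hne (le_antisymm h1 h2)
      rw [mul_comm]
      exact hmain H' H H' le_rfl h2
    · exact hmain H H' H le_rfl h1
  have hpe : ∀ H (φ : MonoidAlgebra A G →+* k), φ (e H) = if (chr φ).ker = H then 1 else 0 := by
    intro H φ
    simp only [he, map_prod]
    split_ifs with hH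
    · apply Finset.prod_eq_one
      intro K _
      simp only [hf]
      split_ifs with hK
      · rw [hφ, if_pos (hH ▸ hK)]
      · rw [map_sub, map_one, hφ, if_neg (hH ▸ hK), sub_zero]
    · have : ∃ K, ¬ (K ≤ H ↔ K ≤ (chr φ).ker) := by
        by_contra! hcon
        exact hH (le_antisymm ((hcon _).2 le_rfl) ((hcon _).1 le_rfl))
      obtain ⟨K, hK⟩ := this
      apply Finset.prod_eq_zero (Finset.mem_univ K)
      simp only [hf]
      split_ifs with h1
      · rw [hφ, if_neg (by tauto)]
      · rw [map_sub, map_one, hφ, if_pos (by tauto), sub_self]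
  refine ⟨fun S => ∑ H, if H ∈ S then e H else 0, ?_, ?_, ?_⟩
  · intro S
    show (∑ H, if H ∈ S then e H else 0) * (∑ H, if H ∈ S then e H else 0) = _
    rw [Finset.sum_mul_sum]
    apply Finset.sum_congr rfl
    intro H _
    rw [Finset.sum_eq_single H]
    · split_ifs
      · exact hei H
      · simp
    · intro H' _ hne
      split_ifs <;> simp [hort H H' hne.symm]
    · simp
  · intro S T hST
    rw [Finset.sum_mul_sum]
    apply Finset.sum_eq_zero
    intro H _
    apply Finset.sum_eq_zero
    intro H' _
    split_ifs with h1 h2 <;> try simp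
    exact hort H H' (fun h => Set.disjoint_left.1 hST h1 (h ▸ h2))
  · intro S φ
    rw [map_sum]
    rw [Finset.sum_eq_single (chr φ).ker]
    · split_ifs
      · rw [hpe, if_pos rfl]
      · simp
    · intro H _ hne
      split_ifs
      · rw [hpe, if_neg hne.symm]
      · simp
    · simp

end Idem

section Unit

variable {A : Type*} [CommRing A] {k : Type*} [Field k] [IsAlgClosed k]

theorem isUnit_of_forall {R : Type*} [CommRing R] [Algebra A R] [Algebra.IsIntegral A R]
    (f : A →+* k) (hf : ∀ a, ¬ IsUnit a → f a = 0) (u : R) (hu : ∀ φ : R →+* k, φ u ≠ 0) :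
    IsUnit u := by
  by_contra hun
  obtain ⟨M, hM, huM⟩ := exists_max_ideal_of_mem_nonunits hun
  have hmax : (M.comap (algebraMap A R)).IsMaximal :=
    Ideal.isMaximal_comap_of_isIntegral_of_isMaximal M
  set P := M.comap (algebraMap A R) with hP
  let _ : Field (A ⧸ P) := Ideal.Quotient.field P
  let _ : Field (R ⧸ M) := Ideal.Quotient.field M
  have hker : ∀ a ∈ P, f a = 0 := fun a ha => hf a (fun hua => hmax.ne_top (P.eq_top_of_isUnit_mem ha hua))
  let _ : Algebra (A ⧸ P) k := (Ideal.Quotient.lift P f hker).toAlgebra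
  let _ : Algebra (A ⧸ P) (R ⧸ M) := Ideal.Quotient.algebraQuotientOfLEComap (le_of_eq hP)
  have : Algebra.IsIntegral (A ⧸ P) (R ⧸ M) := by
    constructor
    intro x
    obtain ⟨y, rfl⟩ := Ideal.Quotient.mk_surjective x
    obtain ⟨g, hg, hgy⟩ := Algebra.IsIntegral.isIntegral (R := A) y
    refine ⟨g.map (Ideal.Quotient.mk P), hg.map _, ?_⟩
    rw [Polynomial.eval₂_map]
    have : (algebraMap (A ⧸ P) (R ⧸ M)).comp (Ideal.Quotient.mk P) =
        (Ideal.Quotient.mk M).comp (algebraMap A R) := by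
      ext a; rfl
    rw [this, ← Polynomial.hom_eval₂, hgy, map_zero]
  have : Algebra.IsAlgebraic (A ⧸ P) (R ⧸ M) := Algebra.IsIntegral.isAlgebraic
  let ψ : (R ⧸ M) →ₐ[A ⧸ P] k := IsAlgClosed.lift
  apply hu ((ψ : (R ⧸ M) →+* k).comp (Ideal.Quotient.mk M))
  have : Ideal.Quotient.mk M u = 0 := Ideal.Quotient.eq_zero_iff_mem.2 huM
  simp [this]

end Unit

section NT

theorem legendre_one (p q : ℕ) [Fact q.Prime] (hq2 : q ≠ 2)
    (hord : orderOf ((p : ZMod (q ^ 2))) = q * (q - 1) / 2) :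
    quadraticChar (ZMod q) (p : ZMod q) = 1 := by
  have hq : q.Prime := Fact.out
  have hodd : q % 2 = 1 := hq.eq_two_or_odd.resolve_left hq2
  have h1 : ((p : ZMod (q ^ 2))) ^ (q * (q - 1) / 2) = 1 := by
    rw [← hord]; exact pow_orderOf_eq_one _
  have h2 := congrArg (ZMod.castHom (dvd_pow_self q two_ne_zero) (ZMod q)) h1
  rw [map_pow, map_natCast, map_one] at h2
  have h3 : q * (q - 1) / 2 = q / 2 * q := by
    obtain ⟨m, hm⟩ : ∃ m, q = 2 * m + 1 := ⟨q / 2, by omega⟩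
    have : q / 2 = m := by omega
    rw [this, hm, Nat.add_sub_cancel, show (2 * m + 1) * (2 * m) = 2 * (m * (2 * m + 1)) by ring]
    omega
  rw [h3, pow_mul, ZMod.pow_card] at h2
  have hr : ringChar (ZMod q) ≠ 2 := by rwa [ZMod.ringChar_zmod_n]
  have h0 : (p : ZMod q) ≠ 0 := by
    intro h; rw [h, zero_pow (by have := hq.two_le; omega : q / 2 ≠ 0)] at h2; exact zero_ne_one h2
  rw [quadraticChar_eq_pow_of_char_ne_two hr h0, ZMod.card, if_pos h2]

theorem units_trichotomy (p q : ℕ) (hq : q.Prime) (hq2 : q ≠ 2)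
    (hpq : p.Coprime q)
    (hord : orderOf ((p : ZMod (q ^ 2))) = q * (q - 1) / 2) (j : ℕ)
    (P : (ZMod (q ^ j))ˣ) (hP : (P : ZMod (q ^ j)) = p) (a b : (ZMod (q ^ j))ˣ) :
    a ∈ Subgroup.zpowers P ∨ b ∈ Subgroup.zpowers P ∨ a * b⁻¹ ∈ Subgroup.zpowers P := by
  have hodd : q % 2 = 1 := hq.eq_two_or_odd.resolve_left hq2
  have : NeZero q := ⟨hq.ne_zero⟩
  have hcyc : IsCyclic (ZMod (q ^ (j + 2)))ˣ := ZMod.isCyclic_units_of_prime_pow q hq hq2 _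
  obtain ⟨γ, hγ⟩ := hcyc.exists_generator
  set f := ZMod.unitsMap (pow_dvd_pow q (Nat.le_add_right j 2)) with hf
  have hfs : Function.Surjective f := ZMod.unitsMap_surjective _
  set f2 := ZMod.unitsMap (pow_dvd_pow q (Nat.le_add_left 2 j)) with hf2
  have hf2s : Function.Surjective f2 := ZMod.unitsMap_surjective _
  have hcop : p.Coprime (q ^ (j + 2)) := hpq.pow_right _
  set Q := ZMod.unitOfCoprime p hcop with hQ
  have hfQ : f Q = P := by
    ext
    rw [hP, hf, ZMod.unitsMap_val, hQ, ZMod.coe_unitOfCoprime, ZMod.cast_natCast (pow_dvd_pow q (Nat.le_add_right j 2))]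
  have hf2Q : ((f2 Q : (ZMod (q ^ 2))ˣ) : ZMod (q ^ 2)) = p := by
    rw [hf2, ZMod.unitsMap_val, hQ, ZMod.coe_unitOfCoprime, ZMod.cast_natCast (pow_dvd_pow q (Nat.le_add_left 2 j))]
  obtain ⟨b0, hb0⟩ : ∃ n : ℕ, γ ^ n = Q := by
    have := hγ Q
    rwa [← mem_powers_iff_mem_zpowers] at this
  have hoγ : orderOf γ = q ^ (j + 1) * (q - 1) := by
    rw [orderOf_eq_card_of_forall_mem_zpowers hγ, Nat.card_eq_fintype_card,
      ZMod.card_units_eq_totient, Nat.totient_prime_pow hq (by omega)]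
    rfl
  have hγ2 : ∀ x, x ∈ Subgroup.zpowers (f2 γ) := by
    intro x
    obtain ⟨y, rfl⟩ := hf2s x
    obtain ⟨i, hi⟩ := hγ y
    exact ⟨i, by simp only at hi ⊢; rw [← hi, map_zpow]⟩
  have hoγ2 : orderOf (f2 γ) = q * (q - 1) := by
    rw [orderOf_eq_card_of_forall_mem_zpowers hγ2, Nat.card_eq_fintype_card,
      ZMod.card_units_eq_totient, Nat.totient_prime_pow hq (by omega)]
    simp
  have ho : orderOf (f2 Q) = q * (q - 1) / 2 := by
    rw [← hord, ← hf2Q, orderOf_units]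
  rw [← hb0, map_pow, orderOf_pow, hoγ2] at ho
  have hg : Nat.gcd (q * (q - 1)) b0 = 2 := by
    obtain ⟨m, hm⟩ : ∃ m, q = 2 * m + 1 := ⟨q / 2, by omega⟩
    have hm0 : 0 < m := by have := hq.two_le; omega
    have e : q * (q - 1) = 2 * (m * q) := by rw [hm, Nat.add_sub_cancel]; ring
    rw [e] at ho ⊢
    rw [Nat.mul_div_cancel_left _ two_pos] at ho
    have hd : Nat.gcd (2 * (m * q)) b0 ∣ 2 * (m * q) := Nat.gcd_dvd_left _ _
    have := Nat.div_mul_cancel hd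
    rw [ho] at this
    exact Nat.eq_of_mul_eq_mul_left (Nat.mul_pos hm0 hq.pos) (this.trans (mul_comm _ _))
  have hqb : ¬ q ∣ b0 := by
    intro h
    have : q ∣ 2 := hg ▸ Nat.dvd_gcd (dvd_mul_right _ _) h
    exact hq2 ((Nat.prime_dvd_prime_iff_eq hq Nat.prime_two).1 this)
  have hg2 : Nat.gcd (orderOf γ) b0 ∣ 2 := by
    rw [hoγ, Nat.Coprime.gcd_mul_left_cancel _ (Nat.Coprime.pow_left _ ((Nat.Prime.coprime_iff_not_dvd hq).2 hqb)), ← hg]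
    exact Nat.gcd_dvd_gcd_of_dvd_left _ (dvd_mul_left _ _)
  have hsq : γ ^ 2 ∈ Subgroup.zpowers Q := by
    obtain ⟨c, hc⟩ := hg2
    have hc' : γ ^ 2 = (γ ^ Nat.gcd (orderOf γ) b0) ^ c := by rw [← pow_mul, ← hc]
    rw [hc']
    apply Subgroup.pow_mem
    refine ⟨Nat.gcdB (orderOf γ) b0, ?_⟩
    simp only
    rw [← zpow_natCast γ (Nat.gcd _ _), Nat.gcd_eq_gcd_ab, zpow_add, zpow_mul, zpow_mul, ← hb0]
    simp [pow_orderOf_eq_one]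
  have heven : ∀ i : ℤ, Even i → (f γ) ^ i ∈ Subgroup.zpowers P := by
    rintro i ⟨t, rfl⟩
    obtain ⟨s, hs⟩ := hsq
    simp only at hs
    rw [← two_mul, zpow_mul]
    apply Subgroup.zpow_mem
    refine ⟨s, ?_⟩
    simp only
    rw [← hfQ, ← map_zpow, hs, map_pow]
    norm_cast
  have hrep : ∀ x, ∃ i : ℤ, x = (f γ) ^ i := by
    intro x
    obtain ⟨y, rfl⟩ := hfs x
    obtain ⟨i, hi⟩ := hγ y
    exact ⟨i, by simp only at hi; rw [← hi, map_zpow]⟩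
  obtain ⟨i, rfl⟩ := hrep a
  obtain ⟨i', rfl⟩ := hrep b
  rcases Int.even_or_odd i with h | h
  · exact Or.inl (heven _ h)
  rcases Int.even_or_odd i' with h' | h'
  · exact Or.inr (Or.inl (heven _ h'))
  · refine Or.inr (Or.inr ?_)
    rw [← zpow_neg, ← zpow_add]
    apply heven
    rw [← sub_eq_add_neg]
    exact h.sub_odd h'

theorem frob_trichotomy {k : Type*} [Field k] {G : Type*} [CommGroup G] [Fintype G]
    (p q r : ℕ) (hq : q.Prime) (hq2 : q ≠ 2) (hpq : p.Coprime q)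
    (hord : orderOf ((p : ZMod (q ^ 2))) = q * (q - 1) / 2)
    (hexp : ∀ g : G, g ^ (q ^ r) = 1) (χ₀ χ₁ χ₂ : G →* k)
    (h1 : χ₁.ker = χ₀.ker) (h2 : χ₂.ker = χ₀.ker) :
    (∃ s : ℕ, ∀ g, χ₁ g = χ₀ g ^ (p ^ s)) ∨ (∃ s : ℕ, ∀ g, χ₂ g = χ₀ g ^ (p ^ s)) ∨
      (∃ s : ℕ, ∀ g, χ₁ g = χ₂ g ^ (p ^ s)) := by
  obtain ⟨g₀, hg₀⟩ : ∃ g₀ : G, ∀ g, ∃ i : ℕ, χ₀ g = χ₀ (g₀ ^ i) := by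
    have hfin : Finite χ₀.toHomUnits.range :=
      Finite.of_surjective χ₀.toHomUnits.rangeRestrict χ₀.toHomUnits.rangeRestrict_surjective
    have hc : IsCyclic χ₀.toHomUnits.range := inferInstance
    obtain ⟨⟨_, g₀, rfl⟩, hx⟩ := hc.exists_generator
    refine ⟨g₀, fun g => ?_⟩
    have := hx ⟨_, g, rfl⟩
    rw [← mem_powers_iff_mem_zpowers] at this
    obtain ⟨i, hi⟩ := this
    refine ⟨i, ?_⟩
    have := congrArg (fun z : χ₀.toHomUnits.range => ((z : kˣ) : k)) hi
    simp at this
    rw [map_pow, this]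
  -- compare on the kernel
  have hker : ∀ χ : G →* k, χ.ker = χ₀.ker → ∀ g h, χ₀ g = χ₀ h → χ g = χ h := by
    intro χ hχ g h hgh
    have hmem : g * h⁻¹ ∈ χ₀.ker := by
      rw [MonoidHom.mem_ker, map_mul, hgh, ← map_mul, mul_inv_cancel, map_one]
    rw [← hχ, MonoidHom.mem_ker] at hmem
    calc χ g = χ (g * h⁻¹) * χ h := by rw [← map_mul, inv_mul_cancel_right]
      _ = χ h := by rw [hmem, one_mul]
  have hgen : ∀ χ χ' : G →* k, χ.ker = χ₀.ker → χ'.ker = χ₀.ker →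
      ∀ n : ℕ, χ g₀ = χ' g₀ ^ n → ∀ g, χ g = χ' g ^ n := by
    intro χ χ' hχ hχ' n hn g
    obtain ⟨i, hi⟩ := hg₀ g
    rw [hker χ hχ _ _ hi, hker χ' hχ' _ _ hi, map_pow, map_pow, hn, ← pow_mul, ← pow_mul, mul_comm]
  obtain ⟨j, -, hj⟩ := (Nat.dvd_prime_pow hq).1 (orderOf_dvd_of_pow_eq_one
    (show χ₀ g₀ ^ (q ^ r) = 1 by rw [← map_pow, hexp, map_one]))
  have hprim : IsPrimitiveRoot (χ₀ g₀) (q ^ j) := hj ▸ IsPrimitiveRoot.orderOf _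
  have hn0 : NeZero (q ^ j) := ⟨pow_ne_zero _ hq.ne_zero⟩
  have hone : ∀ χ : G →* k, χ.ker = χ₀.ker → IsPrimitiveRoot (χ g₀) (q ^ j) := by
    intro χ hχ
    have : ∀ n, χ g₀ ^ n = 1 ↔ χ₀ g₀ ^ n = 1 := by
      intro n
      rw [← map_pow, ← map_pow, ← MonoidHom.mem_ker, ← MonoidHom.mem_ker, hχ]
    exact ⟨(this _).2 hprim.pow_eq_one, fun l hl => hprim.dvd_of_pow_eq_one l ((this l).1 hl)⟩
  have hpw : ∀ χ : G →* k, χ.ker = χ₀.ker → ∃ u : (ZMod (q ^ j))ˣ,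
      χ g₀ = χ₀ g₀ ^ (u : ZMod (q ^ j)).val := by
    intro χ hχ
    obtain ⟨i, hi, hco, he⟩ := (hprim.isPrimitiveRoot_iff).1 (hone χ hχ)
    refine ⟨ZMod.unitOfCoprime i hco, ?_⟩
    rw [ZMod.coe_unitOfCoprime, ZMod.val_natCast, Nat.mod_eq_of_lt hi, he]
  have hpc : p.Coprime (q ^ j) := hpq.pow_right _
  set P := ZMod.unitOfCoprime p hpc with hP
  have hPs : ∀ u, u ∈ Subgroup.zpowers P → ∃ s : ℕ, u = P ^ s := by
    intro u hu
    rw [← mem_powers_iff_mem_zpowers] at hu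
    obtain ⟨s, hs⟩ := hu
    exact ⟨s, hs.symm⟩
  have hval : ∀ (χ : G →* k), χ.ker = χ₀.ker → ∀ n m : ℕ, (n : ZMod (q ^ j)) = m →
      χ g₀ ^ n = χ g₀ ^ m := by
    intro χ hχ n m hnm
    rw [ZMod.natCast_eq_natCast_iff] at hnm
    exact pow_eq_pow_of_modEq hnm (hone χ hχ).pow_eq_one
  obtain ⟨a, ha⟩ := hpw χ₁ h1
  obtain ⟨b, hb⟩ := hpw χ₂ h2
  rcases units_trichotomy p q hq hq2 hpq hord j P (ZMod.coe_unitOfCoprime _ _) a b with h | h | h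
  · obtain ⟨s, hs⟩ := hPs _ h
    refine Or.inl ⟨s, hgen _ _ h1 rfl _ ?_⟩
    rw [ha]
    apply hval _ rfl
    simp [hs, hP]
  · obtain ⟨s, hs⟩ := hPs _ h
    refine Or.inr (Or.inl ⟨s, hgen _ _ h2 rfl _ ?_⟩)
    rw [hb]
    apply hval _ rfl
    simp [hs, hP]
  · obtain ⟨s, hs⟩ := hPs _ h
    refine Or.inr (Or.inr ⟨s, hgen _ _ h1 h2 _ ?_⟩)
    rw [hb, ha, ← pow_mul]
    apply hval _ rfl
    rw [mul_inv_eq_iff_eq_mul] at hs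
    simp [hs, hP, mul_comm]

end NT

section Pair

open Polynomial in
theorem idem_agree {A : Type*} [CommRing A] {k : Type*} [Field k] {G : Type*} [CommGroup G]
    (N : ℕ) [NeZero N] (hN : ∀ g : G, g ^ N = 1) (hsub : ∀ f g : A →+* k, f = g)
    (hprime : Prime (cyclotomic N A)) (ω : k) (hω : IsPrimitiveRoot ω N) (a : ℕ)
    (ha : a.Coprime N) (φ φ' : MonoidAlgebra A G →+* k)
    (h : ∀ g, φ' (MonoidAlgebra.of A G g) = φ (MonoidAlgebra.of A G g) ^ a)
    (e : MonoidAlgebra A G) (he : IsIdempotentElem e) : φ e = φ' e := by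
  let f : A →+* k := φ.comp (algebraMap A _)
  have hdom : IsDomain (AdjoinRoot (cyclotomic N A)) := AdjoinRoot.isDomain_of_prime hprime
  have hev : ∀ x : k, IsPrimitiveRoot x N → (cyclotomic N A).eval₂ f x = 0 := by
    intro x hx
    rw [← eval_map, map_cyclotomic]
    exact hx.isRoot_cyclotomic (NeZero.pos N)
  let ι₁ : AdjoinRoot (cyclotomic N A) →+* k := AdjoinRoot.lift f ω (hev ω hω)
  let ι₂ : AdjoinRoot (cyclotomic N A) →+* k :=
    AdjoinRoot.lift f (ω ^ a) (hev _ (hω.pow_of_coprime a ha))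
  set ζ := AdjoinRoot.root (cyclotomic N A) with hζ
  have hζ1 : ζ ^ N = 1 := by
    have h1 : cyclotomic N A ∣ X ^ N - 1 := cyclotomic.dvd_X_pow_sub_one N A
    have h2 : AdjoinRoot.mk (cyclotomic N A) (X ^ N - 1) = 0 := AdjoinRoot.mk_eq_zero.2 h1
    rw [map_sub, map_pow, AdjoinRoot.mk_X, map_one] at h2
    exact sub_eq_zero.1 h2
  have hex : ∀ g : G, ∃ i : ℕ, ω ^ i = φ (MonoidAlgebra.of A G g) := by
    intro g
    obtain ⟨i, -, hi⟩ := hω.eq_pow_of_pow_eq_one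
      (show φ (MonoidAlgebra.of A G g) ^ N = 1 by rw [← map_pow, ← map_pow, hN, map_one, map_one])
    exact ⟨i, hi⟩
  choose i hi using hex
  have hmod : ∀ m n : ℕ, ω ^ m = ω ^ n → ζ ^ m = ζ ^ n := by
    intro m n hmn
    apply pow_eq_pow_of_modEq _ hζ1
    have hu : IsUnit ω := hω.isUnit (NeZero.ne N)
    obtain ⟨w, rfl⟩ := hu
    have h3 : w ^ m = w ^ n := by ext; simpa using hmn
    rw [pow_eq_pow_iff_modEq, ← orderOf_units, ← hω.eq_orderOf] at h3
    exact h3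
  let ψ : G →* AdjoinRoot (cyclotomic N A) :=
    { toFun := fun g => ζ ^ i g
      map_one' := by
        rw [← pow_zero ζ]
        apply hmod
        rw [hi, map_one, map_one, pow_zero]
      map_mul' := by
        intro g g'
        rw [← pow_add]
        apply hmod
        rw [hi, pow_add, hi, hi, map_mul, map_mul] }
  let Ψ : MonoidAlgebra A G →+* AdjoinRoot (cyclotomic N A) :=
    MonoidAlgebra.liftNCRingHom (AdjoinRoot.of _) ψ (fun _ _ => Commute.all _ _)
  have hΨ : ∀ g, Ψ (MonoidAlgebra.of A G g) = ζ ^ i g := by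
    intro g
    simp [Ψ, ψ]
  have hext : ∀ φ₁ φ₂ : MonoidAlgebra A G →+* k,
      (∀ g, φ₁ (MonoidAlgebra.of A G g) = φ₂ (MonoidAlgebra.of A G g)) → φ₁ = φ₂ := by
    intro φ₁ φ₂ h12
    apply MonoidAlgebra.ringHom_ext
    · intro x
      exact DFunLike.congr_fun (hsub (φ₁.comp (algebraMap A _)) (φ₂.comp (algebraMap A _))) x
    · exact h12
  have e1 : φ = ι₁.comp Ψ := by
    apply hext
    intro g
    rw [RingHom.comp_apply, hΨ, map_pow, AdjoinRoot.lift_root, hi]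
  have e2 : φ' = ι₂.comp Ψ := by
    apply hext
    intro g
    rw [RingHom.comp_apply, hΨ, map_pow, AdjoinRoot.lift_root, h, ← hi, ← pow_mul, ← pow_mul,
      mul_comm]
  have h01 : Ψ e = 0 ∨ Ψ e = 1 := IsIdempotentElem.iff_eq_zero_or_one.1 (he.map Ψ)
  rw [e1, e2, RingHom.comp_apply, RingHom.comp_apply]
  rcases h01 with h | h <;> rw [h] <;> simp

theorem exists_sep {A : Type*} [CommRing A] {k : Type*} [Field k] {G : Type*} [CommGroup G]
    (p q : ℕ) [Fact p.Prime] [Fact q.Prime] (hp2 : p ≠ 2) (hq2 : q ≠ 2) (hpq : p ≠ q) [CharP k p]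
    (hleg : quadraticChar (ZMod q) (p : ZMod q) = 1)
    (hunit : ∀ n : ℕ, ¬ p ∣ n → ∃ c : A, c * n = 1)
    (φ φ' : MonoidAlgebra A G →+* k) (a : ZMod q) (ha : quadraticChar (ZMod q) a = -1)
    (g : G) (hg : IsPrimitiveRoot (φ (MonoidAlgebra.of A G g)) q)
    (hg' : φ' (MonoidAlgebra.of A G g) = φ (MonoidAlgebra.of A G g) ^ a.val) :
    ∃ z : MonoidAlgebra A G, φ z = 1 ∧ φ' z = 0 := by
  have hp : p.Prime := Fact.out
  have hq : q.Prime := Fact.out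
  set ω := φ (MonoidAlgebra.of A G g) with hω
  have hr : ringChar (ZMod q) ≠ 2 := by rwa [ZMod.ringChar_zmod_n]
  have hrk : ringChar k ≠ 2 := by rwa [ringChar.eq k p]
  have h2k : (2 : k) ≠ 0 := Ring.two_ne_zero hrk
  set χ : MulChar (ZMod q) k := (quadraticChar (ZMod q)).ringHomComp (Int.castRingHom k) with hχ
  have hχa : ∀ x, χ x = ((quadraticChar (ZMod q) x : ℤ) : k) := fun x => rfl
  have hχq : χ.IsQuadratic := (quadraticChar_isQuadratic (ZMod q)).comp _
  have hχ1 : χ ≠ 1 := by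
    intro h
    have hau : IsUnit a := by
      rw [isUnit_iff_ne_zero]
      rintro rfl
      simp at ha
    have h1 : χ a = 1 := by rw [h, MulChar.one_apply hau]
    rw [hχa, ha] at h1
    push_cast at h1
    apply h2k
    linear_combination -h1
  set ψ := AddChar.zmodChar q hg.pow_eq_one with hψ
  have hψp : ψ.IsPrimitive := AddChar.zmodChar_primitive_of_primitive_root q hg
  have hcard : (Fintype.card (ZMod q) : k) ≠ 0 := by
    rw [ZMod.card, Ne, CharP.cast_eq_zero_iff k p, Nat.prime_dvd_prime_iff_eq hp hq]
    exact hpq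
  have hne : gaussSum χ ψ ≠ 0 := gaussSum_ne_zero_of_nontrivial hcard hχ1 hψp
  have hpu : IsUnit (p : ZMod q) := by
    rw [isUnit_iff_ne_zero]
    intro h
    rw [h] at hleg
    simp at hleg
  have hfrob : gaussSum χ ψ ^ p = gaussSum χ ψ := by
    rw [MulChar.IsQuadratic.gaussSum_frob p hpu hχq, hχa, hleg]
    simp
  obtain ⟨n, hn⟩ : ∃ n : ℕ, gaussSum χ ψ = n := by
    have := (Subfield.mem_bot_iff_pow_eq_self k p).2 hfrob
    rw [← ZMod.fieldRange_castHom_eq_bot p] at this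
    obtain ⟨m, hm⟩ := this
    refine ⟨m.val, ?_⟩
    rw [← hm]
    simp
  have hpn : ¬ p ∣ n := by
    rw [← CharP.cast_eq_zero_iff k p, ← hn]
    exact hne
  have hp2' : ¬ p ∣ 2 := by
    rw [Nat.prime_dvd_prime_iff_eq hp Nat.prime_two]; exact hp2
  obtain ⟨c, hc⟩ := hunit n hpn
  obtain ⟨d, hd⟩ := hunit 2 hp2'
  have hau : IsUnit a := by
    rw [isUnit_iff_ne_zero]
    rintro rfl
    simp at ha
  have hshift := gaussSum_mulShift χ ψ hau.unit
  rw [IsUnit.unit_spec, hχa, ha] at hshift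
  set y : MonoidAlgebra A G := ∑ s : ZMod q,
    ((quadraticChar (ZMod q) s : ℤ) : MonoidAlgebra A G) * MonoidAlgebra.of A G (g ^ s.val) with hy
  have hy1 : φ y = n := by
    rw [hy, map_sum, ← hn, gaussSum]
    refine Finset.sum_congr rfl fun s _ => ?_
    rw [map_mul, map_intCast, hχa, hψ, AddChar.zmodChar_apply, map_pow, map_pow]
  have hy2 : φ' y = -n := by
    have : φ' y = gaussSum χ (ψ.mulShift a) := by
      rw [hy, map_sum, gaussSum]
      refine Finset.sum_congr rfl fun s _ => ?_
      rw [map_mul, map_intCast, hχa, AddChar.mulShift_apply, hψ, map_pow, map_pow, hg', ← pow_mul]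
      congr 1
      rw [← AddChar.zmodChar_apply' hg.pow_eq_one]
      simp
    rw [this, ← hn, ← hshift]
    push_cast
    ring
  refine ⟨algebraMap A _ d * (algebraMap A _ c * y + 1), ?_, ?_⟩
  · have hcn := congrArg (fun t => φ (algebraMap A (MonoidAlgebra A G) t)) hc
    have hdn := congrArg (fun t => φ (algebraMap A (MonoidAlgebra A G) t)) hd
    simp only [map_mul, map_natCast, map_one] at hcn hdn
    rw [map_mul, map_add, map_mul, hy1, map_one, hcn]
    push_cast at hdn
    linear_combination hdn
  · have hcn := congrArg (fun t => φ' (algebraMap A (MonoidAlgebra A G) t)) hc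
    simp only [map_mul, map_natCast, map_one] at hcn
    rw [map_mul, map_add, map_mul, hy2, map_one]
    linear_combination -φ' (algebraMap A (MonoidAlgebra A G) d) * hcn

theorem exists_pair {A : Type*} [CommRing A] {k : Type*} [Field k] [IsAlgClosed k]
    {G : Type*} [CommGroup G] [Fintype G]
    (p q r : ℕ) [Fact p.Prime] [Fact q.Prime] (hp2 : p ≠ 2) (hq2 : q ≠ 2) (hpq : p ≠ q) [CharP k p]
    (hleg : quadraticChar (ZMod q) (p : ZMod q) = 1)
    (hunit : ∀ n : ℕ, ¬ p ∣ n → ∃ c : A, c * n = 1)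
    (f : A →+* k) (hsub : ∀ f g : A →+* k, f = g)
    (hprime : Prime (Polynomial.cyclotomic (q ^ r) A))
    (hexp : ∀ g : G, g ^ (q ^ r) = 1) (χ : G →* k) (hχ : χ ≠ 1) :
    ∃ φ φ' : MonoidAlgebra A G →+* k, (chr φ).ker = χ.ker ∧ (chr φ').ker = χ.ker ∧
      (∀ e, IsIdempotentElem e → φ e = φ' e) ∧ ∃ z, φ z = 1 ∧ φ' z = 0 := by
  have hp : p.Prime := Fact.out
  have hq : q.Prime := Fact.out
  have hr : ringChar (ZMod q) ≠ 2 := by rwa [ZMod.ringChar_zmod_n]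
  obtain ⟨a, ha⟩ := quadraticChar_exists_neg_one hr
  have ha0 : a ≠ 0 := by rintro rfl; simp at ha
  have hcop : a.val.Coprime q := by
    rw [Nat.coprime_comm, hq.coprime_iff_not_dvd, ← ZMod.natCast_eq_zero_iff]
    simpa using ha0
  let φ : MonoidAlgebra A G →+* k :=
    MonoidAlgebra.liftNCRingHom f χ (fun _ _ => Commute.all _ _)
  let φ' : MonoidAlgebra A G →+* k :=
    MonoidAlgebra.liftNCRingHom f (χ ^ a.val) (fun _ _ => Commute.all _ _)
  have hφ : ∀ g, φ (MonoidAlgebra.of A G g) = χ g := by intro g; simp [φ]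
  have hφ' : ∀ g, φ' (MonoidAlgebra.of A G g) = χ g ^ a.val := by intro g; simp [φ']
  have hroot : ∀ g, χ g ^ q ^ r = 1 := by intro g; rw [← map_pow, hexp, map_one]
  obtain ⟨g₀, hg₀⟩ : ∃ g, χ g ≠ 1 := by
    by_contra! h
    exact hχ (MonoidHom.ext h)
  have hqk : (q : k) ≠ 0 := by
    rw [Ne, CharP.cast_eq_zero_iff k p, Nat.prime_dvd_prime_iff_eq hp hq]
    exact hpq
  have : NeZero ((q ^ r : ℕ) : k) := ⟨by push_cast; exact pow_ne_zero _ hqk⟩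
  have : NeZero (q ^ r) := ⟨pow_ne_zero _ hq.ne_zero⟩
  obtain ⟨ω, hω⟩ := HasEnoughRootsOfUnity.exists_primitiveRoot k (q ^ r)
  refine ⟨φ, φ', ?_, ?_, ?_, ?_⟩
  · ext g
    rw [MonoidHom.mem_ker, MonoidHom.mem_ker, chr_apply, hφ]
  · ext g
    rw [MonoidHom.mem_ker, MonoidHom.mem_ker, chr_apply, hφ']
    constructor
    · intro h
      have h1 : orderOf (χ g) ∣ a.val := orderOf_dvd_of_pow_eq_one h
      have h2 : orderOf (χ g) ∣ q ^ r := orderOf_dvd_of_pow_eq_one (hroot g)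
      exact orderOf_eq_one_iff.1 (Nat.eq_one_of_dvd_coprimes (hcop.pow_right r) h1 h2)
    · intro h; rw [h, one_pow]
  · intro e he
    refine idem_agree (q ^ r) hexp hsub hprime ω hω a.val (hcop.pow_right r) φ φ' ?_ e he
    intro g
    rw [hφ, hφ']
  · obtain ⟨j, -, hj⟩ := (Nat.dvd_prime_pow hq).1 (orderOf_dvd_of_pow_eq_one (hroot g₀))
    have hj0 : j ≠ 0 := by
      rintro rfl
      rw [pow_zero, orderOf_eq_one_iff] at hj
      exact hg₀ hj
    obtain ⟨j, rfl⟩ := Nat.exists_eq_succ_of_ne_zero hj0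
    have hpr : IsPrimitiveRoot (χ g₀) (q ^ (j + 1)) := hj ▸ IsPrimitiveRoot.orderOf _
    have hpr' : IsPrimitiveRoot (χ (g₀ ^ q ^ j)) q := by
      rw [map_pow]
      exact hpr.pow (pow_pos hq.pos _) (pow_succ _ _)
    refine exists_sep p q hp2 hq2 hpq hleg hunit φ φ' a ha (g₀ ^ q ^ j) ?_ ?_
    · rw [hφ]; exact hpr'
    · rw [hφ, hφ']

end Pair

section Main

theorem hom_ext {A : Type*} [CommRing A] {k : Type*} [Field k] {G : Type*} [CommGroup G] [Fintype G]
    (hsub : ∀ f g : A →+* k, f = g) (φ₁ φ₂ : MonoidAlgebra A G →+* k)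
    (h : ∀ g, chr φ₁ g = chr φ₂ g) : φ₁ = φ₂ := by
  apply MonoidAlgebra.ringHom_ext
  · intro x
    exact DFunLike.congr_fun (hsub (φ₁.comp (algebraMap A _)) (φ₂.comp (algebraMap A _))) x
  · exact h

theorem exists_eps {A : Type*} [CommRing A] {k : Type*} [Field k]
    {G : Type*} [CommGroup G] [Fintype G]
    (p q r : ℕ) (hp : p.Prime) (hq : q.Prime) (hp2 : p ≠ 2) (hq2 : q ≠ 2) (hpq : p ≠ q) [CharP k p]
    (hord : orderOf ((p : ZMod (q ^ 2))) = q * (q - 1) / 2)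
    (hsub : ∀ f g : A →+* k, f = g)
    (hexp : ∀ g : G, g ^ (q ^ r) = 1) (x : MonoidAlgebra A G) (H : Subgroup G) :
    (∀ φ : MonoidAlgebra A G →+* k, (chr φ).ker = H → φ x ≠ 0) ∨
    (∀ φ : MonoidAlgebra A G →+* k, (chr φ).ker = H → φ x ≠ 1) ∨
    (∀ φ : MonoidAlgebra A G →+* k, (chr φ).ker = H → φ x ≠ -1) := by
  by_contra! hcon
  obtain ⟨⟨φ₀, k0, e0⟩, ⟨φ₁, k1, e1⟩, ⟨φ₂, k2, e2⟩⟩ := hcon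
  have : Fact p.Prime := ⟨hp⟩
  have hodd : Odd p := hp.odd_of_ne_two hp2
  have h2k : (2 : k) ≠ 0 := Ring.two_ne_zero (by rwa [ringChar.eq k p])
  have key : ∀ φ φ' : MonoidAlgebra A G →+* k, ∀ s : ℕ, (∀ g, chr φ g = chr φ' g ^ (p ^ s)) →
      φ x = φ' x ^ (p ^ s) := by
    intro φ φ' s h
    have : φ = (iterateFrobenius k p s).comp φ' := by
      apply hom_ext hsub
      intro g
      rw [h g, chr_apply, chr_apply, RingHom.comp_apply, iterateFrobenius_def]
    conv_lhs => rw [this]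
    rw [RingHom.comp_apply, iterateFrobenius_def]
  have hps : ∀ s, p ^ s ≠ 0 := fun s => pow_ne_zero _ hp.ne_zero
  rcases frob_trichotomy p q r hq hq2 ((Nat.coprime_primes hp hq).2 hpq) hord hexp (chr φ₀) (chr φ₁)
    (chr φ₂) (k1.trans k0.symm) (k2.trans k0.symm) with ⟨s, h⟩ | ⟨s, h⟩ | ⟨s, h⟩
  · have := key _ _ s h
    rw [e1, e0, zero_pow (hps s)] at this
    exact one_ne_zero this
  · have := key _ _ s h
    rw [e2, e0, zero_pow (hps s)] at this
    exact one_ne_zero (neg_eq_zero.1 this)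
  · have := key _ _ s h
    rw [e1, e2, (hodd.pow).neg_one_pow] at this
    apply h2k
    linear_combination this

theorem abstract_main {A : Type*} [CommRing A] {k : Type*} [Field k] [IsAlgClosed k]
    (p q : ℕ) (hp : p.Prime) (hq : q.Prime) (hp2 : p ≠ 2) (hq2 : q ≠ 2) (hpq : p ≠ q)
    (hord : orderOf ((p : ZMod (q ^ 2))) = q * (q - 1) / 2)
    [CharP k p]
    (hunit : ∀ n : ℕ, ¬ p ∣ n → ∃ c : A, c * n = 1)
    (f : A →+* k) (hf : ∀ a, ¬ IsUnit a → f a = 0) (hsub : ∀ f g : A →+* k, f = g)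
    (hprime : ∀ n, n ≠ 0 → Prime (Polynomial.cyclotomic n A))
    (G : Type*) [CommGroup G] [Fintype G]
    (r : ℕ) (hr : 1 ≤ r) (hexp : Monoid.exponent G = q ^ r) :
    (IsFeeblyCleanRing (MonoidAlgebra A G) ∧ ¬ IsCleanRing (MonoidAlgebra A G)) ∧
    (IsWeaklyCleanRing (MonoidAlgebra A G) ↔ (IsCyclic G ∧ r = 1)) := by
  classical
  have hpF : Fact p.Prime := ⟨hp⟩
  have hqF : Fact q.Prime := ⟨hq⟩
  have hexp' : ∀ g : G, g ^ (q ^ r) = 1 := fun g => hexp ▸ Monoid.pow_exponent_eq_one g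
  have hc : ∀ K : Subgroup G, ∃ c : A, c * (Nat.card K : A) = 1 := by
    intro K
    apply hunit
    intro hdvd
    obtain ⟨x, hx⟩ := exists_prime_orderOf_dvd_card' p (hdvd.trans K.card_subgroup_dvd_card)
    have h1 : p ∣ q ^ r := hx ▸ orderOf_dvd_of_pow_eq_one (hexp' x)
    exact hpq ((Nat.prime_dvd_prime_iff_eq hp hq).1 (hp.dvd_of_dvd_pow h1))
  obtain ⟨E, hEi, hEo, hEφ⟩ := exists_idem (A := A) k hc
  have hU : ∀ u : MonoidAlgebra A G, (∀ φ : MonoidAlgebra A G →+* k, φ u ≠ 0) → IsUnit u :=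
    fun u hu => isUnit_of_forall f hf u hu
  have heps := fun x H => exists_eps (A := A) (k := k) p q r hp hq hp2 hq2 hpq hord hsub hexp' x H
  have hpair := fun χ hχ => exists_pair (A := A) (k := k) p q r hp2 hq2 hpq
    (legendre_one p q hq2 hord) hunit f hsub (hprime _ (pow_ne_zero _ hq.ne_zero)) hexp' χ hχ
  have hqk : (q : k) ≠ 0 := by
    rw [Ne, CharP.cast_eq_zero_iff k p, Nat.prime_dvd_prime_iff_eq hp hq]
    exact hpq
  have : NeZero ((Monoid.exponent G : ℕ) : k) :=
    ⟨by rw [hexp]; push_cast; exact pow_ne_zero _ hqk⟩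
  have hsepχ : ∀ g : G, g ≠ 1 → ∃ χ : G →* k, χ g ≠ 1 := by
    intro g hg
    obtain ⟨χ, hχ⟩ := CommGroup.exists_apply_ne_one_of_hasEnoughRootsOfUnity G k hg
    refine ⟨(Units.coeHom k).comp χ, ?_⟩
    simpa using hχ
  have hqcard : q ∣ Nat.card G :=
    (dvd_pow_self q (by omega)).trans (hexp ▸ Group.exponent_dvd_nat_card)
  obtain ⟨g₁, hg₁⟩ := exists_prime_orderOf_dvd_card' q hqcard
  have hg₁1 : g₁ ≠ 1 := by
    rintro rfl
    rw [orderOf_one] at hg₁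
    exact hq.one_lt.ne hg₁
  obtain ⟨χ₁, hχ₁⟩ := hsepχ g₁ hg₁1
  have hχ₁' : χ₁ ≠ 1 := by rintro rfl; exact hχ₁ rfl
  have hidem01 : ∀ (φ : MonoidAlgebra A G →+* k) (e : MonoidAlgebra A G),
      IsIdempotentElem e → φ e = 0 ∨ φ e = 1 := fun φ e he =>
    IsIdempotentElem.iff_eq_zero_or_one.1 (he.map φ)
  have hune : ∀ (φ : MonoidAlgebra A G →+* k) (u : MonoidAlgebra A G), IsUnit u → φ u ≠ 0 :=
    fun φ u hu => (hu.map φ).ne_zero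
  refine ⟨⟨?_, ?_⟩, ?_, ?_⟩
  · -- feebly clean
    intro x
    set S : Set (Subgroup G) := {H | ¬ (∀ φ : MonoidAlgebra A G →+* k, (chr φ).ker = H → φ x ≠ 0) ∧
      (∀ φ : MonoidAlgebra A G →+* k, (chr φ).ker = H → φ x ≠ 1)} with hS
    set T : Set (Subgroup G) := {H | ¬ (∀ φ : MonoidAlgebra A G →+* k, (chr φ).ker = H → φ x ≠ 0) ∧
      ¬ (∀ φ : MonoidAlgebra A G →+* k, (chr φ).ker = H → φ x ≠ 1)} with hT
    have hST : Disjoint S T := by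
      rw [Set.disjoint_left]
      intro H h1 h2
      exact h2.2 h1.2
    refine ⟨x - E S + E T, E S, E T, ?_, hEi S, hEi T, hEo S T hST, by ring⟩
    apply hU
    intro φ
    rw [map_add, map_sub, hEφ, hEφ]
    by_cases h0 : ∀ φ' : MonoidAlgebra A G →+* k, (chr φ').ker = (chr φ).ker → φ' x ≠ 0
    · rw [if_neg (fun h => h.1 h0), if_neg (fun h => h.1 h0)]
      simpa using h0 φ rfl
    by_cases h1 : ∀ φ' : MonoidAlgebra A G →+* k, (chr φ').ker = (chr φ).ker → φ' x ≠ 1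
    · rw [if_pos ⟨h0, h1⟩, if_neg (fun h => h.2 h1)]
      simpa [sub_eq_zero] using h1 φ rfl
    · rw [if_neg (fun h => h1 h.2), if_pos ⟨h0, h1⟩]
      have h2 := ((heps x (chr φ).ker).resolve_left h0).resolve_left h1 φ rfl
      intro h
      apply h2
      linear_combination h
  · -- not clean
    intro hclean
    obtain ⟨φ, φ', -, -, hag, z, hz1, hz0⟩ := hpair χ₁ hχ₁'
    obtain ⟨u, e, hu, he, hz⟩ := hclean z
    have h1 := hune φ u hu
    have h2 := hune φ' u hu
    have hu' : u = z - e := by rw [hz]; ring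
    rw [hu', map_sub] at h1 h2
    rw [hz1, hag e he] at h1
    rw [hz0] at h2
    rcases hidem01 φ' e he with h | h <;> simp [h] at h1 h2
  · -- weakly clean implies cyclic of order q
    intro hw
    have hsame : ∀ χ χ' : G →* k, χ ≠ 1 → χ' ≠ 1 → χ.ker = χ'.ker := by
      intro χ χ' hχ hχ'
      by_contra hne
      obtain ⟨φ, φ', hk, hk', hag, z, hz1, hz0⟩ := hpair χ hχ
      obtain ⟨ρ, ρ', hl, hl', hag', w, hw1, hw0⟩ := hpair χ' hχ'
      obtain ⟨u, e, hu, he, hx⟩ := hw (z * E {χ.ker} - w * E {χ'.ker})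
      have hne' : χ'.ker ≠ χ.ker := fun h => hne h.symm
      rcases hx with hx | hx
      · have hu' : u = (z * E {χ.ker} - w * E {χ'.ker}) - e := by rw [hx]; ring
        have h1 := hune φ u hu
        have h2 := hune φ' u hu
        rw [hu', map_sub, map_sub, map_mul, map_mul, hEφ, hEφ] at h1 h2
        rw [hag e he, hk, hz1] at h1
        rw [hk', hz0] at h2
        rcases hidem01 φ' e he with h | h <;> simp [h, hne] at h1 h2
      · have hu' : u = (z * E {χ.ker} - w * E {χ'.ker}) + e := by rw [hx]; ring
        have h1 := hune ρ u hu
        have h2 := hune ρ' u hu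
        rw [hu', map_add, map_sub, map_mul, map_mul, hEφ, hEφ] at h1 h2
        rw [hag' e he, hl, hw1] at h1
        rw [hl', hw0] at h2
        rcases hidem01 ρ' e he with h | h <;> simp [h, hne'] at h1 h2
    have hinj : Function.Injective χ₁ := by
      rw [← MonoidHom.ker_eq_bot_iff, Subgroup.eq_bot_iff_forall]
      intro g hg
      by_contra hg1
      obtain ⟨χ, hχ⟩ := hsepχ g hg1
      rw [hsame χ₁ χ hχ₁' (by rintro rfl; exact hχ rfl)] at hg
      exact hχ hg
    refine ⟨isCyclic_of_injective_ringHom χ₁ hinj, ?_⟩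
    by_contra hr1
    have hqne : χ₁ ^ q ≠ 1 := by
      intro h
      have h1 : Monoid.exponent G ∣ q := by
        rw [Monoid.exponent_dvd_iff_forall_pow_eq_one]
        intro g
        apply hinj
        rw [map_pow, map_one, ← MonoidHom.pow_apply, h, MonoidHom.one_apply]
      rw [hexp] at h1
      have h2 : q ^ 2 ∣ q ^ 1 := by
        rw [pow_one]; exact (pow_dvd_pow q (by omega)).trans h1
      have := (Nat.pow_dvd_pow_iff_le_right hq.one_lt).1 h2
      omega
    have hmem : g₁ ∈ (χ₁ ^ q).ker := by
      rw [MonoidHom.mem_ker, MonoidHom.pow_apply, ← map_pow, ← hg₁, pow_orderOf_eq_one, map_one]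
    rw [hsame _ χ₁ hqne hχ₁'] at hmem
    exact hχ₁ hmem
  · -- cyclic of order q is weakly clean
    rintro ⟨hcyc, rfl⟩ x
    have hcard : Nat.card G = q := by
      rw [← IsCyclic.exponent_eq_card, hexp, pow_one]
    have hbt : ∀ H : Subgroup G, H = ⊥ ∨ H = ⊤ := by
      have : Fact (Nat.card G).Prime := ⟨hcard ▸ hq⟩
      exact fun H => H.eq_bot_or_eq_top_of_prime_card
    have hbt' : (⊤ : Subgroup G) ≠ ⊥ := by
      intro h
      have : g₁ ∈ (⊥ : Subgroup G) := h ▸ Subgroup.mem_top g₁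
      exact hg₁1 (Subgroup.mem_bot.1 this)
    have htop : ∀ φ φ' : MonoidAlgebra A G →+* k, (chr φ).ker = ⊤ → (chr φ').ker = ⊤ → φ = φ' := by
      intro φ φ' h h'
      apply hom_ext hsub
      intro g
      have h1 : g ∈ (chr φ).ker := h ▸ Subgroup.mem_top g
      have h2 : g ∈ (chr φ').ker := h' ▸ Subgroup.mem_top g
      rw [MonoidHom.mem_ker] at h1 h2
      rw [h1, h2]
    -- one extra lemma: the trivial component can always be adjusted
    have hadj : ∀ c : k, c ≠ 0 →
        (∀ φ : MonoidAlgebra A G →+* k, (chr φ).ker = ⊤ → φ x ≠ 0) ∨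
        (∀ φ : MonoidAlgebra A G →+* k, (chr φ).ker = ⊤ → φ x ≠ c) := by
      intro c hc0
      by_contra! hcon
      obtain ⟨⟨φ, h1, h2⟩, ⟨φ', h3, h4⟩⟩ := hcon
      rw [htop φ φ' h1 h3, h4] at h2
      exact hc0 h2
    have hplus : (∀ φ : MonoidAlgebra A G →+* k, (chr φ).ker = ⊥ → φ x ≠ 0) ∨
        (∀ φ : MonoidAlgebra A G →+* k, (chr φ).ker = ⊥ → φ x ≠ 1) →
        ∃ S, ∀ φ : MonoidAlgebra A G →+* k, φ (x - E S) ≠ 0 := by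
      intro hb
      refine ⟨{H | ¬ (∀ φ : MonoidAlgebra A G →+* k, (chr φ).ker = H → φ x ≠ 0)}, fun φ => ?_⟩
      rw [map_sub, hEφ]
      split_ifs with hmem
      · rw [sub_ne_zero]
        rcases hbt (chr φ).ker with h | h
        · rw [h] at hmem
          exact hb.resolve_left hmem φ h
        · rw [h] at hmem
          exact (hadj 1 one_ne_zero).resolve_left hmem φ h
      · rw [sub_zero]
        simp only [Set.mem_setOf_eq, not_not] at hmem
        exact hmem φ rfl
    have hminus : (∀ φ : MonoidAlgebra A G →+* k, (chr φ).ker = ⊥ → φ x ≠ 0) ∨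
        (∀ φ : MonoidAlgebra A G →+* k, (chr φ).ker = ⊥ → φ x ≠ -1) →
        ∃ S, ∀ φ : MonoidAlgebra A G →+* k, φ (x + E S) ≠ 0 := by
      intro hb
      refine ⟨{H | ¬ (∀ φ : MonoidAlgebra A G →+* k, (chr φ).ker = H → φ x ≠ 0)}, fun φ => ?_⟩
      rw [map_add, hEφ]
      split_ifs with hmem
      · rw [Ne, add_eq_zero_iff_eq_neg]
        rcases hbt (chr φ).ker with h | h
        · rw [h] at hmem
          exact hb.resolve_left hmem φ h
        · rw [h] at hmem
          exact (hadj (-1) (neg_ne_zero.2 one_ne_zero)).resolve_left hmem φ h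
      · rw [add_zero]
        simp only [Set.mem_setOf_eq, not_not] at hmem
        exact hmem φ rfl
    rcases heps x ⊥ with h | h | h
    · obtain ⟨S, hS⟩ := hplus (Or.inl h)
      exact ⟨x - E S, E S, hU _ hS, hEi S, Or.inl (by ring)⟩
    · obtain ⟨S, hS⟩ := hplus (Or.inr h)
      exact ⟨x - E S, E S, hU _ hS, hEi S, Or.inl (by ring)⟩
    · obtain ⟨S, hS⟩ := hminus (Or.inr h)
      exact ⟨x + E S, E S, hU _ hS, hEi S, Or.inr (by ring)⟩

end Main

end FeeblyAux

open FeeblyAux in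
/-- Let `p, q` be distinct odd primes with `ord_{q²}(p) = q(q-1)/2` and let `G` be a
finite abelian group with `exp(G) = q^r`, `r ≥ 1`. Then `ℤ_(p)[G]` is feebly clean but
not clean, and `ℤ_(p)[G]` is weakly clean iff `G` is cyclic and `r = 1`. -/
theorem feeblyClean_not_clean_and_weaklyClean_iff_of_orderOf_sq
    (p q : ℕ) (hp : p.Prime) (hq : q.Prime) (hp2 : p ≠ 2) (hq2 : q ≠ 2) (hpq : p ≠ q)
    (hord : orderOf ((p : ZMod (q ^ 2))) = q * (q - 1) / 2)
    [hP : (Ideal.span {(p : ℤ)}).IsPrime]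
    (G : Type*) [CommGroup G] [Fintype G]
    (r : ℕ) (hr : 1 ≤ r) (hexp : Monoid.exponent G = q ^ r) :
    (IsFeeblyCleanRing (MonoidAlgebra (Localization.AtPrime (Ideal.span {(p : ℤ)})) G) ∧
      ¬ IsCleanRing (MonoidAlgebra (Localization.AtPrime (Ideal.span {(p : ℤ)})) G)) ∧
    (IsWeaklyCleanRing (MonoidAlgebra (Localization.AtPrime (Ideal.span {(p : ℤ)})) G) ↔
      (IsCyclic G ∧ r = 1)) := by
  have hpF : Fact p.Prime := ⟨hp⟩
  set I : Ideal ℤ := Ideal.span {(p : ℤ)} with hI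
  let k := AlgebraicClosure (ZMod p)
  have hmemI : ∀ n : ℤ, n ∈ I ↔ (p : ℤ) ∣ n := fun n => Ideal.mem_span_singleton
  have hk : ∀ n : ℤ, n ∈ I ↔ (n : k) = 0 := by
    intro n
    rw [hmemI, CharP.intCast_eq_zero_iff k p]
  have hunits : ∀ y : I.primeCompl, IsUnit (Int.castRingHom k y) := by
    intro y
    rw [isUnit_iff_ne_zero]
    intro h
    exact y.2 ((hk y).2 h)
  let f : Localization.AtPrime I →+* k := IsLocalization.lift (M := I.primeCompl) hunits
  refine abstract_main (A := Localization.AtPrime I) (k := k) p q hp hq hp2 hq2 hpq hord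
    ?_ f ?_ ?_ ?_ G r hr hexp
  · intro n hn
    have h1 : IsUnit (algebraMap ℤ (Localization.AtPrime I) (n : ℤ)) := by
      apply IsLocalization.map_units (M := I.primeCompl) (Localization.AtPrime I) ⟨(n : ℤ), ?_⟩
      intro h
      exact hn (Int.natCast_dvd_natCast.1 ((hmemI n).1 h))
    obtain ⟨c, hc⟩ := h1.exists_left_inv
    exact ⟨c, by simpa using hc⟩
  · intro a ha
    have h1 : a ∈ IsLocalRing.maximalIdeal (Localization.AtPrime I) := ha
    rw [← IsLocalization.AtPrime.map_eq_maximalIdeal I] at h1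
    have h2 : Ideal.map (algebraMap ℤ (Localization.AtPrime I)) I ≤ RingHom.ker f := by
      rw [Ideal.map_le_iff_le_comap]
      intro n hn
      rw [Ideal.mem_comap, RingHom.mem_ker, IsLocalization.lift_eq]
      exact (hk n).1 hn
    exact h2 h1
  · intro f g
    apply IsLocalization.ringHom_ext I.primeCompl
    exact RingHom.ext_int _ _
  · intro n hn
    have hz : Irreducible (Polynomial.cyclotomic n ℤ) :=
      Polynomial.cyclotomic.irreducible (Nat.pos_of_ne_zero hn)
    have h1 := ((Polynomial.cyclotomic.monic n ℤ).irreducible_iff_irreducible_map_fraction_map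
      (K := FractionRing ℤ)).1 hz
    rw [Polynomial.map_cyclotomic] at h1
    rw [← Polynomial.map_cyclotomic n (algebraMap (Localization.AtPrime I) (FractionRing ℤ)),
      ← (Polynomial.cyclotomic.monic n _).irreducible_iff_irreducible_map_fraction_map] at h1
    exact h1.prime
end
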